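/- arXiv:2208.14712 — 2 statements merged into one kernel-verified Lean document; each statement's English description precedes it below -/
import Mathlib

section
/- Let k be a field, A a finite-dimensional self-injective k-algebra, M a finitely generated self-orthogonal generator for A-mod, and Λ = End_A(M), so that for every A-module X the group Hom_A(M,X) is a Λ-module via composition. Then the functor Hom_A(M,-) restricts to an equivalence of categories from the full subcategory 𝒢 of A-Mod onto the full subcategory of Gorenstein-projective Λ-modules, and from 𝒢₀ onto the full subcategory of finitely generated Gorenstein-projective Λ-modules. (Lemma 3.11(2).) -/
open CategoryTheory
/-! ## Additive closure classes -/

section AddClosure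

variable (A : Type) [Ring A]

/-- `X ∈ add M`: `X` is a direct summand of a finite direct sum of copies of `M`. -/
def MemAdd (M X : ModuleCat.{0} A) : Prop :=
  ∃ (n : ℕ) (Y : ModuleCat.{0} A), Nonempty ((↥X × ↥Y) ≃ₗ[A] (Fin n → ↥M))

/-- `X ∈ Add M`: `X` is a direct summand of an arbitrary direct sum of copies of `M`. -/
def MemAddBig (M X : ModuleCat.{0} A) : Prop :=
  ∃ (I : Type) (Y : ModuleCat.{0} A), Nonempty ((↥X × ↥Y) ≃ₗ[A] (I →₀ ↥M))

/-- a morphism of `A`-modules factors through a projective module -/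
def FactorsThroughProj {X Y : ModuleCat.{0} A} (f : X ⟶ Y) : Prop :=
  ∃ (P : ModuleCat.{0} A) (_ : Module.Projective A P) (g : X ⟶ P) (h : P ⟶ Y), f = g ≫ h

/-- a morphism of `A`-modules factors through a module in `Add M` -/
def FactorsThroughAddM (M : ModuleCat.{0} A) {X Y : ModuleCat.{0} A} (f : X ⟶ Y) : Prop :=
  ∃ (Z : ModuleCat.{0} A) (_ : MemAddBig A M Z) (g : X ⟶ Z) (h : Z ⟶ Y), f = g ≫ h

/-- `X ∈ add M` for unbundled modules. -/
def MemAddPlain (M : Type) [AddCommGroup M] [Module A M]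
    (X : Type) [AddCommGroup X] [Module A X] : Prop :=
  ∃ (n : ℕ) (Y : ModuleCat.{0} A), Nonempty ((X × ↥Y) ≃ₗ[A] (Fin n → M))

end AddClosure

/-! ## Ext vanishing -/

section ExtDefs

variable (A : Type) [Ring A]

/-- vanishing of `Ext^n_A(X, Y)` -/
noncomputable def extZero (n : ℕ) (X Y : ModuleCat.{0} A) : Prop :=
  Subsingleton (((Ext ℤ (ModuleCat.{0} A) n).obj (Opposite.op X)).obj Y)

/-- `M` is self-orthogonal: `Ext^n_A(M,M) = 0` for all `n ≥ 1`. -/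
noncomputable def SelfOrthogonal (M : ModuleCat.{0} A) : Prop :=
  ∀ n : ℕ, 1 ≤ n → extZero A n M M

/-- `M` is a generator for `A`-mod: `A ∈ add M`. -/
def IsGen (M : ModuleCat.{0} A) : Prop :=
  MemAdd A M (ModuleCat.of A A)

/-- membership in the `M`-Gorenstein subcategory `𝒢`:
`Ext^n_A(M,X) = 0 = Ext^n_A(X,M)` for all `n ≥ 1`. -/
noncomputable def MemG (M X : ModuleCat.{0} A) : Prop :=
  ∀ n : ℕ, 1 ≤ n → extZero A n M X ∧ extZero A n X M

end ExtDefs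

/-! ## Gorenstein homological algebra -/

section Gorenstein

variable (B : Type) [Ring B]

/-- `G` is a Gorenstein-projective `B`-module: `G` is the kernel at degree `0` of an
exact complex `P•` of projective modules such that `Hom_B(P•, B)` is exact. -/
def IsGProj (G : ModuleCat.{0} B) : Prop :=
  ∃ (P : ℤ → ModuleCat.{0} B) (d : ∀ i : ℤ, P i ⟶ P (i + 1)),
    (∀ i, Module.Projective B (P i)) ∧
    (∀ i, LinearMap.range (d i).hom = LinearMap.ker (d (i + 1)).hom) ∧
    (∀ (i : ℤ) (φ : P (i + 1) ⟶ ModuleCat.of B B),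
      d i ≫ φ = 0 ↔ ∃ ψ : P (i + 1 + 1) ⟶ ModuleCat.of B B, φ = d (i + 1) ≫ ψ) ∧
    Nonempty (↥G ≃ₗ[B] ↥(LinearMap.ker (d 0).hom))

/-- `G` is a Gorenstein-injective `B`-module: `G` is the kernel at degree `0` of an
exact complex `I•` of injective modules such that `Hom_B(E, I•)` is exact for every
injective module `E`. -/
def IsGInj (G : ModuleCat.{0} B) : Prop :=
  ∃ (I : ℤ → ModuleCat.{0} B) (d : ∀ i : ℤ, I i ⟶ I (i + 1)),
    (∀ i, Module.Injective B ↥(I i)) ∧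
    (∀ i, LinearMap.range (d i).hom = LinearMap.ker (d (i + 1)).hom) ∧
    (∀ (E : ModuleCat.{0} B), Module.Injective B ↥E →
      ∀ (i : ℤ) (φ : E ⟶ I (i + 1)), φ ≫ d (i + 1) = 0 ↔ ∃ ψ : E ⟶ I i, φ = ψ ≫ d i) ∧
    Nonempty (↥G ≃ₗ[B] ↥(LinearMap.ker (d 0).hom))

/-- vanishing of `Ext^n_B(X, Y)` -/
noncomputable def extZero' (n : ℕ) (X Y : ModuleCat.{0} B) : Prop :=
  Subsingleton (((Ext ℤ (ModuleCat.{0} B) n).obj (Opposite.op X)).obj Y)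

/-- `B` is virtually Gorenstein. -/
noncomputable def VirtGorenstein : Prop :=
  ∀ X : ModuleCat.{0} B,
    (∀ G : ModuleCat.{0} B, IsGProj B G → ∀ n : ℕ, 1 ≤ n → extZero' B n G X) ↔
    (∀ E : ModuleCat.{0} B, IsGInj B E → ∀ n : ℕ, 1 ≤ n → extZero' B n X E)

/-- `X` has projective dimension at most `n`. -/
def ProjDimLE : ℕ → ModuleCat.{0} B → Prop
  | 0, X => Module.Projective B X
  | n + 1, X => ∃ (P : ModuleCat.{0} B) (_ : Module.Projective B P) (g : P ⟶ X),
      Function.Surjective g ∧ ProjDimLE n (ModuleCat.of B ↥(LinearMap.ker g.hom))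

/-- `X` has finite projective dimension. -/
def FiniteProjDim (X : ModuleCat.{0} B) : Prop :=
  ∃ n, ProjDimLE B n X

/-- `X` is compactly filtered: it carries an exhaustive ascending chain of submodules
whose subquotients are finitely generated of finite projective dimension. -/
def CompactlyFiltered (X : ModuleCat.{0} B) : Prop :=
  ∃ F : ℕ → Submodule B ↥X,
    Monotone F ∧ F 0 = ⊥ ∧ (⨆ n, F n) = ⊤ ∧
      ∀ n, Module.Finite B
          (↥(F (n + 1)) ⧸ (Submodule.comap (F (n + 1)).subtype (F n))) ∧
        FiniteProjDim B (ModuleCat.of B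
          (↥(F (n + 1)) ⧸ (Submodule.comap (F (n + 1)).subtype (F n))))

/-- `X` is countably generated. -/
def CountablyGenerated (X : ModuleCat.{0} B) : Prop :=
  ∃ s : Set ↥X, s.Countable ∧ Submodule.span B s = ⊤

/-- the subgroup of `Hom_B(X,Y)` generated by morphisms factoring through projectives. -/
def projSub (X Y : ModuleCat.{0} B) : AddSubgroup (X ⟶ Y) :=
  AddSubgroup.closure {f : X ⟶ Y |
    ∃ (P : ModuleCat.{0} B) (_ : Module.Projective B P) (g : X ⟶ P) (h : P ⟶ Y), f = g ≫ h}

/-- the stable Hom-group `StHom_B(X,Y)` modulo projectives. -/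
def StHomP (X Y : ModuleCat.{0} B) : Type :=
  (X ⟶ Y) ⧸ projSub B X Y

instance (X Y : ModuleCat.{0} B) : AddCommGroup (StHomP B X Y) :=
  inferInstanceAs (AddCommGroup ((X ⟶ Y) ⧸ projSub B X Y))

/-- postcomposition as an additive map on Hom-groups. -/
def postCompHom' {Y Z : ModuleCat.{0} B} (X : ModuleCat.{0} B) (h : Y ⟶ Z) :
    (X ⟶ Y) →+ (X ⟶ Z) :=
  AddMonoidHom.mk' (fun f => f ≫ h) (fun f g => by simp [Preadditive.add_comp])

/-- postcomposition descends to the projectively stable Hom-groups. -/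
def stpPostComp (X : ModuleCat.{0} B) {Y Z : ModuleCat.{0} B} (h : Y ⟶ Z) :
    StHomP B X Y →+ StHomP B X Z :=
  QuotientAddGroup.map _ _ (postCompHom' B X h) (by
    rw [projSub, AddSubgroup.closure_le]
    rintro f ⟨P, hP, u, v, rfl⟩
    rw [SetLike.mem_coe, AddSubgroup.mem_comap]
    exact AddSubgroup.subset_closure ⟨P, hP, u, v ≫ h, by simp [postCompHom']⟩)

/-- the canonical map `⊕ᵢ StHom_B(X, Y i) → StHom_B(X, ⊕ᵢ Y i)`. -/
noncomputable def stpCanonMap (X : ModuleCat.{0} B) (I : Type) (Y : I → ModuleCat.{0} B) :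
    DirectSum I (fun i => StHomP B X (Y i)) →+ StHomP B X (∐ Y) :=
  letI : DecidableEq I := Classical.decEq I
  DirectSum.toAddMonoid fun i => stpPostComp B X (Limits.Sigma.ι Y i)

/-- `G` is compactly Gorenstein-projective: `G` is Gorenstein-projective and compact in
the stable category of Gorenstein-projective modules. -/
noncomputable def CompactlyGProj (G : ModuleCat.{0} B) : Prop :=
  IsGProj B G ∧
    ∀ (I : Type) (Z : I → ModuleCat.{0} B), (∀ i, IsGProj B (Z i)) →
      Function.Bijective (stpCanonMap B G I Z)

/-- Condition (CI): the direct sum of countably many finitely generated modules of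
finite projective dimension is right `Ext`-orthogonal to all countably generated,
compactly Gorenstein-projective modules. -/
noncomputable def CondCI : Prop :=
  ∀ Y : ℕ → ModuleCat.{0} B,
    (∀ n, Module.Finite B (Y n) ∧ FiniteProjDim B (Y n)) →
      ∀ G : ModuleCat.{0} B, CountablyGenerated B G → CompactlyGProj B G →
        ∀ i : ℕ, 1 ≤ i → extZero' B i G (∐ Y)

/-- Condition (CII): every compactly Gorenstein-projective, compactly filtered module
is projective. -/
noncomputable def CondCII : Prop :=
  ∀ X : ModuleCat.{0} B, CompactlyGProj B X → CompactlyFiltered B X →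
    Module.Projective B X

/-- `B` has infinite dominant dimension: there is an exact sequence
`0 → B → I⁰ → I¹ → ⋯` with all `Iⁿ` projective-injective. -/
def InfiniteDomDim : Prop :=
  ∃ (I : ℕ → ModuleCat.{0} B) (d0 : ModuleCat.of B B ⟶ I 0) (d : ∀ n, I n ⟶ I (n + 1)),
    (∀ n, Module.Injective B ↥(I n) ∧ Module.Projective B ↥(I n)) ∧
    Function.Injective d0 ∧ LinearMap.range d0.hom = LinearMap.ker (d 0).hom ∧
    ∀ n, LinearMap.range (d n).hom = LinearMap.ker (d (n + 1)).hom

/-- `B` has finite finitistic dimension. -/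
def FiniteFinitisticDim : Prop :=
  ∃ d : ℕ, ∀ X : ModuleCat.{0} B, Module.Finite B X → FiniteProjDim B X → ProjDimLE B d X

end Gorenstein

/-! ## The endomorphism algebra `Λ = End_A(M)` (with composition written on the right,
i.e. `(Module.End A M)ᵐᵒᵖ`), and the `Λ`-module `Hom_A(M, X)` -/

section EndOp

variable (A : Type) [Ring A]

/-- the left module structure of `Λ = (End_A M)ᵐᵒᵖ` on `Hom_A(M, X)` by
precomposition. -/
instance endOpModule (M : Type) [AddCommGroup M] [Module A M]
    (X : Type) [AddCommGroup X] [Module A X] :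
    Module (Module.End A M)ᵐᵒᵖ (M →ₗ[A] X) where
  smul l f := f ∘ₗ l.unop
  one_smul f := LinearMap.comp_id f
  mul_smul l m f := rfl
  smul_zero l := LinearMap.zero_comp _
  smul_add l f g := LinearMap.add_comp _ _ _
  add_smul l m f := LinearMap.comp_add _ _ _
  zero_smul f := LinearMap.comp_zero f

/-- `Hom_A(M, X)` as an object of `ModuleCat Λ`. -/
noncomputable def HomModObj (M X : ModuleCat.{0} A) :
    ModuleCat.{0} (Module.End A ↥M)ᵐᵒᵖ :=
  ModuleCat.of (Module.End A ↥M)ᵐᵒᵖ (↥M →ₗ[A] ↥X)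

/-- postcomposition with `g : X ⟶ Y` as a `Λ`-linear map `Hom_A(M,X) → Hom_A(M,Y)`. -/
noncomputable def homPost (M : ModuleCat.{0} A) {X Y : ModuleCat.{0} A} (g : X ⟶ Y) :
    (↥M →ₗ[A] ↥X) →ₗ[(Module.End A ↥M)ᵐᵒᵖ] (↥M →ₗ[A] ↥Y) where
  toFun f := (g.hom : ↥X →ₗ[A] ↥Y) ∘ₗ f
  map_add' f₁ f₂ := LinearMap.comp_add _ _ _
  map_smul' l f := rfl

end EndOp

section ExtVanishing

variable {A : Type} [Ring A]

/-- Vanishing of `Ext^{n+1}(X, Y)` in terms of cocycles on a projective resolution of `X`. -/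
lemma extZero_succ_iff_cocycle {X : ModuleCat.{0} A} (R : ProjectiveResolution X)
    (Y : ModuleCat.{0} A) (n : ℕ) :
    extZero A (n + 1) X Y ↔ ∀ f : R.complex.X (n + 1) ⟶ Y,
      R.complex.d (n + 2) (n + 1) ≫ f = 0 → ∃ g, R.complex.d (n + 1) n ≫ g = f := by
  have e := R.isoExt (R := ℤ) (n + 1) Y
  have h1 : extZero A (n + 1) X Y ↔
      Limits.IsZero ((R.complex.linearYonedaObj ℤ Y).homology (n + 1)) := by
    rw [← e.isZero_iff, ModuleCat.isZero_iff_subsingleton]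
    rfl
  rw [h1, ← HomologicalComplex.exactAt_iff_isZero_homology,
    HomologicalComplex.exactAt_iff' _ n (n + 1) (n + 2) (by simp) (by simp),
    ShortComplex.moduleCat_exact_iff]
  rfl

/-- The vanishing of the two versions of `Ext` agrees in positive degrees. -/
lemma extZero_succ_iff_subsingleton (X Y : ModuleCat.{0} A) (n : ℕ) :
    extZero A (n + 1) X Y ↔ Subsingleton (Abelian.Ext X Y (n + 1)) := by
  let R := projectiveResolution X
  rw [extZero_succ_iff_cocycle R]
  constructor
  · intro h
    refine subsingleton_of_forall_eq 0 fun α => ?_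
    obtain ⟨f, hf, rfl⟩ := R.extMk_surjective α (n + 2) rfl
    exact (R.extMk_eq_zero_iff f (n + 2) rfl hf n rfl).2 (h f hf)
  · intro h f hf
    exact (R.extMk_eq_zero_iff f (n + 2) rfl hf n rfl).1 (Subsingleton.elim _ _)

lemma extZero_succ_of_projective (X Y : ModuleCat.{0} A) [Module.Projective A X] (n : ℕ) :
    extZero A (n + 1) X Y := by
  have := (IsProjective.iff_projective (R := A) (P := ↥X)).1 inferInstance
  exact (extZero_succ_iff_subsingleton X Y n).2 (Abelian.Ext.subsingleton_of_projective X Y n)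

lemma extZero_succ_pi (X : ModuleCat.{0} A) (J : Type) (Y : J → ModuleCat.{0} A) (n : ℕ)
    (h : ∀ j, extZero A (n + 1) X (Y j)) :
    extZero A (n + 1) X (ModuleCat.of A (∀ j, Y j)) := by
  let R := projectiveResolution X
  rw [extZero_succ_iff_cocycle R]
  intro f hf
  have h' (j : J) := (extZero_succ_iff_cocycle R (Y j) n).1 (h j)
    (f ≫ ModuleCat.ofHom (LinearMap.proj j)) (by rw [← Category.assoc, hf, Limits.zero_comp])
  choose g hg using h'
  refine ⟨ModuleCat.ofHom (LinearMap.pi fun j => (g j).hom), ?_⟩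
  ext x j
  exact congr($(hg j).hom x)

lemma extZero_succ_of_retract_right {X Y Z : ModuleCat.{0} A} (n : ℕ) (i : ↥Z →ₗ[A] ↥Y)
    (p : ↥Y →ₗ[A] ↥Z) (hpi : p ∘ₗ i = LinearMap.id) (h : extZero A (n + 1) X Y) :
    extZero A (n + 1) X Z := by
  let R := projectiveResolution X
  rw [extZero_succ_iff_cocycle R] at h ⊢
  intro f hf
  obtain ⟨g, hg⟩ := h (f ≫ ModuleCat.ofHom i) (by rw [← Category.assoc, hf, Limits.zero_comp])
  refine ⟨g ≫ ModuleCat.ofHom p, ?_⟩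
  rw [← Category.assoc, hg, Category.assoc, ← ModuleCat.ofHom_comp, hpi]
  rfl

lemma extZero_succ_of_retract_left {X Y Z : ModuleCat.{0} A} (n : ℕ) (i : ↥Z →ₗ[A] ↥X)
    (p : ↥X →ₗ[A] ↥Z) (hpi : p ∘ₗ i = LinearMap.id) (h : extZero A (n + 1) X Y) :
    extZero A (n + 1) Z Y := by
  rw [extZero_succ_iff_subsingleton] at h ⊢
  refine subsingleton_of_forall_eq 0 fun α => ?_
  have h1 : (Abelian.Ext.mk₀ (ModuleCat.ofHom i ≫ ModuleCat.ofHom p)).comp α (zero_add _) = α := by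
    rw [← ModuleCat.ofHom_comp, hpi]
    exact Abelian.Ext.mk₀_id_comp α
  rw [← h1, ← Abelian.Ext.mk₀_comp_mk₀, Abelian.Ext.comp_assoc_of_second_deg_zero,
    Subsingleton.elim ((Abelian.Ext.mk₀ (ModuleCat.ofHom p)).comp α (zero_add _)) 0,
    Abelian.Ext.comp_zero]

section ShortExact

variable {K P X : ModuleCat.{0} A} {i : ↥K →ₗ[A] ↥P} {p : ↥P →ₗ[A] ↥X}

/-- The short exact sequence of module categories attached to exact linear maps. -/
lemma shortExact_of_linearMap (hi : Function.Injective i) (hex : Function.Exact i p)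
    (hp : Function.Surjective p) :
    (ShortComplex.mk (ModuleCat.ofHom i) (ModuleCat.ofHom p)
      (by ext x; exact hex.apply_apply_eq_zero x)).ShortExact where
  exact := (ShortComplex.ShortExact.moduleCat_exact_iff_function_exact _).2 hex
  mono_f := (ModuleCat.mono_iff_injective _).2 hi
  epi_g := (ModuleCat.epi_iff_surjective _).2 hp

lemma exists_extension_of_extZero_one (hi : Function.Injective i)
    (hex : Function.Exact i p) (hp : Function.Surjective p) (Y : ModuleCat.{0} A)
    (h : extZero A 1 X Y) (f : ↥K →ₗ[A] ↥Y) :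
    ∃ g : ↥P →ₗ[A] ↥Y, g ∘ₗ i = f := by
  have hS := shortExact_of_linearMap hi hex hp
  rw [extZero_succ_iff_subsingleton] at h
  obtain ⟨x, hx⟩ := Abelian.Ext.contravariant_sequence_exact₁ hS Y
    (Abelian.Ext.mk₀ (ModuleCat.ofHom f)) (n₁ := 1) rfl (Subsingleton.elim _ _)
  obtain ⟨g, rfl⟩ := (Abelian.Ext.mk₀_bijective P Y).2 x
  refine ⟨g.hom, ?_⟩
  rw [Abelian.Ext.mk₀_comp_mk₀] at hx
  exact congr($((Abelian.Ext.mk₀_bijective _ _).1 hx).hom)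

lemma exists_lift_of_extZero_one (hi : Function.Injective i)
    (hex : Function.Exact i p) (hp : Function.Surjective p) (Y : ModuleCat.{0} A)
    (h : extZero A 1 Y K) (f : ↥Y →ₗ[A] ↥X) :
    ∃ g : ↥Y →ₗ[A] ↥P, p ∘ₗ g = f := by
  have hS := shortExact_of_linearMap hi hex hp
  rw [extZero_succ_iff_subsingleton] at h
  obtain ⟨x, hx⟩ := Abelian.Ext.covariant_sequence_exact₃ Y hS
    (Abelian.Ext.mk₀ (ModuleCat.ofHom f)) (n₁ := 1) rfl (Subsingleton.elim _ _)
  obtain ⟨g, rfl⟩ := (Abelian.Ext.mk₀_bijective Y P).2 x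
  refine ⟨g.hom, ?_⟩
  rw [Abelian.Ext.mk₀_comp_mk₀] at hx
  exact congr($((Abelian.Ext.mk₀_bijective _ _).1 hx).hom)

lemma extZero_one_of_exists_extension (hi : Function.Injective i)
    (hex : Function.Exact i p) (hp : Function.Surjective p) (Y : ModuleCat.{0} A)
    (h : extZero A 1 P Y)
    (hext : ∀ f : ↥K →ₗ[A] ↥Y, ∃ g : ↥P →ₗ[A] ↥Y, g ∘ₗ i = f) : extZero A 1 X Y := by
  have hS := shortExact_of_linearMap hi hex hp
  rw [extZero_succ_iff_subsingleton] at h ⊢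
  refine subsingleton_of_forall_eq 0 fun α => ?_
  obtain ⟨x, rfl⟩ := Abelian.Ext.contravariant_sequence_exact₃ hS Y α
    (Subsingleton.elim _ _) (n₀ := 0) rfl
  obtain ⟨f, rfl⟩ := (Abelian.Ext.mk₀_bijective K Y).2 x
  obtain ⟨g, hg⟩ := hext f.hom
  have hf : f = ModuleCat.ofHom i ≫ ModuleCat.ofHom g := by
    ext1
    exact hg.symm
  rw [hf, ← Abelian.Ext.mk₀_comp_mk₀]
  exact hS.extClass_comp_assoc (Abelian.Ext.mk₀ (ModuleCat.ofHom g))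

lemma extZero_one_of_exists_lift (hi : Function.Injective i)
    (hex : Function.Exact i p) (hp : Function.Surjective p) (Y : ModuleCat.{0} A)
    (h : extZero A 1 Y P)
    (hlift : ∀ f : ↥Y →ₗ[A] ↥X, ∃ g : ↥Y →ₗ[A] ↥P, p ∘ₗ g = f) : extZero A 1 Y K := by
  have hS := shortExact_of_linearMap hi hex hp
  rw [extZero_succ_iff_subsingleton] at h ⊢
  refine subsingleton_of_forall_eq 0 fun α => ?_
  obtain ⟨x, rfl⟩ := Abelian.Ext.covariant_sequence_exact₁ Y hS α
    (Subsingleton.elim _ _) (n₀ := 0) rfl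
  obtain ⟨f, rfl⟩ := (Abelian.Ext.mk₀_bijective Y X).2 x
  obtain ⟨g, hg⟩ := hlift f.hom
  have hf : f = ModuleCat.ofHom g ≫ ModuleCat.ofHom p := by
    ext1
    exact hg.symm
  rw [hf, ← Abelian.Ext.mk₀_comp_mk₀, Abelian.Ext.comp_assoc_of_second_deg_zero]
  have := hS.comp_extClass
  dsimp at this
  rw [this, Abelian.Ext.comp_zero]

lemma extZero_left_of_middle_of_right (hi : Function.Injective i)
    (hex : Function.Exact i p) (hp : Function.Surjective p) (Y : ModuleCat.{0} A)
    {n : ℕ} (hP : extZero A (n + 1) P Y)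
    (hX : extZero A (n + 2) X Y) : extZero A (n + 1) K Y := by
  have hS := shortExact_of_linearMap hi hex hp
  rw [extZero_succ_iff_subsingleton] at hP hX ⊢
  refine subsingleton_of_forall_eq 0 fun α => ?_
  obtain ⟨x, rfl⟩ := Abelian.Ext.contravariant_sequence_exact₁ hS Y α
    (n₁ := n + 1 + 1) (add_comm _ _) (Subsingleton.elim _ _)
  rw [Subsingleton.elim x 0, Abelian.Ext.comp_zero]

lemma extZero_right_of_left_of_middle (hi : Function.Injective i)
    (hex : Function.Exact i p) (hp : Function.Surjective p) (Y : ModuleCat.{0} A)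
    {n : ℕ} (hK : extZero A (n + 1) K Y)
    (hP : extZero A (n + 2) P Y) : extZero A (n + 2) X Y := by
  have hS := shortExact_of_linearMap hi hex hp
  rw [extZero_succ_iff_subsingleton] at hP hK ⊢
  refine subsingleton_of_forall_eq 0 fun α => ?_
  obtain ⟨x, rfl⟩ := Abelian.Ext.contravariant_sequence_exact₃ hS Y α
    (Subsingleton.elim _ _) (n₀ := n + 1) (add_comm _ _)
  rw [Subsingleton.elim x 0, Abelian.Ext.comp_zero]

lemma extZero_to_left_of_right_of_middle (hi : Function.Injective i)
    (hex : Function.Exact i p) (hp : Function.Surjective p) (Y : ModuleCat.{0} A)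
    {n : ℕ} (hX : extZero A (n + 1) Y X)
    (hP : extZero A (n + 2) Y P) : extZero A (n + 2) Y K := by
  have hS := shortExact_of_linearMap hi hex hp
  rw [extZero_succ_iff_subsingleton] at hP hX ⊢
  refine subsingleton_of_forall_eq 0 fun α => ?_
  obtain ⟨x, rfl⟩ := Abelian.Ext.covariant_sequence_exact₁ Y hS α
    (Subsingleton.elim _ _) (n₀ := n + 1) rfl
  rw [Subsingleton.elim x 0, Abelian.Ext.zero_comp]

lemma extZero_to_right_of_middle_of_left (hi : Function.Injective i)
    (hex : Function.Exact i p) (hp : Function.Surjective p) (Y : ModuleCat.{0} A)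
    {n : ℕ} (hP : extZero A (n + 1) Y P)
    (hK : extZero A (n + 2) Y K) : extZero A (n + 1) Y X := by
  have hS := shortExact_of_linearMap hi hex hp
  rw [extZero_succ_iff_subsingleton] at hP hK ⊢
  refine subsingleton_of_forall_eq 0 fun α => ?_
  obtain ⟨x, rfl⟩ := Abelian.Ext.covariant_sequence_exact₃ Y hS α
    (n₁ := n + 1 + 1) rfl (Subsingleton.elim _ _)
  rw [Subsingleton.elim x 0, Abelian.Ext.zero_comp]

end ShortExact

lemma exists_free_presentation (X : ModuleCat.{0} A) :
    ∃ (K P : ModuleCat.{0} A) (i : ↥K →ₗ[A] ↥P) (p : ↥P →ₗ[A] ↥X), Module.Free A P ∧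
      Function.Injective i ∧ Function.Exact i p ∧ Function.Surjective p := by
  let p := Finsupp.linearCombination A (id : ↥X → ↥X)
  exact ⟨ModuleCat.of A (LinearMap.ker p), ModuleCat.of A (↥X →₀ A), (LinearMap.ker p).subtype, p,
    inferInstanceAs (Module.Free A (↥X →₀ A)), Subtype.val_injective,
    LinearMap.exact_subtype_ker_map p, Finsupp.linearCombination_id_surjective A X⟩

lemma exact_mapRange_linearMap (I : Type) {K P X : Type} [AddCommGroup K] [AddCommGroup P]
    [AddCommGroup X] [Module A K] [Module A P] [Module A X] {i : K →ₗ[A] P} {p : P →ₗ[A] X}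
    (hi : Function.Injective i) (hex : Function.Exact i p) :
    Function.Exact (Finsupp.mapRange.linearMap i : (I →₀ K) →ₗ[A] (I →₀ P))
      (Finsupp.mapRange.linearMap p) := by
  intro f
  constructor
  · intro hf
    choose g hg using fun a => (hex (f a)).1 (DFunLike.congr_fun hf a)
    refine ⟨Finsupp.onFinset f.support g fun a ha => ?_, ?_⟩
    · rw [Finsupp.mem_support_iff, ← hg a]
      exact fun h0 => ha (hi (h0.trans (map_zero i).symm))
    · ext a
      exact hg a
  · rintro ⟨g, rfl⟩
    ext a
    exact hex.apply_apply_eq_zero (g a)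

lemma extZero_succ_finsupp (I : Type) (X Y : ModuleCat.{0} A) (n : ℕ)
    (h : extZero A (n + 1) X Y) : extZero A (n + 1) (ModuleCat.of A (I →₀ ↥X)) Y := by
  induction n generalizing X with
  | zero =>
    obtain ⟨K, P, i, p, hP, hi, hex, hp⟩ := exists_free_presentation X
    refine extZero_one_of_exists_extension
      (K := ModuleCat.of A (I →₀ ↥K)) (P := ModuleCat.of A (I →₀ ↥P))
      (X := ModuleCat.of A (I →₀ ↥X))
      (i := Finsupp.mapRange.linearMap i) (p := Finsupp.mapRange.linearMap p)
      (Finsupp.mapRange_injective _ (map_zero _) hi) (exact_mapRange_linearMap I hi hex)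
      (Finsupp.mapRange_surjective _ (map_zero _) hp) Y ?_ ?_
    · have : Module.Free A (ModuleCat.of A (I →₀ ↥P)) :=
        inferInstanceAs (Module.Free A (I →₀ ↥P))
      exact extZero_succ_of_projective _ _ 0
    · intro f
      choose g hg using fun a => exists_extension_of_extZero_one hi hex hp Y h
        (f ∘ₗ (Finsupp.lsingle a : ↥K →ₗ[A] (I →₀ ↥K)))
      refine ⟨Finsupp.lsum ℕ g, Finsupp.lhom_ext fun a x => ?_⟩
      simpa using congr($(hg a) x)
  | succ n ih =>
    obtain ⟨K, P, i, p, hP, hi, hex, hp⟩ := exists_free_presentation X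
    refine extZero_right_of_left_of_middle
      (K := ModuleCat.of A (I →₀ ↥K)) (P := ModuleCat.of A (I →₀ ↥P))
      (X := ModuleCat.of A (I →₀ ↥X))
      (i := Finsupp.mapRange.linearMap i) (p := Finsupp.mapRange.linearMap p)
      (Finsupp.mapRange_injective _ (map_zero _) hi) (exact_mapRange_linearMap I hi hex)
      (Finsupp.mapRange_surjective _ (map_zero _) hp) Y (ih K ?_) ?_
    · have : Module.Projective A P := Module.Projective.of_free
      exact extZero_left_of_middle_of_right hi hex hp Y (extZero_succ_of_projective _ _ n) h
    · have : Module.Free A (ModuleCat.of A (I →₀ ↥P)) :=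
        inferInstanceAs (Module.Free A (I →₀ ↥P))
      exact extZero_succ_of_projective _ _ (n + 1)

end ExtVanishing

section Cogenerator

variable {A : Type} [Ring A]

/-- Over an artinian ring, the annihilator of a module is the annihilator of finitely many
elements. -/
lemma exists_finset_forall_smul_eq_zero [IsArtinianRing A] (S : Type) [AddCommGroup S]
    [Module A S] :
    ∃ t : Finset S, ∀ a : A, (∀ s ∈ t, a • s = 0) → a ∈ Module.annihilator A S := by
  classical
  let I (t : Finset S) : Ideal A := t.inf fun s => LinearMap.ker (LinearMap.toSpanSingleton A S s)
  have hI (t : Finset S) (a : A) : a ∈ I t ↔ ∀ s ∈ t, a • s = 0 := by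
    simp [I, Submodule.mem_finsetInf]
  obtain ⟨_, ⟨t, rfl⟩, ht⟩ := IsArtinian.set_has_minimal (Set.range I) ⟨_, ∅, rfl⟩
  refine ⟨t, fun a ha => Module.mem_annihilator.2 fun s => ?_⟩
  have h1 : I (insert s t) ≤ I t := fun b hb =>
    (hI _ _).2 fun u hu => (hI _ _).1 hb u (Finset.mem_insert_of_mem hu)
  have h2 : I (insert s t) = I t :=
    h1.eq_of_not_lt (ht _ ⟨_, rfl⟩)
  have h3 : a ∈ I (insert s t) := h2 ▸ (hI _ _).2 ha
  exact (hI _ _).1 h3 s (Finset.mem_insert_self s t)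

lemma nonempty_linearEquiv_of_annihilator_le [IsArtinianRing A] (S W : Type) [AddCommGroup S]
    [Module A S] [AddCommGroup W] [Module A W] [IsSimpleModule A S] [IsSimpleModule A W]
    (h : Module.annihilator A S ≤ Module.annihilator A W) : Nonempty (S ≃ₗ[A] W) := by
  classical
  obtain ⟨t, ht⟩ := exists_finset_forall_smul_eq_zero (A := A) S
  have := IsSimpleModule.nontrivial A W
  obtain ⟨w, hw⟩ := exists_ne (0 : W)
  let f : A →ₗ[A] (t → S) := LinearMap.pi fun s => LinearMap.toSpanSingleton A S s
  have hf : LinearMap.ker f ≤ LinearMap.ker (LinearMap.toSpanSingleton A W w) := by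
    intro a ha
    refine Module.mem_annihilator.1 (h (ht a fun s hs => ?_)) w
    exact congr_fun (show f a = 0 from ha) ⟨s, hs⟩
  obtain ⟨g, hg⟩ := IsSemisimpleModule.extension_property
    ((LinearMap.ker f).liftQ f le_rfl)
    (LinearMap.ker_eq_bot.1 (Submodule.ker_liftQ_eq_bot' _ f rfl))
    ((LinearMap.ker f).liftQ _ hf)
  have hg0 : g ≠ 0 := by
    rintro rfl
    have := LinearMap.congr_fun hg (Submodule.Quotient.mk 1)
    simp at this
    exact hw this.symm
  obtain ⟨s, hs⟩ : ∃ s, g ∘ₗ LinearMap.single A (fun _ : t => S) s ≠ 0 := by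
    by_contra! hall
    exact hg0 (LinearMap.pi_ext' fun s => by rw [hall, LinearMap.zero_comp])
  exact ⟨LinearEquiv.ofBijective _ (LinearMap.bijective_of_ne_zero hs)⟩

/-- Primitive ideals are prime. -/
lemma le_annihilator_or_le_annihilator (S : Type) [AddCommGroup S] [Module A S]
    [IsSimpleModule A S] (I J : Ideal A) [J.IsTwoSided] (h : J ⊓ I ≤ Module.annihilator A S) :
    J ≤ Module.annihilator A S ∨ I ≤ Module.annihilator A S := by
  by_contra! hcon
  obtain ⟨⟨y, hy, hy'⟩, ⟨x, hx, hx'⟩⟩ :=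
    hcon.imp SetLike.not_le_iff_exists.1 SetLike.not_le_iff_exists.1
  rw [Module.mem_annihilator] at hx' hy'
  push Not at hx' hy'
  obtain ⟨s, hs⟩ := hx'
  obtain ⟨t, ht⟩ := hy'
  obtain ⟨a, ha⟩ := IsSimpleModule.toSpanSingleton_surjective A hs t
  have hmem : y * (a * x) ∈ Module.annihilator A S :=
    h ⟨J.mul_mem_right _ hy, I.mul_mem_left _ (I.mul_mem_left _ hx)⟩
  apply ht
  rw [← ha, LinearMap.toSpanSingleton_apply, ← mul_smul, ← mul_smul, mul_assoc]
  exact Module.mem_annihilator.1 hmem s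

lemma exists_le_annihilator_of_inf_le {ι : Type} (S : Type) [AddCommGroup S] [Module A S]
    [IsSimpleModule A S] (P : ι → Ideal A) (hP : ∀ i, (P i).IsTwoSided) (t : Finset ι)
    (h : t.inf P ≤ Module.annihilator A S) : ∃ i ∈ t, P i ≤ Module.annihilator A S := by
  classical
  induction t using Finset.induction_on with
  | empty =>
    have := IsSimpleModule.nontrivial A S
    rw [Finset.inf_empty, top_le_iff, Module.annihilator_eq_top_iff] at h
    exact (not_subsingleton S h).elim
  | insert i t hi ih =>
    rw [Finset.inf_insert] at h
    have := hP i
    rcases le_annihilator_or_le_annihilator S _ _ h with h | h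
    · exact ⟨i, Finset.mem_insert_self _ _, h⟩
    · obtain ⟨j, hj, hj'⟩ := ih h
      exact ⟨j, Finset.mem_insert_of_mem hj, hj'⟩

variable (A) in
/-- The annihilators of the simple modules. -/
def primitiveIdeals : Set (Ideal A) :=
  {I | ∃ m : Ideal A, m.IsMaximal ∧ I = Module.annihilator A (A ⧸ m)}

lemma annihilator_mem_primitiveIdeals (S : Type) [AddCommGroup S] [Module A S]
    [h : IsSimpleModule A S] : Module.annihilator A S ∈ primitiveIdeals A := by
  obtain ⟨m, hm, ⟨e⟩⟩ := isSimpleModule_iff_quot_maximal.1 h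
  exact ⟨m, hm, e.annihilator_eq⟩

lemma exists_simple_of_mem_primitiveIdeals {I : Ideal A} (hI : I ∈ primitiveIdeals A) :
    ∃ (S : ModuleCat.{0} A), IsSimpleModule A S ∧ I = Module.annihilator A S := by
  obtain ⟨m, hm, rfl⟩ := hI
  exact ⟨ModuleCat.of A (A ⧸ m), isSimpleModule_iff_isCoatom.2 hm.out, rfl⟩

lemma eq_of_le_of_mem_primitiveIdeals [IsArtinianRing A] {I J : Ideal A}
    (hI : I ∈ primitiveIdeals A) (hJ : J ∈ primitiveIdeals A) (h : I ≤ J) : I = J := by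
  obtain ⟨S, hS, rfl⟩ := exists_simple_of_mem_primitiveIdeals hI
  obtain ⟨W, hW, rfl⟩ := exists_simple_of_mem_primitiveIdeals hJ
  obtain ⟨e⟩ := nonempty_linearEquiv_of_annihilator_le S W h
  exact e.annihilator_eq

lemma finite_primitiveIdeals [IsArtinianRing A] : (primitiveIdeals A).Finite := by
  classical
  by_contra hinf
  let P := Set.Infinite.natEmbedding _ hinf
  let I : ℕ →o (Ideal A)ᵒᵈ :=
    ⟨fun n => OrderDual.toDual ((Finset.range n).inf fun i => (P i : Ideal A)),
      fun _ _ hmn => OrderDual.toDual_le_toDual.2 (Finset.inf_mono (Finset.range_mono hmn))⟩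
  obtain ⟨n, hn⟩ := IsArtinian.monotone_stabilizes I
  have h1 : (Finset.range n).inf (fun i => (P i : Ideal A)) ≤ P n := by
    have h2 : (Finset.range n).inf (fun i => (P i : Ideal A)) =
      (Finset.range (n + 1)).inf (fun i => (P i : Ideal A)) := hn (n + 1) n.le_succ
    rw [h2]
    exact Finset.inf_le (Finset.self_mem_range_succ n)
  obtain ⟨S, hS, hPS⟩ := exists_simple_of_mem_primitiveIdeals (P n).2
  rw [hPS] at h1
  obtain ⟨i, hi, hle⟩ := exists_le_annihilator_of_inf_le S (fun i => (P i : Ideal A))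
    (fun i => by
      obtain ⟨W, -, hW⟩ := exists_simple_of_mem_primitiveIdeals (P i).2
      rw [hW]
      infer_instance) _ h1
  rw [← hPS] at hle
  have := P.injective (Subtype.ext (eq_of_le_of_mem_primitiveIdeals (P i).2 (P n).2 hle))
  exact (Finset.mem_range.1 hi).ne this

/-- A two-sided ideal containing a primitive ideal strictly is the whole ring. -/
lemma eq_of_le_of_ne_top [IsArtinianRing A] {I J : Ideal A} [J.IsTwoSided]
    (hI : I ∈ primitiveIdeals A) (h : I ≤ J) (hJ : J ≠ ⊤) : I = J := by
  obtain ⟨m, hm, hJm⟩ := Ideal.exists_le_maximal J hJ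
  have hle : J ≤ Module.annihilator A (A ⧸ m) := by
    intro x hx
    refine Module.mem_annihilator.2 fun q => ?_
    obtain ⟨a, rfl⟩ := Submodule.Quotient.mk_surjective m q
    rw [← Submodule.Quotient.mk_smul, Submodule.Quotient.mk_eq_zero]
    exact hJm (J.mul_mem_right a hx)
  exact le_antisymm h (hle.trans (eq_of_le_of_mem_primitiveIdeals hI ⟨m, hm, rfl⟩ (h.trans hle)).ge)

/-- In a finite-dimensional left self-injective algebra, every proper two-sided ideal has a
nonzero left annihilator. -/
lemma exists_ne_zero_forall_mul_eq_zero (k : Type) [Field k] [Algebra k A]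
    [FiniteDimensional k A] [Module.Injective A A] (P : Ideal A) [P.IsTwoSided] (hP : P ≠ ⊤) :
    ∃ x : A, x ≠ 0 ∧ ∀ p ∈ P, x * p = 0 := by
  classical
  by_contra! hcon
  obtain ⟨t, ht⟩ : (P.restrictScalars k).FG := IsNoetherian.noetherian _
  let f : A →ₗ[A] (t → A) := LinearMap.pi fun a => LinearMap.toSpanSingleton A A a
  have hf : Function.Injective f := by
    rw [injective_iff_map_eq_zero]
    intro x hx
    by_contra hx0
    obtain ⟨p, hp, hxp⟩ := hcon x hx0
    apply hxp
    have : P.restrictScalars k ≤ LinearMap.ker (LinearMap.mulLeft k x) := by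
      rw [← ht, Submodule.span_le]
      intro a ha
      exact congr_fun hx ⟨a, ha⟩
    exact this hp
  obtain ⟨h, hh⟩ := Module.Injective.out f hf LinearMap.id
  apply hP
  rw [Ideal.eq_top_iff_one]
  have h1 : h (f 1) = 1 := hh 1
  have h2 : f 1 = ∑ a : t, (a : A) • Pi.single a (1 : A) := by
    ext b
    simp [f, Finset.sum_apply, Pi.single_apply]
  rw [← h1, h2, map_sum]
  refine P.sum_mem fun a _ => ?_
  rw [map_smul]
  exact P.mul_mem_right _ (ht ▸ Submodule.subset_span a.2 : (a : A) ∈ P.restrictScalars k)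

/-- The minimal left ideals annihilated on the right by a proper two-sided ideal. -/
lemma exists_isAtom_forall_mul_eq_zero (k : Type) [Field k] [Algebra k A]
    [FiniteDimensional k A] [Module.Injective A A] (P : Ideal A) [P.IsTwoSided] (hP : P ≠ ⊤) :
    ∃ S : Ideal A, IsAtom S ∧ ∀ s ∈ S, ∀ p ∈ P, s * p = 0 := by
  have : IsArtinianRing A := IsArtinianRing.of_finite k A
  obtain ⟨x, hx, hxP⟩ := exists_ne_zero_forall_mul_eq_zero k P hP
  obtain h | ⟨S, hS, hle⟩ := eq_bot_or_exists_atom_le (Ideal.span {x})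
  · exact (hx (Ideal.span_singleton_eq_bot.1 h)).elim
  · refine ⟨S, hS, fun s hs p hp => ?_⟩
    obtain ⟨a, rfl⟩ := Ideal.mem_span_singleton'.1 (hle hs)
    rw [mul_assoc, hxP p hp, mul_zero]

/-- Over a finite-dimensional left self-injective algebra, every simple module embeds into the
regular module. -/
lemma exists_injective_of_isSimpleModule (k : Type) [Field k] [Algebra k A]
    [FiniteDimensional k A] [Module.Injective A A] (S : Type) [AddCommGroup S] [Module A S]
    [IsSimpleModule A S] : ∃ f : S →ₗ[A] A, Function.Injective f := by
  classical
  have : IsArtinianRing A := IsArtinianRing.of_finite k A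
  have htwo (P : primitiveIdeals A) : (P : Ideal A).IsTwoSided := by
    obtain ⟨W, -, hW⟩ := exists_simple_of_mem_primitiveIdeals P.2
    rw [hW]
    infer_instance
  have htop (P : primitiveIdeals A) : (P : Ideal A) ≠ ⊤ := by
    obtain ⟨W, hW', hW⟩ := exists_simple_of_mem_primitiveIdeals P.2
    rw [hW, Ne, Module.annihilator_eq_top_iff, not_subsingleton_iff_nontrivial]
    exact IsSimpleModule.nontrivial A W
  choose T hT hTP using fun P : primitiveIdeals A =>
    exists_isAtom_forall_mul_eq_zero k (P : Ideal A) (htop P)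
  have hsimple (P : primitiveIdeals A) : IsSimpleModule A (T P) :=
    isSimpleModule_iff_isAtom.2 (hT P)
  let τ (P : primitiveIdeals A) : primitiveIdeals A :=
    ⟨Module.annihilator A (T P), annihilator_mem_primitiveIdeals _⟩
  have hτ : Function.Injective τ := by
    intro P Q hPQ
    obtain ⟨e⟩ := nonempty_linearEquiv_of_annihilator_le (T Q) (T P)
      (congrArg Subtype.val hPQ).ge
    obtain ⟨h, hh⟩ := Module.Injective.out (T Q).subtype Subtype.val_injective
      ((T P).subtype ∘ₗ e.toLinearMap)
    have hmul (s : T P) : (s : A) = (e.symm s : A) * h 1 := by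
      have := hh (e.symm s)
      simp only [Submodule.subtype_apply, LinearMap.comp_apply, LinearEquiv.coe_coe,
        LinearEquiv.apply_symm_apply] at this
      rw [← this, ← smul_eq_mul, ← map_smul, smul_eq_mul, mul_one]
    have hann : ∀ s ∈ T P, ∀ q ∈ (Q : Ideal A), s * q = 0 := by
      intro s hs q hq
      rw [show s = _ from hmul ⟨s, hs⟩, mul_assoc]
      exact hTP Q _ (e.symm ⟨s, hs⟩).2 _ ((Q : Ideal A).mul_mem_left _ hq)
    have hsup : (P : Ideal A) ⊔ Q ≠ ⊤ := by
      intro htop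
      obtain ⟨p, hp, q, hq, hpq⟩ := Submodule.mem_sup.1 ((Ideal.eq_top_iff_one _).1 htop)
      obtain ⟨s, hs, hs0⟩ := Submodule.exists_mem_ne_zero_of_ne_bot (hT P).1
      apply hs0
      rw [← mul_one s, ← hpq, mul_add, hTP P s hs p hp, hann s hs q hq, add_zero]
    have : ((P : Ideal A) ⊔ Q).IsTwoSided := by
      refine ⟨fun {a} b ha => ?_⟩
      obtain ⟨p, hp, q, hq, rfl⟩ := Submodule.mem_sup.1 ha
      rw [add_mul]
      exact Submodule.add_mem_sup ((P : Ideal A).mul_mem_right b hp)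
        ((Q : Ideal A).mul_mem_right b hq)
    exact Subtype.ext ((eq_of_le_of_ne_top P.2 le_sup_left hsup).trans
      (eq_of_le_of_ne_top Q.2 le_sup_right hsup).symm)
  have := finite_primitiveIdeals (A := A).to_subtype
  obtain ⟨P, hP⟩ := Finite.surjective_of_injective hτ
    ⟨Module.annihilator A S, annihilator_mem_primitiveIdeals S⟩
  obtain ⟨e⟩ := nonempty_linearEquiv_of_annihilator_le S (T P) (congrArg Subtype.val hP).ge
  exact ⟨(T P).subtype ∘ₗ e.toLinearMap, Subtype.val_injective.comp e.injective⟩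

/-- A finite-dimensional left self-injective algebra is a cogenerator. -/
lemma exists_linearMap_apply_ne_zero (k : Type) [Field k] [Algebra k A]
    [FiniteDimensional k A] [Module.Injective A A] (X : Type) [AddCommGroup X] [Module A X]
    {x : X} (hx : x ≠ 0) : ∃ f : X →ₗ[A] A, f x ≠ 0 := by
  let p := LinearMap.toSpanSingleton A X x
  have hker : LinearMap.ker p ≠ ⊤ := by
    rw [Ne, Ideal.eq_top_iff_one]
    simpa [p] using hx
  obtain ⟨m, hm, hle⟩ := Ideal.exists_le_maximal _ hker
  have : IsSimpleModule A (A ⧸ m) := isSimpleModule_iff_isCoatom.2 hm.out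
  obtain ⟨f, hf⟩ := exists_injective_of_isSimpleModule (A := A) k (A ⧸ m)
  let g : (A ⧸ LinearMap.ker p) →ₗ[A] A := (LinearMap.ker p).liftQ (f ∘ₗ m.mkQ) (by
    intro a ha
    have : m.mkQ a = 0 := (Submodule.Quotient.mk_eq_zero m).2 (hle ha)
    rw [LinearMap.mem_ker, LinearMap.comp_apply, this, map_zero])
  obtain ⟨h, hh⟩ := Module.Injective.out ((LinearMap.ker p).liftQ p le_rfl)
    (LinearMap.ker_eq_bot.1 (Submodule.ker_liftQ_eq_bot' _ p rfl)) g
  refine ⟨h, ?_⟩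
  have h1 := hh (Submodule.Quotient.mk 1)
  rw [Submodule.liftQ_apply, Submodule.liftQ_apply, LinearMap.toSpanSingleton_apply,
    one_smul] at h1
  rw [h1, LinearMap.comp_apply, Ne, map_eq_zero_iff f hf, Submodule.mkQ_apply,
    Submodule.Quotient.mk_eq_zero]
  exact fun h => hm.ne_top ((Ideal.eq_top_iff_one m).2 h)

end Cogenerator

section HomFunctor

variable {A : Type} [Ring A] {M : ModuleCat.{0} A}

lemma exists_sum_apply_eq_one_of_isGen (hgen : IsGen A M) :
    ∃ (n : ℕ) (m : Fin n → ↥M) (π : Fin n → (↥M →ₗ[A] A)), ∑ i, π i (m i) = 1 := by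
  obtain ⟨n, Y, ⟨e⟩⟩ := hgen
  refine ⟨n, e (1, 0), fun i => LinearMap.fst A A Y ∘ₗ e.symm.toLinearMap ∘ₗ
    LinearMap.single A (fun _ => ↥M) i, ?_⟩
  simp only [LinearMap.comp_apply, ← map_sum, LinearMap.coe_single, Finset.univ_sum_single]
  simp

/-- Every element is a sum of values of maps out of a generator. -/
lemma sum_toSpanSingleton_comp_apply {n : ℕ} {m : Fin n → ↥M} {π : Fin n → (↥M →ₗ[A] A)}
    (h : ∑ i, π i (m i) = 1) {X : Type} [AddCommGroup X] [Module A X] (x : X) :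
    ∑ i, (LinearMap.toSpanSingleton A X x ∘ₗ π i) (m i) = x := by
  simp only [LinearMap.comp_apply, LinearMap.toSpanSingleton_apply, ← Finset.sum_smul, h, one_smul]

lemma homPost_comp {X Y Z : ModuleCat.{0} A} (g : X ⟶ Y) (h : Y ⟶ Z) :
    homPost A M (g ≫ h) = homPost A M h ∘ₗ homPost A M g := rfl

lemma homPost_injective (hgen : IsGen A M) (X Y : ModuleCat.{0} A) :
    Function.Injective (fun g : X ⟶ Y => homPost A M g) := by
  obtain ⟨n, m, π, h⟩ := exists_sum_apply_eq_one_of_isGen hgen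
  intro g g' hgg'
  ext x
  rw [← sum_toSpanSingleton_comp_apply h x, map_sum, map_sum]
  refine Finset.sum_congr rfl fun i _ => ?_
  exact LinearMap.congr_fun
    (LinearMap.congr_fun hgg' (LinearMap.toSpanSingleton A X x ∘ₗ π i)) (m i)

lemma homPost_surjective (hgen : IsGen A M) (X Y : ModuleCat.{0} A) :
    Function.Surjective (fun g : X ⟶ Y => homPost A M g) := by
  obtain ⟨n, m, π, h⟩ := exists_sum_apply_eq_one_of_isGen hgen
  intro φ
  let r (x : ↥X) (i : Fin n) : ↥M →ₗ[A] ↥X := LinearMap.toSpanSingleton A X x ∘ₗ π i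
  let g (x : ↥X) : ↥Y := ∑ i, φ (r x i) (m i)
  have hφ (f : ↥M →ₗ[A] ↥X) (l : Module.End A ↥M) : φ (f ∘ₗ l) = φ f ∘ₗ l :=
    φ.map_smul (MulOpposite.op l) f
  have hg (f : ↥M →ₗ[A] ↥X) (y : ↥M) : g (f y) = φ f y := by
    have h1 (i : Fin n) : r (f y) i = f ∘ₗ (LinearMap.toSpanSingleton A M y ∘ₗ π i) := by
      ext z
      simp [r]
    conv_rhs => rw [← sum_toSpanSingleton_comp_apply h y, map_sum]
    exact Finset.sum_congr rfl fun i _ => by rw [h1, hφ]; rfl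
  have hadd (x y : ↥X) : g (x + y) = g x + g y := by
    have h1 (i : Fin n) : r (x + y) i = r x i + r y i := by
      ext z
      simp [r]
    simp only [g, h1, map_add, LinearMap.add_apply, Finset.sum_add_distrib]
  let g' : ↥X →+ ↥Y := AddMonoidHom.mk' g hadd
  refine ⟨ModuleCat.ofHom { g' with map_smul' := fun a x => ?_ }, ?_⟩
  · change g' (a • x) = a • g' x
    conv_lhs => rw [← sum_toSpanSingleton_comp_apply h x, Finset.smul_sum, map_sum]
    change _ = a • g x
    rw [Finset.smul_sum]
    refine Finset.sum_congr rfl fun i _ => ?_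
    rw [← map_smul, ← map_smul]
    exact hg _ _
  · ext f y
    exact hg f y

/-- Linear maps out of `X` into a self-injective algebra generated by `M` factor through `M`. -/
lemma exists_linearMap_generator_apply_ne_zero (k : Type) [Field k] [Algebra k A]
    [FiniteDimensional k A] [Module.Injective A A] (hgen : IsGen A M) (X : ModuleCat.{0} A)
    {x : ↥X} (hx : x ≠ 0) : ∃ f : ↥X →ₗ[A] ↥M, f x ≠ 0 := by
  obtain ⟨n, m, π, h⟩ := exists_sum_apply_eq_one_of_isGen hgen
  obtain ⟨f, hf⟩ := exists_linearMap_apply_ne_zero (A := A) k X hx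
  by_contra! hcon
  apply hf
  rw [← mul_one (f x), ← h, Finset.mul_sum]
  refine Finset.sum_eq_zero fun i _ => ?_
  have := congrArg (π i) (hcon (LinearMap.toSpanSingleton A M (m i) ∘ₗ f))
  simpa using this

/-- A product of copies of a finite-dimensional module is a direct sum of copies of it. -/
lemma exists_pi_linearEquiv_finsupp_sum (k : Type) [Field k] [Algebra k A]
    [FiniteDimensional k A] (M : Type) [AddCommGroup M] [Module A M] [Module.Finite A M]
    (J : Type) : ∃ E : Type, Nonempty ((J → M) ≃ₗ[A] (J ⊕ E →₀ M)) := by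
  classical
  let _ : Module k M := Module.compHom M (algebraMap k A)
  have : IsScalarTower k A M := ⟨fun c a x => by
    rw [Algebra.smul_def, mul_smul]; rfl⟩
  have : Module.Finite k M := Module.Finite.trans A M
  have hli : LinearIndependent k (fun j : J => (Pi.single j 1 : J → k)) :=
    Pi.linearIndependent_single_one J k
  let b := Module.Basis.sumExtend hli
  let e := Module.finBasis k M
  let T : (J ⊕ _ →₀ M) →ₗ[A] (J → M) :=
    Finsupp.lsum ℕ fun s => LinearMap.pi fun j => b s j • LinearMap.id
  have hT (f : J ⊕ _ →₀ M) (j : J) : T f j = f.sum fun s x => b s j • x := by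
    simp [T, Finsupp.lsum_apply, Finsupp.sum, Finset.sum_apply]
  refine ⟨_, ⟨(LinearEquiv.ofBijective T ⟨?_, fun g => ?_⟩).symm⟩⟩
  · rw [injective_iff_map_eq_zero]
    intro f hf
    ext s
    refine e.ext_elem fun l => ?_
    have h0 : b.repr.symm (Finsupp.mapRange.linearMap (e.coord l) f) = 0 := by
      ext j
      rw [Module.Basis.repr_symm_apply, Finsupp.linearCombination_apply,
        Finsupp.mapRange.linearMap_apply, Finsupp.sum_mapRange_index (by simp)]
      have := congrArg (e.coord l) (congr_fun hf j)
      rw [hT, map_finsuppSum] at this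
      simpa [Finsupp.sum, Finset.sum_apply, mul_comm] using this
    simpa using DFunLike.congr_fun ((LinearEquiv.map_eq_zero_iff _).1 h0) s
  · let c (l : Fin _) : J → k := fun j => e.repr (g j) l
    refine ⟨∑ l, Finsupp.mapRange.linearMap (LinearMap.toSpanSingleton k M (e l))
      (b.repr (c l)), ?_⟩
    ext j
    have h1 (l) : T (Finsupp.mapRange.linearMap (LinearMap.toSpanSingleton k M (e l))
        (b.repr (c l))) j = c l j • e l := by
      have h2 : c l j = (b.repr (c l)).sum fun s x => x * b s j := by
        conv_lhs => rw [← b.linearCombination_repr (c l), Finsupp.linearCombination_apply]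
        simp [Finsupp.sum, Finset.sum_apply]
      rw [hT, Finsupp.mapRange.linearMap_apply, Finsupp.sum_mapRange_index (by simp), h2,
        Finsupp.sum, Finsupp.sum, Finset.sum_smul]
      simp [smul_smul, mul_comm]
    rw [map_sum, Finset.sum_apply]
    simp only [h1]
    exact e.sum_repr (g j)

/-- `X` is a direct summand of a direct sum of copies of `M`. -/
def IsRetractOfCopies (M X : ModuleCat.{0} A) : Prop :=
  ∃ (I : Type) (i : ↥X →ₗ[A] (I →₀ ↥M)) (p : (I →₀ ↥M) →ₗ[A] ↥X), p ∘ₗ i = LinearMap.id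

lemma isRetractOfCopies_finsupp (I : Type) :
    IsRetractOfCopies M (ModuleCat.of A (I →₀ ↥M)) :=
  ⟨I, LinearMap.id, LinearMap.id, rfl⟩

lemma isRetractOfCopies_pi (k : Type) [Field k] [Algebra k A]
    [FiniteDimensional k A] [Module.Finite A ↥M] (J : Type) :
    IsRetractOfCopies M (ModuleCat.of A (J → ↥M)) := by
  obtain ⟨E, ⟨e⟩⟩ := exists_pi_linearEquiv_finsupp_sum (A := A) k M J
  exact ⟨_, e.toLinearMap, e.symm.toLinearMap, LinearMap.ext fun x => by simp⟩

lemma IsRetractOfCopies.extZero_left {X : ModuleCat.{0} A} (h : IsRetractOfCopies M X)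
    (hso : SelfOrthogonal A M) (n : ℕ) : extZero A (n + 1) X M := by
  obtain ⟨I, i, p, hpi⟩ := h
  exact extZero_succ_of_retract_left (X := ModuleCat.of A (I →₀ ↥M)) n i p hpi
    (extZero_succ_finsupp I M M n (hso _ n.succ_pos))

lemma IsRetractOfCopies.extZero_right (k : Type) [Field k] [Algebra k A]
    [FiniteDimensional k A] [Module.Finite A ↥M] {X : ModuleCat.{0} A}
    (h : IsRetractOfCopies M X) (hso : SelfOrthogonal A M) (n : ℕ) :
    extZero A (n + 1) M X := by
  obtain ⟨I, i, p, hpi⟩ := h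
  refine extZero_succ_of_retract_right (Y := ModuleCat.of A (I →₀ ↥M)) n i p hpi ?_
  obtain ⟨E, ⟨e⟩⟩ := exists_pi_linearEquiv_finsupp_sum (A := A) k M I
  let s := Finsupp.sumFinsuppLEquivProdFinsupp (α := I) (β := E) (M := ↥M) A
  exact extZero_succ_of_retract_right (Y := ModuleCat.of A (I → ↥M)) n
    (e.symm.toLinearMap ∘ₗ s.symm.toLinearMap ∘ₗ LinearMap.inl A _ _)
    (LinearMap.fst A _ _ ∘ₗ s.toLinearMap ∘ₗ e.toLinearMap)
    (LinearMap.ext fun x => by simp) (extZero_succ_pi M I (fun _ => M) n fun _ => hso _ n.succ_pos)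

end HomFunctor

section ProjectiveModules

variable {A : Type} [Ring A] {M : ModuleCat.{0} A}

/-- `Hom_A(M, -)` takes direct sums of copies of `M` to free modules. -/
lemma nonempty_finsupp_linearEquiv_hom [Module.Finite A ↥M] (I : Type) :
    Nonempty ((I →₀ (Module.End A ↥M)ᵐᵒᵖ) ≃ₗ[(Module.End A ↥M)ᵐᵒᵖ] (↥M →ₗ[A] (I →₀ ↥M))) := by
  classical
  let T : (I →₀ (Module.End A ↥M)ᵐᵒᵖ) →ₗ[(Module.End A ↥M)ᵐᵒᵖ] (↥M →ₗ[A] (I →₀ ↥M)) :=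
    Finsupp.linearCombination _ fun i => (Finsupp.lsingle i : ↥M →ₗ[A] (I →₀ ↥M))
  have hT (f) (x : ↥M) (i : I) : T f x i = (f i).unop x := by
    have h1 (j : I) (l : (Module.End A ↥M)ᵐᵒᵖ) :
        (l • (Finsupp.lsingle j : ↥M →ₗ[A] (I →₀ ↥M))) x = Finsupp.single j (l.unop x) := rfl
    simp only [T, Finsupp.linearCombination_apply, Finsupp.sum, LinearMap.sum_apply,
      Finsupp.finsetSum_apply, h1, Finsupp.single_apply]
    rw [Finset.sum_ite_eq']
    split_ifs with h
    · rfl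
    · rw [Finsupp.notMem_support_iff.1 h]
      rfl
  refine ⟨LinearEquiv.ofBijective T ⟨?_, fun φ => ?_⟩⟩
  · rw [injective_iff_map_eq_zero]
    intro f hf
    ext i : 1
    apply MulOpposite.unop_injective
    ext x
    rw [← hT, hf]
    rfl
  · obtain ⟨t, ht⟩ := Module.Finite.fg_top (R := A) (M := ↥M)
    let s : Finset I := t.biUnion fun x => (φ x).support
    have hs (x : ↥M) (i : I) (hi : i ∉ s) : φ x i = 0 := by
      have : (⊤ : Submodule A ↥M) ≤ LinearMap.ker (Finsupp.lapply i ∘ₗ φ) := by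
        rw [← ht, Submodule.span_le]
        intro y hy
        by_contra hne
        exact hi (Finset.mem_biUnion.2 ⟨y, hy, Finsupp.mem_support_iff.2 hne⟩)
      exact this (Submodule.mem_top (x := x))
    refine ⟨Finsupp.onFinset s (fun i => MulOpposite.op (Finsupp.lapply i ∘ₗ φ)) fun i hi => ?_, ?_⟩
    · by_contra his
      apply hi
      apply MulOpposite.unop_injective
      ext x
      exact hs x i his
    · ext x i
      rw [hT]
      rfl

lemma IsRetractOfCopies.projective_hom [Module.Finite A ↥M] {X : ModuleCat.{0} A}
    (h : IsRetractOfCopies M X) :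
    Module.Projective (Module.End A ↥M)ᵐᵒᵖ (↥M →ₗ[A] ↥X) := by
  obtain ⟨I, i, p, hpi⟩ := h
  obtain ⟨e⟩ := nonempty_finsupp_linearEquiv_hom (A := A) (M := M) I
  refine Module.Projective.of_split
    (e.symm.toLinearMap ∘ₗ homPost A M (Y := ModuleCat.of A (I →₀ ↥M)) (ModuleCat.ofHom i))
    (homPost A M (X := ModuleCat.of A (I →₀ ↥M)) (ModuleCat.ofHom p) ∘ₗ e.toLinearMap) ?_
  ext f x
  have := LinearMap.congr_fun hpi (f x)
  rw [LinearMap.comp_apply, LinearMap.comp_apply, LinearMap.comp_apply, LinearEquiv.coe_coe,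
    LinearEquiv.coe_coe, LinearEquiv.apply_symm_apply]
  exact this

/-- Every projective module over the endomorphism ring of a generator `M` is of the form
`Hom_A(M, X)` with `X` a direct summand of a direct sum of copies of `M`. -/
lemma exists_isRetractOfCopies_of_projective [Module.Finite A ↥M] (hgen : IsGen A M)
    (P : ModuleCat.{0} (Module.End A ↥M)ᵐᵒᵖ) [Module.Projective (Module.End A ↥M)ᵐᵒᵖ P] :
    ∃ X : ModuleCat.{0} A, IsRetractOfCopies M X ∧
      Nonempty (↥P ≃ₗ[(Module.End A ↥M)ᵐᵒᵖ] (↥M →ₗ[A] ↥X)) := by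
  obtain ⟨s, hs⟩ := Module.projective_lifting_property
    (Finsupp.linearCombination (Module.End A ↥M)ᵐᵒᵖ (id : ↥P → ↥P)) LinearMap.id
    (Finsupp.linearCombination_id_surjective _ _)
  obtain ⟨e⟩ := nonempty_finsupp_linearEquiv_hom (A := A) (M := M) P
  let Y := ModuleCat.of A (↥P →₀ ↥M)
  let a : ↥P →ₗ[(Module.End A ↥M)ᵐᵒᵖ] (↥M →ₗ[A] ↥Y) := e.toLinearMap ∘ₗ s
  let b : (↥M →ₗ[A] ↥Y) →ₗ[(Module.End A ↥M)ᵐᵒᵖ] ↥P :=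
    Finsupp.linearCombination _ id ∘ₗ e.symm.toLinearMap
  have hba (x : ↥P) : b (a x) = x := by
    simpa [a, b] using LinearMap.congr_fun hs x
  obtain ⟨g, hg⟩ := homPost_surjective hgen Y Y (a ∘ₗ b)
  dsimp only at hg
  have hgg : g ≫ g = g := by
    apply homPost_injective hgen
    dsimp only
    rw [homPost_comp, hg]
    ext1 f
    simp [hba]
  have hgg' (y : ↥Y) : g.hom (g.hom y) = g.hom y := congr($(hgg).hom y)
  let X := ModuleCat.of A (LinearMap.range g.hom)
  let q : Y ⟶ X := ModuleCat.ofHom g.hom.rangeRestrict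
  let j : X ⟶ Y := ModuleCat.ofHom (LinearMap.range g.hom).subtype
  have hjq : j ≫ q = 𝟙 X := by
    refine ModuleCat.hom_ext (LinearMap.ext fun x => ?_)
    obtain ⟨_, y, rfl⟩ := x
    apply Subtype.ext
    exact hgg' y
  have hqj (f : ↥M →ₗ[A] ↥X) : homPost A M q (homPost A M j f) = f := by
    rw [← LinearMap.comp_apply, ← homPost_comp, hjq]
    rfl
  have hab (f : ↥M →ₗ[A] ↥Y) : a (b f) = homPost A M j (homPost A M q f) := by
    rw [← LinearMap.comp_apply, ← hg]
    rfl
  refine ⟨X, ⟨P, j.hom, q.hom, congr($(hjq).hom)⟩, ⟨LinearEquiv.ofLinearMap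
    (homPost A M q ∘ₗ a) (b ∘ₗ homPost A M j) ?_ ?_⟩⟩
  · ext1 f
    change homPost A M q (a (b (homPost A M j f))) = f
    rw [hab, hqj, hqj]
  · ext1 x
    change b (homPost A M j (homPost A M q (a x))) = x
    rw [← hab, hba, hba]

/-- Maps between modules over a finite-dimensional algebra form a finitely generated module over
the endomorphism ring. -/
lemma finite_hom_of_finite (k : Type) [Field k] [Algebra k A] [FiniteDimensional k A]
    [Module.Finite A ↥M] (X : ModuleCat.{0} A) [Module.Finite A ↥X] :
    Module.Finite (Module.End A ↥M)ᵐᵒᵖ (↥M →ₗ[A] ↥X) := by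
  let _ : Module k ↥M := Module.compHom M (algebraMap k A)
  have : IsScalarTower k A ↥M := ⟨fun c a x => by
    rw [Algebra.smul_def, mul_smul]; rfl⟩
  let _ : Module k ↥X := Module.compHom X (algebraMap k A)
  have : IsScalarTower k A ↥X := ⟨fun c a x => by
    rw [Algebra.smul_def, mul_smul]; rfl⟩
  have : Module.Finite k ↥M := Module.Finite.trans A ↥M
  have : Module.Finite k ↥X := Module.Finite.trans A ↥X
  have hfin : Module.Finite k (↥M →ₗ[A] ↥X) :=
    Module.Finite.of_injective (LinearMap.restrictScalarsₗ k A ↥M ↥X k)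
      (LinearMap.restrictScalars_injective k)
  obtain ⟨t, ht⟩ := hfin.fg_top
  refine ⟨t, top_le_iff.1 fun f _ => ?_⟩
  have hf : f ∈ Submodule.span k (t : Set (↥M →ₗ[A] ↥X)) := ht ▸ Submodule.mem_top
  induction hf using Submodule.span_induction with
  | mem f hf => exact Submodule.subset_span hf
  | zero => exact zero_mem _
  | add f g _ _ hf hg => exact add_mem (hf trivial) (hg trivial)
  | smul c f _ hf =>
    have : c • f = (MulOpposite.op (c • LinearMap.id) : (Module.End A ↥M)ᵐᵒᵖ) • f := by
      ext x
      change c • f x = f (c • x)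
      exact (LinearMap.map_smul_of_tower f c x).symm
    rw [this]
    exact Submodule.smul_mem _ _ (hf trivial)

end ProjectiveModules

section ShortExactLemmas

variable {A : Type} [Ring A] {K P X : Type} [AddCommGroup K] [Module A K] [AddCommGroup P]
  [Module A P] [AddCommGroup X] [Module A X]

lemma exists_comp_eq_of_exact_of_injective {i : K →ₗ[A] P} {p : P →ₗ[A] X}
    (hi : Function.Injective i) (hex : Function.Exact i p) {Y : Type} [AddCommGroup Y]
    [Module A Y] (f : Y →ₗ[A] P) (hf : p ∘ₗ f = 0) : ∃ g : Y →ₗ[A] K, i ∘ₗ g = f := by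
  have hmem (y : Y) : f y ∈ LinearMap.range i := (hex _).1 (LinearMap.congr_fun hf y)
  refine ⟨(LinearEquiv.ofInjective i hi).symm.toLinearMap ∘ₗ f.codRestrict _ hmem, ?_⟩
  ext y
  exact congrArg Subtype.val
    ((LinearEquiv.ofInjective i hi).apply_symm_apply ⟨f y, hmem y⟩)

lemma exists_comp_eq_of_exact_of_surjective {i : K →ₗ[A] P} {p : P →ₗ[A] X}
    (hex : Function.Exact i p) (hp : Function.Surjective p) {Y : Type} [AddCommGroup Y]
    [Module A Y] (f : P →ₗ[A] Y) (hf : f ∘ₗ i = 0) : ∃ g : X →ₗ[A] Y, g ∘ₗ p = f := by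
  have hle : LinearMap.ker p ≤ LinearMap.ker f := by
    intro x hx
    obtain ⟨y, rfl⟩ := (hex x).1 hx
    exact LinearMap.congr_fun hf y
  refine ⟨(LinearMap.ker p).liftQ f hle ∘ₗ (p.quotKerEquivOfSurjective hp).symm.toLinearMap, ?_⟩
  ext x
  have : (p.quotKerEquivOfSurjective hp).symm (p x) = Submodule.Quotient.mk x := by
    rw [LinearEquiv.symm_apply_eq]
    rfl
  simp [this]

end ShortExactLemmas

/-- A relation that can be continued in both directions admits bi-infinite chains. -/
lemma exists_int_chain {T : Type*} (r : T → T → Prop) (hforward : ∀ x, ∃ y, r x y)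
    (hbackward : ∀ x, ∃ y, r y x) (x : T) :
    ∃ f : ℤ → T, f 0 = x ∧ ∀ i, r (f i) (f (i + 1)) := by
  choose F hF using hforward
  choose G hG using hbackward
  let f : ℤ → T
    | Int.ofNat n => F^[n] x
    | Int.negSucc n => G^[n + 1] x
  refine ⟨f, rfl, fun i => ?_⟩
  match i with
  | Int.ofNat n =>
    change r (F^[n] x) (F^[n + 1] x)
    rw [Function.iterate_succ_apply']
    exact hF _
  | Int.negSucc 0 => exact hG x
  | Int.negSucc (n + 1) =>
    change r (G^[n + 1 + 1] x) (G^[n + 1] x)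
    rw [Function.iterate_succ_apply']
    exact hG _

section GorensteinProjective

variable {A : Type} [Ring A] {M : ModuleCat.{0} A}

/-- There is a short exact sequence `0 → Z → N → Z' → 0` with `N` a direct summand of a direct
sum of copies of `M`. -/
def HasExtensionByCopies (M Z Z' : ModuleCat.{0} A) : Prop :=
  ∃ (N : ModuleCat.{0} A) (i : ↥Z →ₗ[A] ↥N) (p : ↥N →ₗ[A] ↥Z'), IsRetractOfCopies M N ∧
    Function.Injective i ∧ Function.Exact i p ∧ Function.Surjective p

lemma MemG.exists_forward (k : Type) [Field k] [Algebra k A] [FiniteDimensional k A]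
    [Module.Injective A A] [Module.Finite A ↥M] (hgen : IsGen A M) (hso : SelfOrthogonal A M)
    {X : ModuleCat.{0} A} (hX : MemG A M X) :
    ∃ Y : ModuleCat.{0} A, MemG A M Y ∧ HasExtensionByCopies M X Y := by
  let N := ModuleCat.of A ((↥X →ₗ[A] ↥M) → ↥M)
  let i : ↥X →ₗ[A] ↥N := LinearMap.pi fun f => f
  let Y := ModuleCat.of A (↥N ⧸ LinearMap.range i)
  let p : ↥N →ₗ[A] ↥Y := (LinearMap.range i).mkQ
  have hN : IsRetractOfCopies M N := isRetractOfCopies_pi k _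
  have hi : Function.Injective i := by
    rw [injective_iff_map_eq_zero]
    intro x hx
    by_contra hx0
    obtain ⟨f, hf⟩ := exists_linearMap_generator_apply_ne_zero k hgen X hx0
    exact hf (congr_fun hx f)
  have hex : Function.Exact i p := LinearMap.exact_map_mkQ_range i
  have hp : Function.Surjective p := Submodule.mkQ_surjective _
  refine ⟨Y, fun n hn => ?_, N, i, p, hN, hi, hex, hp⟩
  obtain ⟨n, rfl⟩ := Nat.exists_eq_add_of_le' hn
  refine ⟨extZero_to_right_of_middle_of_left hi hex hp M (hN.extZero_right k hso n)
    (hX _ (by omega)).1, ?_⟩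
  cases n with
  | zero =>
    exact extZero_one_of_exists_extension hi hex hp M (hN.extZero_left hso 0)
      fun f => ⟨LinearMap.proj f, rfl⟩
  | succ n =>
    exact extZero_right_of_left_of_middle hi hex hp M (hX _ (by omega)).2
      (hN.extZero_left hso (n + 1))

lemma MemG.exists_backward (k : Type) [Field k] [Algebra k A] [FiniteDimensional k A]
    [Module.Finite A ↥M] (hgen : IsGen A M) (hso : SelfOrthogonal A M)
    {X : ModuleCat.{0} A} (hX : MemG A M X) :
    ∃ Y : ModuleCat.{0} A, MemG A M Y ∧ HasExtensionByCopies M Y X := by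
  let N := ModuleCat.of A ((↥M →ₗ[A] ↥X) →₀ ↥M)
  let p : ↥N →ₗ[A] ↥X := Finsupp.lsum ℕ fun f => f
  let Y := ModuleCat.of A (LinearMap.ker p)
  let i : ↥Y →ₗ[A] ↥N := (LinearMap.ker p).subtype
  have hN : IsRetractOfCopies M N := isRetractOfCopies_finsupp _
  have hi : Function.Injective i := Subtype.val_injective
  have hex : Function.Exact i p := LinearMap.exact_subtype_ker_map p
  have hps (f : ↥M →ₗ[A] ↥X) (m : ↥M) : p (Finsupp.single f m) = f m :=
    Finsupp.sum_single_index (map_zero f)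
  have hp : Function.Surjective p := by
    obtain ⟨n, m, π, h⟩ := exists_sum_apply_eq_one_of_isGen hgen
    intro x
    refine ⟨∑ j, Finsupp.single (LinearMap.toSpanSingleton A X x ∘ₗ π j) (m j), ?_⟩
    rw [map_sum]
    simp only [hps]
    exact sum_toSpanSingleton_comp_apply h x
  refine ⟨Y, fun n hn => ?_, N, i, p, hN, hi, hex, hp⟩
  obtain ⟨n, rfl⟩ := Nat.exists_eq_add_of_le' hn
  refine ⟨?_, extZero_left_of_middle_of_right hi hex hp M (hN.extZero_left hso n)
    (hX _ (by omega)).2⟩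
  cases n with
  | zero =>
    exact extZero_one_of_exists_lift hi hex hp M (hN.extZero_right k hso 0)
      fun f => ⟨Finsupp.lsingle f, LinearMap.ext fun m => hps f m⟩
  | succ n =>
    exact extZero_to_left_of_right_of_middle hi hex hp M (hX _ (by omega)).1
      (hN.extZero_right k hso (n + 1))

lemma nonempty_hom_linearEquiv_ker_homPost {Z N N' : ModuleCat.{0} A} {i : ↥Z →ₗ[A] ↥N}
    (g : N ⟶ N') (hi : Function.Injective i) (hex : Function.Exact i g.hom) :
    Nonempty ((↥M →ₗ[A] ↥Z) ≃ₗ[(Module.End A ↥M)ᵐᵒᵖ] LinearMap.ker (homPost A M g)) := by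
  have hmem (f : ↥M →ₗ[A] ↥Z) :
      homPost A M (ModuleCat.ofHom i) f ∈ LinearMap.ker (homPost A M g) := by
    rw [LinearMap.mem_ker]
    ext m
    exact hex.apply_apply_eq_zero (f m)
  refine ⟨LinearEquiv.ofBijective ((homPost A M (ModuleCat.ofHom i)).codRestrict _ hmem)
    ⟨fun f f' h => ?_, fun ⟨f, hf⟩ => ?_⟩⟩
  · ext m
    exact hi (LinearMap.congr_fun (congrArg Subtype.val h) m)
  · obtain ⟨f', hf'⟩ := exists_comp_eq_of_exact_of_injective hi hex f hf
    exact ⟨f', Subtype.ext hf'⟩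

variable (M) in
/-- The regular module over the endomorphism ring of `M` is `Hom_A(M, M)`. -/
def homSelfLinearEquiv :
    (↥M →ₗ[A] ↥M) ≃ₗ[(Module.End A ↥M)ᵐᵒᵖ] (Module.End A ↥M)ᵐᵒᵖ where
  toFun f := MulOpposite.op f
  invFun l := l.unop
  map_add' _ _ := rfl
  map_smul' _ _ := rfl
  left_inv _ := rfl
  right_inv _ := rfl

/-- Maps from `Hom_A(M, X)` to the regular module are induced by maps from `X` to `M`. -/
lemma exists_eq_homSelf_comp_homPost (hgen : IsGen A M) {X : ModuleCat.{0} A}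
    (φ : (↥M →ₗ[A] ↥X) →ₗ[(Module.End A ↥M)ᵐᵒᵖ] (Module.End A ↥M)ᵐᵒᵖ) :
    ∃ h : X ⟶ M, φ = (homSelfLinearEquiv M).toLinearMap ∘ₗ homPost A M h := by
  obtain ⟨h, hh⟩ := homPost_surjective hgen X M ((homSelfLinearEquiv M).symm.toLinearMap ∘ₗ φ)
  exact ⟨h, by dsimp only at hh; rw [hh]; rfl⟩

lemma eq_zero_of_homSelf_comp_homPost_eq_zero (hgen : IsGen A M) {X : ModuleCat.{0} A}
    {h : X ⟶ M} (h0 : (homSelfLinearEquiv M).toLinearMap ∘ₗ homPost A M h = 0) : h = 0 := by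
  apply homPost_injective hgen
  ext1 f
  exact (homSelfLinearEquiv M).injective (LinearMap.congr_fun h0 f)

theorem MemG.isGProj (k : Type) [Field k] [Algebra k A] [FiniteDimensional k A]
    [Module.Injective A A] [Module.Finite A ↥M] (hgen : IsGen A M) (hso : SelfOrthogonal A M)
    {X : ModuleCat.{0} A} (hX : MemG A M X) :
    IsGProj (Module.End A ↥M)ᵐᵒᵖ (HomModObj A M X) := by
  obtain ⟨Z, hZ0, hZ⟩ := exists_int_chain
    (fun Z Z' : {Z : ModuleCat.{0} A // MemG A M Z} => HasExtensionByCopies M Z Z')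
    (fun Z => by
      obtain ⟨Y, hY, h⟩ := Z.2.exists_forward k hgen hso
      exact ⟨⟨Y, hY⟩, h⟩)
    (fun Z => by
      obtain ⟨Y, hY, h⟩ := Z.2.exists_backward k hgen hso
      exact ⟨⟨Y, hY⟩, h⟩) ⟨X, hX⟩
  choose N i p hN hi hex hp using hZ
  let δ (j : ℤ) : N j ⟶ N (j + 1) := ModuleCat.ofHom (i (j + 1) ∘ₗ p j)
  refine ⟨fun j => HomModObj A M (N j), fun j => ModuleCat.ofHom (homPost A M (δ j)),
    fun j => (hN j).projective_hom, fun j => ?_, fun j φ => ?_, ?_⟩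
  · ext f
    constructor
    · rintro ⟨g, rfl⟩
      let g' : ↥M →ₗ[A] ↥(N j) := g
      rw [LinearMap.mem_ker]
      refine LinearMap.ext fun m => ?_
      change i (j + 1 + 1) (p (j + 1) (i (j + 1) (p j (g' m)))) = 0
      rw [(hex (j + 1)).apply_apply_eq_zero, map_zero]
    · intro hf
      have hf0 : p (j + 1) ∘ₗ f = 0 := LinearMap.ext fun m => hi (j + 1 + 1)
        ((LinearMap.congr_fun hf m).trans (map_zero _).symm)
      obtain ⟨g, hg⟩ := exists_comp_eq_of_exact_of_injective (hi (j + 1)) (hex (j + 1)) f hf0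
      obtain ⟨g', hg'⟩ := exists_lift_of_extZero_one (hi j) (hex j) (hp j) M
        ((Z j).2 1 le_rfl).1 g
      refine ⟨g', ?_⟩
      rw [← hg, ← hg']
      rfl
  · obtain ⟨h, hh⟩ := exists_eq_homSelf_comp_homPost hgen φ.hom
    constructor
    · intro hφ
      have h0 : δ j ≫ h = 0 := by
        apply eq_zero_of_homSelf_comp_homPost_eq_zero hgen
        refine LinearMap.ext fun f => ?_
        exact (LinearMap.congr_fun hh (homPost A M (δ j) f)).symm.trans congr($(hφ).hom f)
      have hhi : h.hom ∘ₗ i (j + 1) = 0 := by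
        ext z
        obtain ⟨y, rfl⟩ := hp j z
        exact congr($(h0).hom y)
      obtain ⟨h', hh'⟩ := exists_comp_eq_of_exact_of_surjective (hex (j + 1)) (hp (j + 1)) h.hom hhi
      obtain ⟨h'', hh''⟩ := exists_extension_of_extZero_one (hi (j + 1 + 1)) (hex (j + 1 + 1))
        (hp (j + 1 + 1)) M ((Z (j + 1 + 1 + 1)).2 1 le_rfl).2 h'
      refine ⟨ModuleCat.ofHom ((homSelfLinearEquiv M).toLinearMap ∘ₗ
        homPost A M (ModuleCat.ofHom h'')), ModuleCat.hom_ext ?_⟩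
      have h1 : h = δ (j + 1) ≫ ModuleCat.ofHom h'' := by
        ext1
        rw [← hh', ← hh'']
        rfl
      rw [hh, h1]
      rfl
    · rintro ⟨ψ, rfl⟩
      refine ModuleCat.hom_ext (LinearMap.ext fun f => ?_)
      let f' : ↥M →ₗ[A] ↥(N j) := f
      have h0 : homPost A M (δ (j + 1)) (homPost A M (δ j) f') = 0 := by
        refine LinearMap.ext fun m => ?_
        change i (j + 1 + 1) (p (j + 1) (i (j + 1) (p j (f' m)))) = 0
        rw [(hex (j + 1)).apply_apply_eq_zero, map_zero]
      exact (congrArg ψ.hom h0).trans (map_zero ψ.hom)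
  · have hex0 : Function.Exact (i 0) (δ 0).hom := by
      intro y
      rw [← hex 0 y]
      exact map_eq_zero_iff (i (0 + 1)) (hi (0 + 1))
    obtain ⟨e⟩ := nonempty_hom_linearEquiv_ker_homPost (M := M) (δ 0) (hi 0) hex0
    have hX0 : (Z 0 : ModuleCat.{0} A) = X := congrArg Subtype.val hZ0
    rw [← hX0]
    exact ⟨e⟩

/-- A module is finitely generated if its image under `Hom_A(M, -)` is. -/
lemma finite_of_finite_hom [Module.Finite A ↥M] (hgen : IsGen A M) (X : ModuleCat.{0} A)
    [Module.Finite (Module.End A ↥M)ᵐᵒᵖ (↥M →ₗ[A] ↥X)] : Module.Finite A ↥X := by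
  obtain ⟨n, m, π, h⟩ := exists_sum_apply_eq_one_of_isGen hgen
  obtain ⟨t, ht⟩ := Module.Finite.fg_top (R := (Module.End A ↥M)ᵐᵒᵖ) (M := ↥M →ₗ[A] ↥X)
  let S : Submodule A ↥X := ⨆ f ∈ t, LinearMap.range f
  have hS (f : ↥M →ₗ[A] ↥X) (x : ↥M) : f x ∈ S := by
    have hf : f ∈ Submodule.span (Module.End A ↥M)ᵐᵒᵖ (t : Set (↥M →ₗ[A] ↥X)) :=
      ht ▸ Submodule.mem_top
    induction hf using Submodule.span_induction generalizing x with
    | mem f hf => exact Submodule.mem_iSup_of_mem f (Submodule.mem_iSup_of_mem hf ⟨x, rfl⟩)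
    | zero => exact zero_mem _
    | add f g _ _ hf hg => exact add_mem (hf x) (hg x)
    | smul l f _ hf => exact hf (l.unop x)
  have hfg : S.FG := Submodule.fg_biSup t _ fun f _ => Module.Finite.fg_top.map f |> fun h => by
    rwa [Submodule.map_top] at h
  have htop : S = ⊤ := by
    rw [eq_top_iff]
    intro x _
    rw [← sum_toSpanSingleton_comp_apply h x]
    exact sum_mem fun i _ => hS _ _
  exact ⟨htop ▸ hfg⟩

theorem IsGProj.exists_memG (k : Type) [Field k] [Algebra k A] [FiniteDimensional k A]
    [Module.Finite A ↥M] (hgen : IsGen A M) (hso : SelfOrthogonal A M)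
    {G : ModuleCat.{0} (Module.End A ↥M)ᵐᵒᵖ} (hG : IsGProj (Module.End A ↥M)ᵐᵒᵖ G) :
    ∃ X : ModuleCat.{0} A, MemG A M X ∧
      Nonempty (↥G ≃ₗ[(Module.End A ↥M)ᵐᵒᵖ] (↥M →ₗ[A] ↥X)) := by
  obtain ⟨P, d, hP, hd, hdual, ⟨eG⟩⟩ := hG
  have hPN (j : ℤ) := exists_isRetractOfCopies_of_projective hgen (P j)
  choose N hN e using hPN
  replace e (j : ℤ) := (e j).some
  have hδ (j : ℤ) := homPost_surjective hgen (N j) (N (j + 1))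
    ((e (j + 1)).toLinearMap ∘ₗ (d j).hom ∘ₗ (e j).symm.toLinearMap)
  choose δ hδ using hδ
  have hδe (j : ℤ) (x : ↥(P j)) : homPost A M (δ j) (e j x) = e (j + 1) ((d j).hom x) := by
    simpa using LinearMap.congr_fun (hδ j) (e j x)
  -- exactness under `Hom_A(M, -)` and `Hom_A(-, M)`
  have hlift (j : ℤ) (f : ↥M →ₗ[A] ↥(N (j + 1))) (hf : (δ (j + 1)).hom ∘ₗ f = 0) :
      ∃ g, (δ j).hom ∘ₗ g = f := by
    obtain ⟨x, rfl⟩ := (e (j + 1)).surjective f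
    have h1 : e (j + 1 + 1) ((d (j + 1)).hom x) = 0 := (hδe (j + 1) x).symm.trans hf
    rw [LinearEquiv.map_eq_zero_iff] at h1
    obtain ⟨y, rfl⟩ : x ∈ LinearMap.range (d j).hom := hd j ▸ h1
    exact ⟨e j y, hδe j y⟩
  have hδδ (j : ℤ) (y : ↥(N j)) : (δ (j + 1)).hom ((δ j).hom y) = 0 := by
    have : δ j ≫ δ (j + 1) = 0 := by
      apply homPost_injective hgen
      ext1 f
      obtain ⟨x, rfl⟩ := (e j).surjective f
      change homPost A M (δ (j + 1)) (homPost A M (δ j) (e j x)) = 0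
      rw [hδe, hδe, LinearEquiv.map_eq_zero_iff]
      have : (d j).hom x ∈ LinearMap.ker (d (j + 1)).hom := hd j ▸ ⟨x, rfl⟩
      exact this
    exact congr($(this).hom y)
  have hextend (j : ℤ) (h : ↥(N (j + 1)) →ₗ[A] ↥M) (hh : h ∘ₗ (δ j).hom = 0) :
      ∃ h', h' ∘ₗ (δ (j + 1)).hom = h := by
    obtain ⟨ψ, hψ⟩ := (hdual j (ModuleCat.ofHom ((homSelfLinearEquiv M).toLinearMap ∘ₗ
      homPost A M (ModuleCat.ofHom h) ∘ₗ (e (j + 1)).toLinearMap))).1 (by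
        refine ModuleCat.hom_ext (LinearMap.ext fun x => ?_)
        change homSelfLinearEquiv M (h ∘ₗ e (j + 1) ((d j).hom x)) = 0
        rw [← hδe, LinearEquiv.map_eq_zero_iff]
        change (h ∘ₗ (δ j).hom) ∘ₗ e j x = 0
        rw [hh, LinearMap.zero_comp])
    obtain ⟨h', hh'⟩ := exists_eq_homSelf_comp_homPost hgen
      (ψ.hom ∘ₗ (e (j + 1 + 1)).symm.toLinearMap)
    refine ⟨h'.hom, ?_⟩
    have : δ (j + 1) ≫ h' = ModuleCat.ofHom h := by
      apply homPost_injective hgen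
      ext1 f
      obtain ⟨x, rfl⟩ := (e (j + 1)).surjective f
      apply (homSelfLinearEquiv M).injective
      have h1 : homSelfLinearEquiv M (homPost A M (ModuleCat.ofHom h) (e (j + 1) x)) =
        ψ.hom ((d (j + 1)).hom x) := congr($(hψ).hom x)
      have h2 := LinearMap.congr_fun hh' (homPost A M (δ (j + 1)) (e (j + 1) x))
      refine Eq.trans ?_ h1.symm
      refine h2.symm.trans ?_
      rw [hδe]
      simp
    exact congr($(this).hom)
  let X (j : ℤ) := ModuleCat.of A (LinearMap.ker (δ j).hom)
  let i (j : ℤ) : ↥(X j) →ₗ[A] ↥(N j) := (LinearMap.ker (δ j).hom).subtype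
  let p (j : ℤ) : ↥(N j) →ₗ[A] ↥(X (j + 1)) := (δ j).hom.codRestrict _ (hδδ j)
  have hi (j : ℤ) : Function.Injective (i j) := Subtype.val_injective
  have hex' (j : ℤ) : Function.Exact (i j) (δ j).hom := LinearMap.exact_subtype_ker_map _
  have hex (j : ℤ) : Function.Exact (i j) (p j) := by
    intro y
    rw [← hex' j y]
    exact (map_eq_zero_iff (i (j + 1)) (hi (j + 1))).symm
  have hp (j : ℤ) : Function.Surjective (p j) := by
    obtain ⟨n, m, π, h⟩ := exists_sum_apply_eq_one_of_isGen hgen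
    intro x
    choose g hg using fun l => hlift j (i (j + 1) ∘ₗ LinearMap.toSpanSingleton A _ x ∘ₗ π l) (by
      ext z
      exact (hex' (j + 1)).apply_apply_eq_zero _)
    refine ⟨∑ l, g l (m l), hi (j + 1) ?_⟩
    change (δ j).hom _ = _
    rw [map_sum]
    conv_rhs => rw [← sum_toSpanSingleton_comp_apply h x, map_sum]
    exact Finset.sum_congr rfl fun l _ => LinearMap.congr_fun (hg l) (m l)
  have hright (n : ℕ) : ∀ j, extZero A (n + 1) M (X j) := by
    induction n with
    | zero =>
      intro j
      refine extZero_one_of_exists_lift (hi j) (hex j) (hp j) M ((hN j).extZero_right k hso 0)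
        fun f => ?_
      obtain ⟨g, hg⟩ := hlift j (i (j + 1) ∘ₗ f) (by
        ext z
        exact (hex' (j + 1)).apply_apply_eq_zero _)
      exact ⟨g, LinearMap.ext fun z => hi (j + 1) (LinearMap.congr_fun hg z)⟩
    | succ n ih =>
      exact fun j => extZero_to_left_of_right_of_middle (hi j) (hex j) (hp j) M (ih (j + 1))
        ((hN j).extZero_right k hso (n + 1))
  have hleft (n : ℕ) : ∀ j, extZero A (n + 1) (X j) M := by
    induction n with
    | zero =>
      intro j
      obtain ⟨j, rfl⟩ : ∃ l, j = l + 1 + 1 + 1 := ⟨j - 3, by ring⟩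
      refine extZero_one_of_exists_extension (hi _) (hex _) (hp _) M ((hN _).extZero_left hso 0)
        fun f => ?_
      obtain ⟨h, hh⟩ := hextend j (f ∘ₗ p (j + 1)) (by
        ext z
        change f (p (j + 1) (i (j + 1) (p j z))) = 0
        rw [(hex (j + 1)).apply_apply_eq_zero, map_zero])
      refine ⟨h, LinearMap.ext fun x => ?_⟩
      obtain ⟨y, rfl⟩ := hp (j + 1) x
      exact LinearMap.congr_fun hh y
    | succ n ih =>
      intro j
      obtain ⟨j, rfl⟩ : ∃ l, j = l + 1 := ⟨j - 1, by ring⟩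
      exact extZero_right_of_left_of_middle (hi j) (hex j) (hp j) M (ih j)
        ((hN j).extZero_left hso (n + 1))
  refine ⟨X 0, fun n hn => ?_, ?_⟩
  · obtain ⟨n, rfl⟩ := Nat.exists_eq_add_of_le' hn
    exact ⟨hright n 0, hleft n 0⟩
  · obtain ⟨e'⟩ := nonempty_hom_linearEquiv_ker_homPost (M := M) (δ 0) (hi 0) (hex' 0)
    have hker : (LinearMap.ker (d 0).hom).map (e 0).toLinearMap =
        LinearMap.ker (homPost A M (δ 0)) := by
      ext f
      obtain ⟨x, rfl⟩ := (e 0).surjective f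
      rw [LinearMap.mem_ker, hδe, LinearEquiv.map_eq_zero_iff, Submodule.mem_map_equiv,
        LinearEquiv.symm_apply_apply, LinearMap.mem_ker]
    exact ⟨eG.trans (((e 0).ofSubmodules _ _ hker).trans e'.symm)⟩

end GorensteinProjective

/-- **Lemma 3.11(2)**. The functor `Hom_A(M,-)` restricts to an equivalence from `𝒢` onto
the Gorenstein-projective `Λ`-modules, and from `𝒢₀` onto the finitely generated
Gorenstein-projective `Λ`-modules, where `Λ = End_A(M)` (composition written on the right,
i.e. `(Module.End A M)ᵐᵒᵖ`). -/
theorem homFunctor_restricts_to_equivalence_onto_gorenstein_projectives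
    (k A : Type) [Field k] [Ring A] [Algebra k A] [FiniteDimensional k A]
    [Module.Injective A A]
    (M : ModuleCat.{0} A) [Module.Finite A ↥M]
    (hgen : IsGen A M) (hso : SelfOrthogonal A M) :
    (∀ X : ModuleCat.{0} A, MemG A M X →
      IsGProj (Module.End A ↥M)ᵐᵒᵖ (HomModObj A M X)) ∧
    (∀ X : ModuleCat.{0} A, MemG A M X → Module.Finite A ↥X →
      Module.Finite (Module.End A ↥M)ᵐᵒᵖ (↥M →ₗ[A] ↥X)) ∧
    (∀ X Y : ModuleCat.{0} A, MemG A M X → MemG A M Y →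
      Function.Bijective (fun g : X ⟶ Y => homPost A M g)) ∧
    (∀ N : ModuleCat.{0} (Module.End A ↥M)ᵐᵒᵖ, IsGProj (Module.End A ↥M)ᵐᵒᵖ N →
      ∃ X : ModuleCat.{0} A, MemG A M X ∧
        Nonempty (↥N ≃ₗ[(Module.End A ↥M)ᵐᵒᵖ] (↥M →ₗ[A] ↥X))) ∧
    (∀ N : ModuleCat.{0} (Module.End A ↥M)ᵐᵒᵖ, IsGProj (Module.End A ↥M)ᵐᵒᵖ N →
      Module.Finite (Module.End A ↥M)ᵐᵒᵖ ↥N →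
      ∃ X : ModuleCat.{0} A, MemG A M X ∧ Module.Finite A ↥X ∧
        Nonempty (↥N ≃ₗ[(Module.End A ↥M)ᵐᵒᵖ] (↥M →ₗ[A] ↥X))) := by
  refine ⟨fun X hX => hX.isGProj k hgen hso, fun X _ _ => finite_hom_of_finite k X,
    fun X Y _ _ => ⟨homPost_injective hgen X Y, homPost_surjective hgen X Y⟩,
    fun N hN => hN.exists_memG k hgen hso, fun N hN _ => ?_⟩
  obtain ⟨X, hX, ⟨e⟩⟩ := hN.exists_memG k hgen hso
  have := Module.Finite.equiv e
  exact ⟨X, hX, finite_of_finite_hom hgen X, ⟨e⟩⟩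
end

section
/- Let k be a field, A a finite-dimensional self-injective k-algebra, and M a finitely generated self-orthogonal generator for A-mod. Then: (i) every A-module X fits into a short exact sequence 0 → K → G → X → 0 with G ∈ 𝒢 and Ext_A^1(G',K) = 0 for all G' ∈ 𝒢, and into a short exact sequence 0 → X → G'' → C → 0 with G'' ∈ 𝒢 and Ext_A^1(C,G') = 0 for all G' ∈ 𝒢 (so (𝒢, 𝒢^{⊥1}) and (^{⊥1}𝒢, 𝒢) are cotorsion pairs in A-Mod); (ii) 𝒢 ∩ {Y : Ext_A^1(G',Y) = 0 for all G' ∈ 𝒢} = Add(M) = {Y : Ext_A^1(Y,G') = 0 for all G' ∈ 𝒢} ∩ 𝒢. (Lemma on cotorsion pairs, Lemma 3.13(2).) -/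
open CategoryTheory
namespace SelfOrth

section Factor
variable {A : Type*} [Ring A] {X Y Z : Type*} [AddCommGroup X] [AddCommGroup Y] [AddCommGroup Z]
  [Module A X] [Module A Y] [Module A Z]

theorem exists_comp_eq_of_ker_le (s : X →ₗ[A] Y) (hs : Function.Surjective s) (t : X →ₗ[A] Z)
    (h : ∀ x, s x = 0 → t x = 0) : ∃ e : Y →ₗ[A] Z, ∀ x, e (s x) = t x := by
  refine ⟨((LinearMap.ker s).liftQ t fun x hx => h x hx) ∘ₗ
    (s.quotKerEquivOfSurjective hs).symm.toLinearMap, fun x => ?_⟩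
  have : (s.quotKerEquivOfSurjective hs).symm (s x) = Submodule.Quotient.mk x := by
    rw [LinearEquiv.symm_apply_eq]; rfl
  rw [LinearMap.comp_apply, LinearEquiv.coe_coe, this]
  exact Submodule.liftQ_apply _ _ _

theorem exists_comp_eq_of_mem_range (j : Y →ₗ[A] Z) (hj : Function.Injective j) (t : X →ₗ[A] Z)
    (h : ∀ x, t x ∈ Set.range j) : ∃ e : X →ₗ[A] Y, ∀ x, j (e x) = t x := by
  refine ⟨(LinearEquiv.ofInjective j hj).symm.toLinearMap ∘ₗ
    t.codRestrict (LinearMap.range j) h, fun x => ?_⟩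
  have := LinearEquiv.apply_symm_apply (LinearEquiv.ofInjective j hj)
    (t.codRestrict (LinearMap.range j) h x)
  exact congrArg Subtype.val this

end Factor

variable {A : Type} [Ring A]

/-- Elementwise form of `Ext¹(X, Y) = 0`: maps to `Y` extend along inclusions with cokernel `X`. -/
def ExtVanish (A : Type) [Ring A] (X Y : Type) [AddCommGroup X] [Module A X] [AddCommGroup Y]
    [Module A Y] : Prop :=
  ∀ (L Q : Type) [AddCommGroup L] [Module A L] [AddCommGroup Q] [Module A Q]
    (i : L →ₗ[A] Q) (p : Q →ₗ[A] X), Function.Injective i → Function.Surjective p →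
    Function.Exact i p → ∀ h : L →ₗ[A] Y, ∃ e : Q →ₗ[A] Y, ∀ l, e (i l) = h l

section Basic
variable {X Y L Q J Z : Type} [AddCommGroup X] [Module A X] [AddCommGroup Y] [Module A Y]
  [AddCommGroup L] [Module A L] [AddCommGroup Q] [Module A Q]
  [AddCommGroup J] [Module A J] [AddCommGroup Z] [Module A Z]

theorem extVanish_of_projective [Module.Projective A Q] (i : L →ₗ[A] Q) (p : Q →ₗ[A] X)
    (hp : Function.Surjective p) (hex : Function.Exact i p)
    (H : ∀ h : L →ₗ[A] Y, ∃ e : Q →ₗ[A] Y, ∀ l, e (i l) = h l) : ExtVanish A X Y := by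
  intro L' Q' _ _ _ _ i' p' hi' hp' hex' h
  obtain ⟨u, hu⟩ := Module.projective_lifting_property p' p hp'
  have hu' : ∀ q, p' (u q) = p q := fun q => LinearMap.congr_fun hu q
  obtain ⟨v, hv⟩ := exists_comp_eq_of_mem_range i' hi' (u ∘ₗ i) fun l =>
    (hex' _).1 (by simp [hu', hex.apply_apply_eq_zero])
  obtain ⟨e, he⟩ := H (h ∘ₗ v)
  obtain ⟨e', he'⟩ := exists_comp_eq_of_ker_le (i'.coprod u) (fun q' => by
    obtain ⟨q, hq⟩ := hp (p' q')
    obtain ⟨l, hl⟩ := (hex' (q' - u q)).1 (by simp [hu', hq])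
    exact ⟨(l, q), by simp [hl]⟩) (h.coprod e) (by
    rintro ⟨l, q⟩ hlq
    simp only [LinearMap.coprod_apply] at hlq ⊢
    obtain ⟨l₀, rfl⟩ := (hex q).1 (by
      have := congrArg p' hlq
      simpa [hu', hex'.apply_apply_eq_zero] using this)
    have : l + v l₀ = 0 := hi' (by simpa [hv] using hlq)
    rw [he, LinearMap.comp_apply, ← map_add, this, map_zero])
  exact ⟨e', fun l => by simpa using he' (l, 0)⟩

theorem ExtVanish.exists_lift (H : ExtVanish A X Y) (j : Y →ₗ[A] J) (q : J →ₗ[A] Z)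
    (hj : Function.Injective j) (hex : Function.Exact j q) (f : X →ₗ[A] Z)
    (hf : ∀ x, ∃ t, q t = f x) : ∃ g : X →ₗ[A] J, ∀ x, q (g x) = f x := by
  let E : Submodule A (X × J) := LinearMap.ker (f.coprod (-q))
  have hE : ∀ z : E, q z.1.2 = f z.1.1 := fun z => by
    have := z.2
    simp only [E, LinearMap.mem_ker, LinearMap.coprod_apply, LinearMap.neg_apply] at this
    exact (add_neg_eq_zero.1 this).symm
  let i : Y →ₗ[A] E := (LinearMap.inr A X J ∘ₗ j).codRestrict E fun y => by
    simp [E, hex.apply_apply_eq_zero]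
  let p : E →ₗ[A] X := LinearMap.fst A X J ∘ₗ E.subtype
  obtain ⟨e, he⟩ := H Y E i p (fun a b hab => hj (congrArg (fun z : E => z.1.2) hab))
    (fun x => by
      obtain ⟨t, ht⟩ := hf x
      exact ⟨⟨(x, t), by simp [E, ht]⟩, rfl⟩)
    (fun z => by
      constructor
      · intro hz
        have hz : z.1.1 = 0 := hz
        obtain ⟨y, hy⟩ := (hex z.1.2).1 (by rw [hE, hz, map_zero])
        exact ⟨y, Subtype.ext (Prod.ext hz.symm hy)⟩
      · rintro ⟨y, rfl⟩; rfl) LinearMap.id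
  obtain ⟨g, hg⟩ := exists_comp_eq_of_ker_le p (fun x => by
      obtain ⟨t, ht⟩ := hf x
      exact ⟨⟨(x, t), by simp [E, ht]⟩, rfl⟩)
    (LinearMap.snd A X J ∘ₗ E.subtype - j ∘ₗ e) (fun z hz => by
      have hz : z.1.1 = 0 := hz
      obtain ⟨y, hy⟩ := (hex z.1.2).1 (by rw [hE, hz, map_zero])
      have : z = i y := Subtype.ext (Prod.ext hz hy.symm)
      rw [this]
      simp only [LinearMap.sub_apply, LinearMap.comp_apply, he]
      exact sub_self _)
  refine ⟨g, fun x => ?_⟩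
  obtain ⟨t, ht⟩ := hf x
  have := hg ⟨(x, t), by simp [E, ht]⟩
  have h2 : g x = t - j (e ⟨(x, t), by simp [E, ht]⟩) := this
  rw [h2, map_sub, hex.apply_apply_eq_zero, sub_zero, ht]

theorem extVanish_of_injective [Module.Injective A J] (j : Y →ₗ[A] J) (q : J →ₗ[A] Z)
    (hj : Function.Injective j) (hex : Function.Exact j q)
    (H : ∀ f : X →ₗ[A] Z, (∀ x, ∃ t, q t = f x) → ∃ g : X →ₗ[A] J, ∀ x, q (g x) = f x) :
    ExtVanish A X Y := by
  intro L Q _ _ _ _ i p hi hp hexip h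
  obtain ⟨u, hu⟩ := Module.Injective.out i hi (j ∘ₗ h)
  obtain ⟨f, hf⟩ := exists_comp_eq_of_ker_le p hp (q ∘ₗ u) (fun x hx => by
    obtain ⟨l, rfl⟩ := (hexip x).1 hx
    simp [hu, hex.apply_apply_eq_zero])
  obtain ⟨g, hg⟩ := H f (fun x => by
    obtain ⟨t, rfl⟩ := hp x
    exact ⟨u t, (hf t).symm⟩)
  obtain ⟨e, he⟩ := exists_comp_eq_of_mem_range j hj (u - g ∘ₗ p) (fun x =>
    (hex _).1 (by simp [hg, hf]))
  exact ⟨e, fun l => hj (by simp [he, hu, hexip.apply_apply_eq_zero])⟩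

/-- Dimension shift: `Ext²(X, Y)` computed from a syzygy of `X` or from a cosyzygy of `Y`. -/
theorem extVanish_syzygy_iff [Module.Projective A Q] [Module.Injective A J]
    (i : L →ₗ[A] Q) (p : Q →ₗ[A] X) (hi : Function.Injective i) (hp : Function.Surjective p)
    (hex : Function.Exact i p) (j : Y →ₗ[A] J) (q : J →ₗ[A] Z) (hj : Function.Injective j)
    (hq : Function.Surjective q) (hex' : Function.Exact j q) :
    ExtVanish A L Y ↔ ExtVanish A X Z := by
  constructor
  · intro H
    refine extVanish_of_projective i p hp hex fun h => ?_
    obtain ⟨g, hg⟩ := H.exists_lift j q hj hex' h fun x => hq _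
    obtain ⟨u, hu⟩ := Module.Injective.out i hi g
    exact ⟨q ∘ₗ u, fun l => by simp [hu, hg]⟩
  · intro H
    refine extVanish_of_injective j q hj hex' fun f _ => ?_
    obtain ⟨e, he⟩ := H L Q i p hi hp hex f
    obtain ⟨u, hu⟩ := Module.projective_lifting_property q e hq
    exact ⟨u ∘ₗ i, fun x => by
      have := LinearMap.congr_fun hu (i x)
      simpa [he] using this⟩

end Basic

/-- `Z (n + 1)` is a syzygy of `Z n` for every `n`. -/
def IsSyzygySeq (Z : ℕ → ModuleCat.{0} A) : Prop :=
  ∀ n, ∃ (P : ModuleCat.{0} A) (i : Z (n + 1) →ₗ[A] P) (p : P →ₗ[A] Z n), Module.Projective A P ∧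
    Function.Injective i ∧ Function.Surjective p ∧ Function.Exact i p

/-- `W (n + 1)` is a cosyzygy of `W n` for every `n`. -/
def IsCosyzygySeq (W : ℕ → ModuleCat.{0} A) : Prop :=
  ∀ n, ∃ (J : ModuleCat.{0} A) (j : W n →ₗ[A] J) (q : J →ₗ[A] W (n + 1)), Module.Injective A J ∧
    Function.Injective j ∧ Function.Surjective q ∧ Function.Exact j q

theorem extVanish_syzygySeq_iff {Z W : ℕ → ModuleCat.{0} A} (hZ : IsSyzygySeq Z)
    (hW : IsCosyzygySeq W) (n : ℕ) : ExtVanish A (Z n) (W 0) ↔ ExtVanish A (Z 0) (W n) := by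
  suffices ∀ a b, ExtVanish A (Z a) (W b) ↔ ExtVanish A (Z 0) (W (b + a)) by
    have := this n 0
    rwa [zero_add] at this
  intro a
  induction a with
  | zero => intro b; rfl
  | succ a ih =>
    intro b
    obtain ⟨P, i, p, hP, hi, hp, hex⟩ := hZ a
    obtain ⟨J, j, q, hJ, hj, hq, hex'⟩ := hW b
    rw [extVanish_syzygy_iff i p hi hp hex j q hj hq hex', ih]
    rw [show b + 1 + a = b + (a + 1) by omega]

end SelfOrth

namespace SelfOrth

variable {A : Type} [Ring A]

/-- Vanishing of `Ext` in terms of maps out of a projective resolution. -/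
theorem extZero_succ_iff {X : ModuleCat.{0} A} (P : ProjectiveResolution X) (Y : ModuleCat.{0} A)
    (n : ℕ) : extZero A (n + 1) X Y ↔
      ∀ f : P.complex.X (n + 1) ⟶ Y, P.complex.d (n + 2) (n + 1) ≫ f = 0 →
        ∃ g : P.complex.X n ⟶ Y, P.complex.d (n + 1) n ≫ g = f := by
  unfold extZero
  rw [← ModuleCat.isZero_iff_subsingleton,
    ((P.isoExt (R := ℤ) (n + 1) Y)).isZero_iff,
    ← HomologicalComplex.exactAt_iff_isZero_homology,
    HomologicalComplex.exactAt_iff' _ n (n + 1) (n + 2) (by simp) (by simp),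
    ShortComplex.moduleCat_exact_iff]
  rfl

/-- The syzygies of `X` attached to a projective resolution. -/
noncomputable def syzygy {X : ModuleCat.{0} A} (P : ProjectiveResolution X) : ℕ → ModuleCat.{0} A
  | 0 => X
  | n + 1 => ModuleCat.of A (LinearMap.range (P.complex.d (n + 1) n).hom)

theorem exists_syzygy_cover {X : ModuleCat.{0} A} (P : ProjectiveResolution X) (n : ℕ) :
    ∃ p : P.complex.X n →ₗ[A] syzygy P n, Function.Surjective p ∧
      Function.Exact (LinearMap.range (P.complex.d (n + 1) n).hom).subtype p := by
  cases n with
  | zero =>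
    refine ⟨(P.π.f 0).hom, (ModuleCat.epi_iff_surjective _).1 inferInstance, ?_⟩
    have := (ShortComplex.moduleCat_exact_iff_range_eq_ker _).1 P.exact₀
    exact (LinearMap.exact_iff (f := (LinearMap.range (P.complex.d 1 0).hom).subtype)
      (g := (P.π.f 0).hom)).2 (by rw [Submodule.range_subtype]; exact this.symm)
  | succ n =>
    refine ⟨(P.complex.d (n + 1) n).hom.rangeRestrict, LinearMap.surjective_rangeRestrict _, ?_⟩
    have := (ShortComplex.moduleCat_exact_iff_range_eq_ker _).1 (P.exact_succ n)
    exact (LinearMap.exact_iff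
      (f := (LinearMap.range (P.complex.d (n + 2) (n + 1)).hom).subtype)
      (g := (P.complex.d (n + 1) n).hom.rangeRestrict)).2
      (by rw [Submodule.range_subtype, LinearMap.ker_rangeRestrict]; exact this.symm)

theorem projective_of_resolution {X : ModuleCat.{0} A} (P : ProjectiveResolution X) (n : ℕ) :
    Module.Projective A (P.complex.X n) :=
  (IsProjective.iff_projective _).2 (P.projective n)

theorem isSyzygySeq_syzygy {X : ModuleCat.{0} A} (P : ProjectiveResolution X) :
    IsSyzygySeq (syzygy P) := fun n => by
  obtain ⟨p, hp, hex⟩ := exists_syzygy_cover P n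
  exact ⟨P.complex.X n, (LinearMap.range (P.complex.d (n + 1) n).hom).subtype, p,
    projective_of_resolution P n, Subtype.val_injective, hp, hex⟩

theorem extZero_iff_extVanish_syzygy {X : ModuleCat.{0} A} (P : ProjectiveResolution X)
    (Y : ModuleCat.{0} A) (n : ℕ) :
    extZero A (n + 1) X Y ↔ ExtVanish A (syzygy P n) Y := by
  obtain ⟨p, hp, hex⟩ := exists_syzygy_cover P n
  have := projective_of_resolution P n
  rw [extZero_succ_iff P]
  constructor
  · intro H
    refine extVanish_of_projective _ p hp hex fun h => ?_
    obtain ⟨g, hg⟩ := H (ModuleCat.ofHom (h ∘ₗ (P.complex.d (n + 1) n).hom.rangeRestrict)) (by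
      ext x
      have hz : (P.complex.d (n + 1) n).hom.rangeRestrict ((P.complex.d (n + 2) (n + 1)).hom x)
          = 0 := Subtype.ext (by
        have := P.complex.d_comp_d (n + 2) (n + 1) n
        exact ConcreteCategory.congr_hom this x)
      exact (congrArg h hz).trans (map_zero h))
    refine ⟨g.hom, ?_⟩
    rintro ⟨_, x, rfl⟩
    exact ConcreteCategory.congr_hom hg x
  · intro H f hf
    obtain ⟨h, hh⟩ := exists_comp_eq_of_ker_le (P.complex.d (n + 1) n).hom.rangeRestrict
      (LinearMap.surjective_rangeRestrict _) f.hom (fun x hx => by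
        have hx' : (P.complex.d (n + 1) n).hom x = 0 := congrArg Subtype.val hx
        have := (ShortComplex.moduleCat_exact_iff _).1 (P.exact_succ n) x hx'
        obtain ⟨y, rfl⟩ := this
        exact ConcreteCategory.congr_hom hf y)
    obtain ⟨e, he⟩ := H _ _ (LinearMap.range (P.complex.d (n + 1) n).hom).subtype p
      Subtype.val_injective hp hex h
    refine ⟨ModuleCat.ofHom e, ?_⟩
    ext x
    exact (he _).trans (hh x)

theorem extZero_one_iff (X Y : ModuleCat.{0} A) : extZero A 1 X Y ↔ ExtVanish A X Y :=
  extZero_iff_extVanish_syzygy (projectiveResolution X) Y 0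

theorem exists_isCosyzygySeq (Y : ModuleCat.{0} A) :
    ∃ W : ℕ → ModuleCat.{0} A, IsCosyzygySeq W ∧ W 0 = Y := by
  have step : ∀ W : ModuleCat.{0} A, ∃ (W' J : ModuleCat.{0} A) (j : W →ₗ[A] J)
      (q : J →ₗ[A] W'), Module.Injective A J ∧ Function.Injective j ∧ Function.Surjective q ∧
      Function.Exact j q := fun W => by
    have hJ : Module.Injective A (Injective.under W : ModuleCat.{0} A) :=
      Module.injective_module_of_injective_object A _
        (inj := inferInstanceAs (Injective (Injective.under W)))
    refine ⟨ModuleCat.of A (_ ⧸ LinearMap.range (Injective.ι W).hom), Injective.under W,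
      (Injective.ι W).hom, Submodule.mkQ _, hJ,
      (ModuleCat.mono_iff_injective _).1 inferInstance, Submodule.mkQ_surjective _, ?_⟩
    rw [LinearMap.exact_iff, Submodule.ker_mkQ]
  choose f hf using step
  exact ⟨fun n => Nat.rec Y (fun _ W => f W) n, fun n => hf _, rfl⟩

theorem extZero_iff_of_isCosyzygySeq {W : ℕ → ModuleCat.{0} A} (hW : IsCosyzygySeq W)
    (X : ModuleCat.{0} A) (n : ℕ) : extZero A (n + 1) X (W 0) ↔ ExtVanish A X (W n) := by
  rw [extZero_iff_extVanish_syzygy (projectiveResolution X),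
    extVanish_syzygySeq_iff (isSyzygySeq_syzygy _) hW]
  rfl

theorem extZero_iff_of_isSyzygySeq {Z : ℕ → ModuleCat.{0} A} (hZ : IsSyzygySeq Z)
    (Y : ModuleCat.{0} A) (n : ℕ) : extZero A (n + 1) (Z 0) Y ↔ ExtVanish A (Z n) Y := by
  obtain ⟨W, hW, rfl⟩ := exists_isCosyzygySeq Y
  rw [extZero_iff_of_isCosyzygySeq hW, extVanish_syzygySeq_iff hZ hW]

/-- Membership in `𝒢` via syzygies and cosyzygies of `M`. -/
theorem memG_iff {Z W : ℕ → ModuleCat.{0} A} (hZ : IsSyzygySeq Z) (hW : IsCosyzygySeq W)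
    {M : ModuleCat.{0} A} (hZM : Z 0 = M) (hWM : W 0 = M) (X : ModuleCat.{0} A) :
    MemG A M X ↔ ∀ n, ExtVanish A (Z n) X ∧ ExtVanish A X (W n) := by
  constructor
  · intro h n
    obtain ⟨h1, h2⟩ := h (n + 1) (by omega)
    rw [← hZM] at h1
    rw [← hWM] at h2
    exact ⟨(extZero_iff_of_isSyzygySeq hZ X n).1 h1, (extZero_iff_of_isCosyzygySeq hW X n).1 h2⟩
  · intro h n hn
    obtain ⟨n, rfl⟩ := Nat.exists_eq_add_of_le' hn
    constructor
    · rw [← hZM]; exact (extZero_iff_of_isSyzygySeq hZ X n).2 (h n).1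
    · rw [← hWM]; exact (extZero_iff_of_isCosyzygySeq hW X n).2 (h n).2

end SelfOrth

namespace SelfOrth

/-- The left module `Hom_k(A, k)`, with `(a • φ) b = φ (b * a)`. -/
def DualReg (k A : Type) [Field k] [Ring A] [Algebra k A] : Type := A →ₗ[k] k

namespace DualReg
variable {k A : Type} [Field k] [Ring A] [Algebra k A]

noncomputable instance : AddCommGroup (DualReg k A) := inferInstanceAs (AddCommGroup (A →ₗ[k] k))

instance : FunLike (DualReg k A) A k := inferInstanceAs (FunLike (A →ₗ[k] k) A k)

instance : LinearMapClass (DualReg k A) k A k := inferInstanceAs (LinearMapClass (A →ₗ[k] k) k A k)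

@[ext]
theorem ext {φ ψ : DualReg k A} (h : ∀ a, φ a = ψ a) : φ = ψ := DFunLike.ext _ _ h

/-- A functional on `A` as an element of `DualReg k A`. -/
def ofLinear (f : A →ₗ[k] k) : DualReg k A := f

@[simp] theorem ofLinear_apply (f : A →ₗ[k] k) (a : A) : ofLinear f a = f a := rfl

@[simp] theorem zero_apply (a : A) : (0 : DualReg k A) a = 0 := rfl

@[simp] theorem add_apply (φ ψ : DualReg k A) (a : A) : (φ + ψ) a = φ a + ψ a := rfl

noncomputable instance : SMul A (DualReg k A) :=
  ⟨fun a φ => (show A →ₗ[k] k from φ) ∘ₗ LinearMap.mulRight k a⟩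

@[simp] theorem smul_apply (a : A) (φ : DualReg k A) (b : A) : (a • φ) b = φ (b * a) := rfl

noncomputable instance : Module A (DualReg k A) where
  one_smul φ := by ext; simp
  mul_smul a b φ := by ext; simp [mul_assoc]
  smul_zero a := by ext; simp
  smul_add a φ ψ := by ext; simp
  add_smul a b φ := by ext; simp [mul_add]
  zero_smul φ := by ext; simp

@[simp] theorem sum_apply {ι : Type*} (s : Finset ι) (f : ι → DualReg k A) (a : A) :
    (∑ i ∈ s, f i) a = ∑ i ∈ s, f i a := by
  classical
  induction s using Finset.induction_on with
  | empty => simp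
  | insert i s hi ih => simp [Finset.sum_insert hi, ih]

theorem apply_algebraMap_mul (φ : DualReg k A) (c : k) (a : A) :
    φ (algebraMap k A c * a) = c * φ a := by
  rw [← Algebra.smul_def, map_smul, smul_eq_mul]

section
variable {X : Type} [AddCommGroup X] [Module A X] [Module k X] [IsScalarTower k A X]

/-- The coinduction correspondence: functionals on `X` are `A`-linear maps `X → Hom_k(A, k)`. -/
noncomputable def lift (f : X →ₗ[k] k) : X →ₗ[A] DualReg k A where
  toFun x := ofLinear (f ∘ₗ
    { toFun := fun a : A => a • x
      map_add' := fun a b => add_smul a b x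
      map_smul' := fun c a => smul_assoc c a x })
  map_add' x y := by ext; simp
  map_smul' a x := by ext; simp [mul_smul]

@[simp] theorem lift_apply (f : X →ₗ[k] k) (x : X) (a : A) : lift f x a = f (a • x) := rfl

/-- The functional attached to a map `X → Hom_k(A, k)`. -/
noncomputable def functional (h : X →ₗ[A] DualReg k A) : X →ₗ[k] k where
  toFun x := h x 1
  map_add' x y := by simp
  map_smul' c x := by
    rw [← algebraMap_smul A c x, map_smul, smul_apply, one_mul, ← mul_one (algebraMap k A c),
      apply_algebraMap_mul]
    rfl

@[simp] theorem functional_apply (h : X →ₗ[A] DualReg k A) (x : X) : functional h x = h x 1 := rfl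

end

theorem apply_eq_apply_one {X : Type} [AddCommGroup X] [Module A X] (h : X →ₗ[A] DualReg k A)
    (x : X) (a : A) : h x a = h (a • x) 1 := by simp

instance injective : Module.Injective A (DualReg k A) where
  out X Y _ _ _ _ f hf g := by
    let := Module.compHom X (algebraMap k A)
    let := Module.compHom Y (algebraMap k A)
    have : IsScalarTower k A X := ⟨fun c a x => by
      rw [Algebra.smul_def, mul_smul]; rfl⟩
    have : IsScalarTower k A Y := ⟨fun c a x => by
      rw [Algebra.smul_def, mul_smul]; rfl⟩
    obtain ⟨r, hr⟩ := (f.restrictScalars k).exists_leftInverse_of_injective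
      (LinearMap.ker_eq_bot.2 hf)
    refine ⟨lift (functional g ∘ₗ r), fun x => ?_⟩
    ext a
    have : r (f (a • x)) = a • x := LinearMap.congr_fun hr (a • x)
    rw [lift_apply, ← map_smul, LinearMap.comp_apply, this]
    simp

/-- Right multiplication on `Hom_k(A, k)`: `φ ↦ (a ↦ φ (c * a))`. -/
noncomputable def rmul (c : A) : DualReg k A →ₗ[A] DualReg k A where
  toFun φ := (show A →ₗ[k] k from φ) ∘ₗ LinearMap.mulLeft k c
  map_add' φ ψ := rfl
  map_smul' a φ := by
    ext b
    change φ (c * b * a) = φ (c * (b * a))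
    rw [mul_assoc]

@[simp] theorem rmul_apply (c : A) (φ : DualReg k A) (a : A) : rmul c φ a = φ (c * a) := rfl

theorem exists_eq_rmul [FiniteDimensional k A] (u : DualReg k A →ₗ[A] DualReg k A) :
    ∃ c : A, u = rmul c := by
  let v : Module.Dual k (Module.Dual k A) :=
    { toFun := fun f => u (ofLinear f) 1
      map_add' := fun f g => by
        have : ofLinear (f + g) = ofLinear f + ofLinear g := rfl
        rw [this, map_add, add_apply]
      map_smul' := fun c f => by
        have : ofLinear (c • f) = algebraMap k A c • ofLinear f := by
          ext a
          rw [smul_apply, ← Algebra.commutes, apply_algebraMap_mul]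
          rfl
        rw [this, map_smul, smul_apply, one_mul, ← mul_one (algebraMap k A c),
          apply_algebraMap_mul]
        rfl }
  obtain ⟨c, hc⟩ := (Module.evalEquiv k A).surjective v
  refine ⟨c, LinearMap.ext fun φ => DualReg.ext fun a => ?_⟩
  have h : ∀ f : DualReg k A, f c = u f 1 := fun f => LinearMap.congr_fun hc f
  rw [apply_eq_apply_one, ← h, smul_apply, rmul_apply]

end DualReg

section Matrices
variable {k A : Type} [Field k] [Ring A] [Algebra k A] {p q r : ℕ}
variable {X X' : Type} [AddCommGroup X] [Module A X] [AddCommGroup X'] [Module A X']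

/-- A matrix over `A` acting on column vectors with entries in a module. -/
def act (F : Matrix (Fin p) (Fin q) A) (x : Fin q → X) : Fin p → X := fun i => ∑ j, F i j • x j

theorem map_act (f : X →ₗ[A] X') (F : Matrix (Fin p) (Fin q) A) (x : Fin q → X) (i : Fin p) :
    f (act F x i) = act F (fun j => f (x j)) i := by simp [act]

theorem act_sub (F : Matrix (Fin p) (Fin q) A) (x y : Fin q → X) :
    act F (x - y) = act F x - act F y := by
  ext i; simp [act, smul_sub]

theorem act_add (F : Matrix (Fin p) (Fin q) A) (x y : Fin q → X) :
    act F (x + y) = act F x + act F y := by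
  ext i; simp [act, smul_add, Finset.sum_add_distrib]

theorem act_zero (F : Matrix (Fin p) (Fin q) A) : act F (0 : Fin q → X) = 0 := by
  ext i; simp [act]

theorem act_act (F : Matrix (Fin p) (Fin q) A) (E : Matrix (Fin q) (Fin r) A) (x : Fin r → X) :
    act F (act E x) = act (F * E) x := by
  ext i
  simp only [act, Matrix.mul_apply, Finset.smul_sum, Finset.sum_smul, mul_smul]
  exact Finset.sum_comm

/-- The map `Hom_k(A, k)^p → Hom_k(A, k)^q` induced by a `p × q` matrix. -/
noncomputable def dualAct (k : Type) [Field k] [Algebra k A] (F : Matrix (Fin p) (Fin q) A) :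
    (Fin p → DualReg k A) →ₗ[A] (Fin q → DualReg k A) :=
  LinearMap.pi fun j => ∑ i, DualReg.rmul (F i j) ∘ₗ LinearMap.proj i

theorem dualAct_apply (F : Matrix (Fin p) (Fin q) A) (g : Fin p → DualReg k A) (j : Fin q)
    (a : A) : dualAct k F g j a = ∑ i, g i (F i j * a) := by
  simp [dualAct, LinearMap.sum_apply]

theorem exists_eq_dualAct [FiniteDimensional k A]
    (u : (Fin p → DualReg k A) →ₗ[A] (Fin q → DualReg k A)) :
    ∃ F : Matrix (Fin p) (Fin q) A, u = dualAct k F := by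
  choose F hF using fun (i : Fin p) (j : Fin q) => DualReg.exists_eq_rmul
    (LinearMap.proj j ∘ₗ u ∘ₗ LinearMap.single A (fun _ => DualReg k A) i)
  refine ⟨Matrix.of F, LinearMap.pi_ext' fun i => LinearMap.ext fun φ => funext fun j => ?_⟩
  have := LinearMap.congr_fun (hF i j) φ
  simp only [LinearMap.comp_apply, LinearMap.proj_apply] at this ⊢
  rw [this]
  ext a
  rw [dualAct_apply, Finset.sum_eq_single i]
  · simp
  · intro i' _ hi'; simp [hi']
  · simp

/-- Exactness of `X^r → X^q → X^p` in the middle. -/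
def ActExact (F : Matrix (Fin p) (Fin q) A) (E : Matrix (Fin q) (Fin r) A) (X : Type)
    [AddCommGroup X] [Module A X] : Prop :=
  ∀ x : Fin q → X, act F x = 0 → ∃ y, act E y = x

/-- Exactness of `A^p → A^q → A^r` in the middle. -/
def FreeExact (F : Matrix (Fin p) (Fin q) A) (E : Matrix (Fin q) (Fin r) A) : Prop :=
  ∀ a : Fin q → A, Matrix.vecMul a E = 0 → ∃ b, Matrix.vecMul b F = a

/-- Exactness of `Hom_k(A, k)^p → Hom_k(A, k)^q → Hom_k(A, k)^r` in the middle. -/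
def DualExact (k : Type) [Field k] [Algebra k A] (F : Matrix (Fin p) (Fin q) A)
    (E : Matrix (Fin q) (Fin r) A) : Prop :=
  ∀ g : Fin q → DualReg k A, dualAct k E g = 0 → ∃ g', dualAct k F g' = g

/-- The pairing between `Hom_A(X, Hom_k(A, k)^q)` and `X^q`. -/
noncomputable def pairing (h : X →ₗ[A] (Fin q → DualReg k A)) (x : Fin q → X) : k :=
  ∑ i, h (x i) i 1

theorem pairing_act (F : Matrix (Fin p) (Fin q) A) (h : X →ₗ[A] (Fin p → DualReg k A))
    (x : Fin q → X) : pairing h (act F x) = pairing (dualAct k F ∘ₗ h) x := by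
  simp only [pairing, act, map_sum, map_smul, Finset.sum_apply, Pi.smul_apply, DualReg.sum_apply,
    DualReg.smul_apply, LinearMap.comp_apply, dualAct_apply, one_mul, mul_one]
  exact Finset.sum_comm

theorem eq_of_pairing {h h' : X →ₗ[A] (Fin q → DualReg k A)}
    (H : ∀ x, pairing h x = pairing h' x) : h = h' := by
  classical
  ext x i a
  have := H (Pi.single i (a • x))
  have key : ∀ g : X →ₗ[A] (Fin q → DualReg k A),
      pairing g (Pi.single i (a • x)) = g x i a := fun g => by
    rw [pairing, Finset.sum_eq_single i]
    · simp
    · intro j _ hj; simp [hj]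
    · simp
  rwa [key, key] at this

theorem exists_pairing_eq [Module k X] [IsScalarTower k A X] (f : (Fin q → X) →ₗ[k] k) :
    ∃ h : X →ₗ[A] (Fin q → DualReg k A), ∀ x, pairing h x = f x := by
  classical
  refine ⟨LinearMap.pi fun i => DualReg.lift (f ∘ₗ LinearMap.single k (fun _ => X) i),
    fun x => ?_⟩
  conv_rhs => rw [← Finset.univ_sum_single x]
  simp [pairing]

theorem isScalarTower_compHom (k A X : Type) [Field k] [Ring A] [Algebra k A] [AddCommGroup X]
    [Module A X] : letI := Module.compHom X (algebraMap k A); IsScalarTower k A X :=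
  let := Module.compHom X (algebraMap k A)
  ⟨fun c a x => by rw [Algebra.smul_def, mul_smul]; rfl⟩

/-- The duality between cycles modulo boundaries in `X^r → X^q → X^p` and lifting problems for
maps from `X` into `Hom_k(A, k)^p → Hom_k(A, k)^q → Hom_k(A, k)^r`, relative to a map `π`. -/
theorem act_mem_iff_dual_lift (F : Matrix (Fin p) (Fin q) A) (E : Matrix (Fin q) (Fin r) A)
    (π : X' →ₗ[A] X) :
    (∀ x : Fin q → X', act F x = 0 → ∃ y : Fin r → X, act E y = fun j => π (x j)) ↔
    ∀ h : X →ₗ[A] (Fin q → DualReg k A), (∀ x, dualAct k E (h x) = 0) →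
      ∃ h' : X' →ₗ[A] (Fin p → DualReg k A), ∀ x, dualAct k F (h' x) = h (π x) := by
  let := Module.compHom X (algebraMap k A)
  let := Module.compHom X' (algebraMap k A)
  have := isScalarTower_compHom k A X
  have := isScalarTower_compHom k A X'
  have hπ : ∀ (h : X →ₗ[A] (Fin q → DualReg k A)) x,
      pairing (h ∘ₗ π) x = pairing h (fun j => π (x j)) := fun h x => rfl
  constructor
  · intro H h hE
    let Fk : (Fin q → X') →ₗ[k] (Fin p → X') :=
      { toFun := act F
        map_add' := act_add F
        map_smul' := fun c x => by ext i; simp [act, Finset.smul_sum, smul_comm c] }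
    let f : (Fin q → X') →ₗ[k] k :=
      ∑ i : Fin q, DualReg.functional (LinearMap.proj i ∘ₗ h ∘ₗ π) ∘ₗ
        (LinearMap.proj i : (Fin q → X') →ₗ[k] X')
    have hf : ∀ x, f x = pairing (h ∘ₗ π) x := fun x => by simp [f, pairing, LinearMap.sum_apply]
    obtain ⟨μ₀, hμ₀⟩ := exists_comp_eq_of_ker_le Fk.rangeRestrict
      Fk.surjective_rangeRestrict f (fun x hx => by
        obtain ⟨y, hy⟩ := H x (congrArg Subtype.val hx)
        rw [hf, hπ, ← hy, pairing_act]
        simp [pairing, hE])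
    obtain ⟨μ, hμ⟩ := μ₀.exists_extend
    obtain ⟨h', hh'⟩ := exists_pairing_eq (A := A) μ
    refine ⟨h', fun x => ?_⟩
    refine LinearMap.congr_fun (f := dualAct k F ∘ₗ h') (g := h ∘ₗ π) (eq_of_pairing fun x => ?_) x
    rw [← pairing_act, hh', ← hf, ← hμ₀, ← hμ]
    rfl
  · intro H x hx
    let Ek : (Fin r → X) →ₗ[k] (Fin q → X) :=
      { toFun := act E
        map_add' := act_add E
        map_smul' := fun c x => by ext i; simp [act, Finset.smul_sum, smul_comm c] }
    by_contra hne
    obtain ⟨f, hfx, hf⟩ := Submodule.exists_le_ker_of_notMem (p := LinearMap.range Ek)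
      (v := fun j => π (x j)) (fun ⟨y, hy⟩ => hne ⟨y, hy⟩)
    obtain ⟨h, hh⟩ := exists_pairing_eq (A := A) f
    have h0 : dualAct k E ∘ₗ h = 0 := eq_of_pairing fun y => by
      rw [← pairing_act, hh]
      have : act E y ∈ LinearMap.ker f := hf ⟨y, rfl⟩
      rw [LinearMap.mem_ker.1 this]
      simp [pairing]
    obtain ⟨h', hh'⟩ := H h fun x => LinearMap.congr_fun h0 x
    apply hfx
    rw [← hh, ← hπ, ← (LinearMap.ext hh' : dualAct k F ∘ₗ h' = h ∘ₗ π), ← pairing_act, hx]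
    simp [pairing]

theorem actExact_iff_dual_lift (F : Matrix (Fin p) (Fin q) A) (E : Matrix (Fin q) (Fin r) A) :
    ActExact F E X ↔
    ∀ h : X →ₗ[A] (Fin q → DualReg k A), (∀ x, dualAct k E (h x) = 0) →
      ∃ h' : X →ₗ[A] (Fin p → DualReg k A), ∀ x, dualAct k F (h' x) = h x :=
  act_mem_iff_dual_lift F E LinearMap.id

end Matrices
end SelfOrth

namespace SelfOrth

section Simple
variable {A : Type} [Ring A]

theorem nonempty_linearEquiv_of_iInf_ker_le {T T' : Type} [AddCommGroup T] [Module A T]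
    [AddCommGroup T'] [Module A T'] [IsSimpleModule A T] [IsSimpleModule A T'] {t' : T'}
    (ht' : t' ≠ 0) (s : Finset T)
    (h : ∀ a : A, (∀ t ∈ s, a • t = 0) → a • t' = 0) : Nonempty (T ≃ₗ[A] T') := by
  classical
  induction s using Finset.induction_on with
  | empty => exact absurd (by simpa using h 1) ht'
  | insert t s _ ih =>
    by_cases hs : ∀ a : A, (∀ t ∈ s, a • t = 0) → a • t' = 0
    · exact ih hs
    push Not at hs
    obtain ⟨b, hb, hb'⟩ := hs
    let B : Submodule A A :=
      { carrier := {a | ∀ t ∈ s, a • t = 0}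
        add_mem' := fun {x y} hx hy t ht => by rw [add_smul, hx t ht, hy t ht, add_zero]
        zero_mem' := fun t _ => zero_smul A t
        smul_mem' := fun c x hx t ht => by rw [smul_eq_mul, mul_smul, hx t ht, smul_zero] }
    let u : B →ₗ[A] T := LinearMap.toSpanSingleton A T t ∘ₗ B.subtype
    let v : B →ₗ[A] T' := LinearMap.toSpanSingleton A T' t' ∘ₗ B.subtype
    have huv : ∀ x, u x = 0 → v x = 0 := fun x hx => h x.1 fun r hr => by
      rcases Finset.mem_insert.1 hr with rfl | hr
      · exact hx
      · exact x.2 r hr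
    have hu : Function.Surjective u := LinearMap.surjective_of_ne_zero fun h0 =>
      hb' (huv ⟨b, hb⟩ (by rw [h0]; rfl))
    obtain ⟨e, he⟩ := exists_comp_eq_of_ker_le u hu v huv
    exact ⟨LinearEquiv.ofBijective e (LinearMap.bijective_of_ne_zero fun h0 =>
      hb' (by have := he ⟨b, hb⟩; rw [h0] at this; exact this.symm))⟩

theorem nonempty_linearEquiv_of_annihilator_le [IsArtinianRing A] {T T' : Type} [AddCommGroup T]
    [Module A T] [AddCommGroup T'] [Module A T'] [IsSimpleModule A T] [IsSimpleModule A T']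
    (h : Module.annihilator A T ≤ Module.annihilator A T') : Nonempty (T ≃ₗ[A] T') := by
  have := IsSimpleModule.nontrivial A T'
  obtain ⟨t', ht'⟩ := exists_ne (0 : T')
  obtain ⟨s, hs⟩ := Finset.exists_inf_le
    (fun t : T => LinearMap.ker (LinearMap.toSpanSingleton A T t))
  refine nonempty_linearEquiv_of_iInf_ker_le ht' s fun a ha => ?_
  refine Module.mem_annihilator.1 (h (Module.mem_annihilator.2 fun t => ?_)) t'
  have h1 : a ∈ s.inf fun t : T => LinearMap.ker (LinearMap.toSpanSingleton A T t) := by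
    rw [Submodule.mem_finsetInf]
    exact fun t ht => ha t ht
  exact hs t h1

theorem annihilator_sup_eq_top [IsArtinianRing A] {T T' : Type} [AddCommGroup T] [Module A T]
    [AddCommGroup T'] [Module A T'] [IsSimpleModule A T] [IsSimpleModule A T']
    (h : IsEmpty (T ≃ₗ[A] T')) : Module.annihilator A T ⊔ Module.annihilator A T' = ⊤ := by
  by_contra hne
  obtain ⟨m, hm, hle⟩ := Ideal.exists_le_maximal _ hne
  have hS : IsSimpleModule A (A ⧸ m) := isSimpleModule_iff_isCoatom.2 hm.1
  have key : ∀ I : Ideal A, I.IsTwoSided → I ≤ m → I ≤ Module.annihilator A (A ⧸ m) := by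
    intro I hI hIm a ha
    refine Module.mem_annihilator.2 fun x => ?_
    obtain ⟨b, rfl⟩ := Submodule.mkQ_surjective m x
    rw [← map_smul]
    exact (Submodule.Quotient.mk_eq_zero m).2 (hIm (I.mul_mem_right b ha))
  obtain ⟨e⟩ := nonempty_linearEquiv_of_annihilator_le
    (key _ inferInstance (le_sup_left.trans hle))
  obtain ⟨e'⟩ := nonempty_linearEquiv_of_annihilator_le
    (key _ inferInstance (le_sup_right.trans hle))
  exact h.false (e.trans e'.symm)

end Simple

section QuasiFrobenius
variable (k : Type) {A : Type} [Field k] [Ring A] [Algebra k A] [FiniteDimensional k A]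
  [Module.Injective A A]
include k

theorem exists_mul_eq_zero_of_isTwoSided (I : Ideal A) [I.IsTwoSided] (hI : I ≠ ⊤) :
    ∃ x : A, x ≠ 0 ∧ ∀ a ∈ I, x * a = 0 := by
  by_contra! H
  obtain ⟨s, hs⟩ : (I.restrictScalars k).FG := IsNoetherian.noetherian _
  let f : A →ₗ[A] (s → A) := LinearMap.pi fun a => LinearMap.toSpanSingleton A A a.1
  have hf : Function.Injective f := (injective_iff_map_eq_zero f).2 fun x hx => by
    by_contra hx0
    obtain ⟨a, ha, hxa⟩ := H x hx0
    have hle : I.restrictScalars k ≤ LinearMap.ker (LinearMap.mulLeft k x) := by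
      rw [← hs, Submodule.span_le]
      exact fun b hb => congrFun hx ⟨b, hb⟩
    exact hxa (hle ha)
  obtain ⟨ρ, hρ⟩ := Module.Injective.out f hf LinearMap.id
  classical
  have h1 : f 1 = ∑ a : s, a.1 • (Pi.single a 1 : s → A) := by
    ext b
    simp [f, Finset.sum_apply, Pi.single_apply]
  apply hI
  rw [Ideal.eq_top_iff_one, ← LinearMap.id_apply (R := A) (1 : A), ← hρ, h1, map_sum]
  refine I.sum_mem fun a _ => ?_
  rw [map_smul, smul_eq_mul]
  refine I.mul_mem_right _ ?_
  have : a.1 ∈ I.restrictScalars k := hs ▸ Submodule.subset_span a.2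
  exact this

theorem exists_simple_annihilated (T : Type) [AddCommGroup T] [Module A T] [IsSimpleModule A T] :
    ∃ S : Submodule A A, IsSimpleModule A S ∧
      ∀ x ∈ S, ∀ a ∈ Module.annihilator A T, x * a = 0 := by
  have : IsArtinianRing A := IsArtinianRing.of_finite k A
  have := IsSimpleModule.nontrivial A T
  obtain ⟨x, hx, hxI⟩ := exists_mul_eq_zero_of_isTwoSided k (Module.annihilator A T) (by
    rw [Ne, Module.annihilator_eq_top_iff]
    exact not_subsingleton T)
  obtain hbot | ⟨S, hS, hle⟩ := eq_bot_or_exists_atom_le (A ∙ x)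
  · exact absurd (Submodule.span_singleton_eq_bot.1 hbot) hx
  refine ⟨S, isSimpleModule_iff_isAtom.2 hS, fun y hy a ha => ?_⟩
  obtain ⟨c, rfl⟩ := Submodule.mem_span_singleton.1 (hle hy)
  rw [smul_eq_mul, mul_assoc, hxI a ha, mul_zero]

theorem nonempty_linearEquiv_of_annihilated {T T' : Type} [AddCommGroup T] [Module A T]
    [AddCommGroup T'] [Module A T'] [IsSimpleModule A T] [IsSimpleModule A T']
    {S S' : Submodule A A} [IsSimpleModule A S']
    (hS : ∀ x ∈ S, ∀ a ∈ Module.annihilator A T, x * a = 0)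
    (hS' : ∀ x ∈ S', ∀ a ∈ Module.annihilator A T', x * a = 0) (e : S ≃ₗ[A] S') :
    Nonempty (T ≃ₗ[A] T') := by
  have : IsArtinianRing A := IsArtinianRing.of_finite k A
  by_contra hne
  rw [not_nonempty_iff] at hne
  have htop := annihilator_sup_eq_top hne
  have := IsSimpleModule.nontrivial A S'
  obtain ⟨y, hy⟩ := exists_ne (0 : S')
  obtain ⟨u, hu⟩ := Module.Injective.out S.subtype S.subtype_injective (S'.subtype ∘ₗ e.toLinearMap)
  have hyu : y.1 = (e.symm y).1 * u 1 := by
    have h1 := hu (e.symm y)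
    simp only [Submodule.subtype_apply, LinearMap.comp_apply, LinearEquiv.coe_coe,
      LinearEquiv.apply_symm_apply] at h1
    rw [← h1, ← smul_eq_mul, ← map_smul, smul_eq_mul, mul_one]
  apply hy
  apply Subtype.ext
  obtain ⟨a, ha, b, hb, hab⟩ := Submodule.mem_sup.1 (htop.symm ▸ Submodule.mem_top : (1 : A) ∈ _)
  rw [← mul_one y.1, ← hab, mul_add, hS' y.1 y.2 b hb, hyu, mul_assoc,
    hS _ (e.symm y).2 _ (Ideal.mul_mem_left _ _ ha), add_zero]
  rfl

theorem exists_injective_of_isSimpleModule (T : Type) [AddCommGroup T] [Module A T]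
    [IsSimpleModule A T] : ∃ f : T →ₗ[A] A, Function.Injective f := by
  have : IsNoetherianRing A := IsNoetherianRing.of_finite k A
  by_contra! H
  have hc : ∀ c : isotypicComponents A A, ∃ S : Submodule A A, IsSimpleModule A S ∧
      c.1 = isotypicComponent A A S := fun c => c.2
  choose U hU hUc using hc
  choose S hS hSann using fun c => exists_simple_annihilated k (A := A) (U c)
  obtain ⟨S₀, hS₀, hS₀ann⟩ := exists_simple_annihilated k (A := A) T
  have key : ∀ S S' : Submodule A A, IsSimpleModule A S → IsSimpleModule A S' →
      isotypicComponent A A S = isotypicComponent A A S' → Nonempty (S ≃ₗ[A] S') := by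
    intro S S' _ _ h
    exact isIsotypicOfType_submodule_iff.1 (IsIsotypicOfType.isotypicComponent A A S') S
      (h ▸ S.le_isotypicComponent)
  let f : Option (isotypicComponents A A) → isotypicComponents A A := fun o => match o with
    | none => ⟨isotypicComponent A A S₀, S₀, hS₀, rfl⟩
    | some c => ⟨isotypicComponent A A (S c), S c, hS c, rfl⟩
  have hTU : ∀ c, IsEmpty (T ≃ₗ[A] U c) := fun c =>
    ⟨fun e => H ((U c).subtype ∘ₗ e.toLinearMap) ((U c).subtype_injective.comp e.injective)⟩
  have hf : Function.Injective f := by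
    rintro (_ | c) (_ | c') h
    · rfl
    · obtain ⟨e⟩ := key S₀ (S c') hS₀ (hS c') (congrArg Subtype.val h)
      obtain ⟨e'⟩ := nonempty_linearEquiv_of_annihilated k hS₀ann (hSann c') e
      exact ((hTU c').false e').elim
    · obtain ⟨e⟩ := key S₀ (S c) hS₀ (hS c) (congrArg Subtype.val h.symm)
      obtain ⟨e'⟩ := nonempty_linearEquiv_of_annihilated k hS₀ann (hSann c) e
      exact ((hTU c).false e').elim
    · obtain ⟨e⟩ := key (S c) (S c') (hS c) (hS c') (congrArg Subtype.val h)
      obtain ⟨e'⟩ := nonempty_linearEquiv_of_annihilated k (hSann c) (hSann c') e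
      exact congrArg some (Subtype.ext ((hUc c).trans (e'.isotypicComponent_eq.trans
        (hUc c').symm)))
  have := Nat.card_le_card_of_injective f hf
  rw [Finite.card_option] at this
  omega

theorem exists_map_ne_zero {X : Type} [AddCommGroup X] [Module A X] {x : X} (hx : x ≠ 0) :
    ∃ f : X →ₗ[A] A, f x ≠ 0 := by
  have hne : LinearMap.ker (LinearMap.toSpanSingleton A X x) ≠ ⊤ := fun h => hx (by
    have h1 : (1 : A) ∈ LinearMap.ker (LinearMap.toSpanSingleton A X x) := h ▸ Submodule.mem_top
    simpa using h1)
  obtain ⟨m, hm, hle⟩ := Ideal.exists_le_maximal _ hne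
  have hS : IsSimpleModule A (A ⧸ m) := isSimpleModule_iff_isCoatom.2 hm.1
  obtain ⟨g, hg⟩ := exists_injective_of_isSimpleModule k (A := A) (A ⧸ m)
  obtain ⟨e, he⟩ := exists_comp_eq_of_ker_le (LinearMap.toSpanSingleton A X x).rangeRestrict
    (LinearMap.surjective_rangeRestrict _) (g ∘ₗ m.mkQ) (fun a ha => by
      have : a ∈ m := hle (congrArg Subtype.val ha)
      simp [(Submodule.Quotient.mk_eq_zero m).2 this])
  obtain ⟨f, hf⟩ := Module.Injective.out (LinearMap.range
    (LinearMap.toSpanSingleton A X x)).subtype (Submodule.subtype_injective _) e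
  refine ⟨f, fun h0 => ?_⟩
  have h1 := hf ((LinearMap.toSpanSingleton A X x).rangeRestrict 1)
  rw [he] at h1
  have h2 : f x = g (m.mkQ 1) := by simpa using h1
  rw [h0] at h2
  have h3 : m.mkQ 1 = 0 := hg (by rw [← h2, map_zero])
  exact hm.ne_top ((Ideal.eq_top_iff_one m).2 ((Submodule.Quotient.mk_eq_zero m).1 h3))

theorem exists_injective_pi (X : Type) [AddCommGroup X] [Module A X] [Module.Finite A X] :
    ∃ (n : ℕ) (f : X →ₗ[A] (Fin n → A)), Function.Injective f := by
  have : IsArtinianRing A := IsArtinianRing.of_finite k A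
  obtain ⟨s, hs⟩ := Finset.exists_inf_le (fun f : X →ₗ[A] A => LinearMap.ker f)
  refine ⟨s.card, LinearMap.pi fun i => (s.equivFin.symm i).1,
    (injective_iff_map_eq_zero _).2 fun x hx => ?_⟩
  by_contra hx0
  obtain ⟨f, hf⟩ := exists_map_ne_zero k (A := A) hx0
  refine hf (hs f ((Submodule.mem_finsetInf).2 fun g hg => ?_))
  have := congrFun hx (s.equivFin ⟨g, hg⟩)
  simpa using this

omit [Module.Injective A A] in
instance DualReg.finite : Module.Finite A (DualReg k A) := by
  let : Module k (DualReg k A) := inferInstanceAs (Module k (A →ₗ[k] k))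
  have : Module.Finite k (DualReg k A) := inferInstanceAs (Module.Finite k (A →ₗ[k] k))
  have : IsScalarTower k A (DualReg k A) := ⟨fun c a φ => DualReg.ext fun b => by
    rw [DualReg.smul_apply, mul_smul_comm, map_smul]
    rfl⟩
  exact Module.Finite.of_restrictScalars_finite k A _

instance DualReg.projective : Module.Projective A (DualReg k A) := by
  obtain ⟨n, f, hf⟩ := exists_injective_pi k (A := A) (DualReg k A)
  obtain ⟨g, hg⟩ := Module.Injective.out f hf LinearMap.id
  exact Module.Projective.of_split f g (LinearMap.ext hg)

end QuasiFrobenius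
end SelfOrth

namespace SelfOrth

section FreeSide
variable {A : Type} [Ring A] {p q r : ℕ} {F : Matrix (Fin p) (Fin q) A}
  {E : Matrix (Fin q) (Fin r) A} {X N : Type} [AddCommGroup X] [Module A X] [AddCommGroup N]
  [Module A N]

theorem linearCombination_vecMul (F : Matrix (Fin p) (Fin q) A) (x : Fin q → X) (b : Fin p → A) :
    Fintype.linearCombination A x (Matrix.vecMul b F) =
      Fintype.linearCombination A (act F x) b := by
  simp only [Fintype.linearCombination_apply, act, Matrix.vecMul, dotProduct, Finset.smul_sum,
    Finset.sum_smul, mul_smul]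
  exact Finset.sum_comm

theorem act_map_single (F : Matrix (Fin p) (Fin q) A) (t : (Fin q → A) →ₗ[A] X) (i : Fin p) :
    act F (fun j => t (Pi.single j 1)) i = t (Matrix.vecMul (Pi.single i 1) F) := by
  rw [Matrix.single_one_vecMul, pi_eq_sum_univ (F.row i), map_sum, act]
  refine Finset.sum_congr rfl fun j _ => ?_
  rw [map_smul]
  congr 2
  ext l
  simp [Pi.single_apply, eq_comm]

theorem linearCombination_map_single (t : (Fin q → A) →ₗ[A] X) :
    Fintype.linearCombination A (fun j => t (Pi.single j 1)) = t := by
  refine LinearMap.pi_ext' fun i => LinearMap.ext_ring ?_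
  simp [Fintype.linearCombination_apply_single]

theorem actExact_iff_extend (hFE : F * E = 0) (hex : FreeExact F E) :
    ActExact F E X ↔ ∀ t : (Fin q → A) →ₗ[A] X, (∀ a, Matrix.vecMul a E = 0 → t a = 0) →
      ∃ u : (Fin r → A) →ₗ[A] X, ∀ a, u (Matrix.vecMul a E) = t a := by
  constructor
  · intro H t ht
    obtain ⟨y, hy⟩ := H (fun j => t (Pi.single j 1)) (funext fun i => by
      rw [act_map_single]
      exact ht _ (by rw [Matrix.vecMul_vecMul, hFE, Matrix.vecMul_zero]))
    refine ⟨Fintype.linearCombination A y, fun a => ?_⟩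
    rw [linearCombination_vecMul, hy, linearCombination_map_single]
  · intro H x hx
    obtain ⟨u, hu⟩ := H (Fintype.linearCombination A x) (fun a ha => by
      obtain ⟨b, rfl⟩ := hex a ha
      rw [linearCombination_vecMul, hx]
      simp [Fintype.linearCombination_apply])
    refine ⟨fun j => u (Pi.single j 1), funext fun i => ?_⟩
    rw [act_map_single, hu]
    simp [Fintype.linearCombination_apply_single]

theorem actExact_of_injective [Module.Injective A X] (hFE : F * E = 0) (hex : FreeExact F E) :
    ActExact F E X := (actExact_iff_extend hFE hex).2 fun t ht => by
  obtain ⟨e, he⟩ := exists_comp_eq_of_ker_le (Matrix.vecMulLinear E).rangeRestrict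
    (LinearMap.surjective_rangeRestrict _) t (fun a ha => ht a (congrArg Subtype.val ha))
  obtain ⟨u, hu⟩ := Module.Injective.out (LinearMap.range (Matrix.vecMulLinear E)).subtype
    (Submodule.subtype_injective _) e
  exact ⟨u, fun a => (hu _).trans (he a)⟩

theorem extVanish_iff_actExact_of_free (hFE : F * E = 0) (hex : FreeExact F E)
    (π : (Fin r → A) →ₗ[A] N) (hπ : Function.Surjective π)
    (hEπ : Function.Exact (Matrix.vecMulLinear E) π) : ExtVanish A N X ↔ ActExact F E X := by
  have hex' : Function.Exact (LinearMap.range (Matrix.vecMulLinear E)).subtype π := fun x => by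
    rw [hEπ x]
    simp
  rw [actExact_iff_extend hFE hex]
  constructor
  · intro H t ht
    obtain ⟨e, he⟩ := exists_comp_eq_of_ker_le (Matrix.vecMulLinear E).rangeRestrict
      (LinearMap.surjective_rangeRestrict _) t (fun a ha => ht a (congrArg Subtype.val ha))
    obtain ⟨u, hu⟩ := H _ _ _ π (Submodule.subtype_injective _) hπ hex' e
    exact ⟨u, fun a => (hu _).trans (he a)⟩
  · intro H
    refine extVanish_of_projective _ π hπ hex' fun h => ?_
    obtain ⟨u, hu⟩ := H (h ∘ₗ (Matrix.vecMulLinear E).rangeRestrict) (fun a ha => by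
      have : (Matrix.vecMulLinear E).rangeRestrict a = 0 := Subtype.ext ha
      simp [this])
    refine ⟨u, ?_⟩
    rintro ⟨_, a, rfl⟩
    exact hu a

end FreeSide

section DualSide
variable {k A : Type} [Field k] [Ring A] [Algebra k A] {p q r : ℕ} {F : Matrix (Fin p) (Fin q) A}
  {E : Matrix (Fin q) (Fin r) A} {X T : Type} [AddCommGroup X] [Module A X] [AddCommGroup T]
  [Module A T]

theorem dualAct_dualAct (F : Matrix (Fin p) (Fin q) A) (E : Matrix (Fin q) (Fin r) A)
    (g : Fin p → DualReg k A) : dualAct k E (dualAct k F g) = dualAct k (F * E) g := by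
  ext j a
  simp only [dualAct_apply, Matrix.mul_apply, Finset.sum_mul, map_sum, mul_assoc]
  exact Finset.sum_comm

theorem eq_zero_of_dualAct (H : ∀ g, dualAct k F g = 0) : F = 0 := by
  ext i j
  by_contra h
  obtain ⟨f, hf, -⟩ := Submodule.exists_le_ker_of_notMem (p := (⊥ : Submodule k A)) (v := F i j) h
  apply hf
  have := congrArg (fun φ => φ 1) (congrFun (H (Pi.single i (DualReg.ofLinear f))) j)
  simp only [dualAct_apply, mul_one] at this
  rw [Finset.sum_eq_single i (fun l _ hl => by simp [hl]) (by simp)] at this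
  simpa using this

theorem extVanish_iff_actExact_of_dual (hFE : F * E = 0) (hex : DualExact k F E)
    (j : T →ₗ[A] (Fin p → DualReg k A)) (hj : Function.Injective j)
    (hjF : Function.Exact j (dualAct k F)) : ExtVanish A X T ↔ ActExact F E X := by
  rw [actExact_iff_dual_lift (k := k)]
  constructor
  · intro H h hh
    exact H.exists_lift j _ hj hjF h fun x => hex _ (hh x)
  · intro H
    refine extVanish_of_injective j _ hj hjF fun f hf => H f fun x => ?_
    obtain ⟨t, ht⟩ := hf x
    rw [← ht, dualAct_dualAct, hFE]
    ext; simp [dualAct_apply]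

variable (k) in
theorem FreeExact.dualExact [Module.Injective A A] (hFE : F * E = 0) (hex : FreeExact F E) :
    DualExact k F E := fun g hg => by
  obtain ⟨h', hh'⟩ := (actExact_iff_dual_lift (k := k) F E).1
    (actExact_of_injective (X := A) hFE hex) (LinearMap.toSpanSingleton A _ g)
    (fun x => by simp [hg])
  exact ⟨h' 1, by simp [hh']⟩

theorem DualExact.freeExact [Module.Projective A (DualReg k A)] (hex : DualExact k F E) :
    FreeExact F E := fun a ha => by
  have H : ActExact F E (DualReg k A) := (actExact_iff_dual_lift (k := k) F E).2 fun h hh => by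
    obtain ⟨h₀, hh₀⟩ := exists_comp_eq_of_mem_range (LinearMap.range (dualAct k F)).subtype
      (Submodule.subtype_injective _) h (fun x => by
        obtain ⟨g, hg⟩ := hex _ (hh x)
        exact ⟨⟨h x, g, hg⟩, rfl⟩)
    obtain ⟨h', hh'⟩ := Module.projective_lifting_property (dualAct k F).rangeRestrict h₀
      (LinearMap.surjective_rangeRestrict _)
    exact ⟨h', fun x => by
      rw [← hh₀, ← hh']
      rfl⟩
  by_contra hne
  obtain ⟨f, hfa, hf⟩ := Submodule.exists_le_ker_of_notMem
    (p := LinearMap.range ((Matrix.vecMulLinear F).restrictScalars k)) (v := a)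
    (fun ⟨y, hy⟩ => hne ⟨y, hy⟩)
  have hsum : ∀ b : Fin q → A, f b = ∑ i, f (Pi.single i (b i)) := fun b => by
    conv_lhs => rw [← Finset.univ_sum_single b]
    rw [map_sum]
  let g : Fin q → DualReg k A := fun i => DualReg.ofLinear (f ∘ₗ LinearMap.single k (fun _ => A) i)
  have hg : ∀ i b, g i b = f (Pi.single i b) := fun i b => rfl
  obtain ⟨g', hg'⟩ := H g (funext fun i => DualReg.ext fun b => by
    have h1 : f (Matrix.vecMul (Pi.single i b) F) = 0 := hf ⟨Pi.single i b, rfl⟩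
    rw [hsum] at h1
    simpa [act, hg, Matrix.single_vecMul] using h1)
  apply hfa
  rw [hsum]
  simp only [← hg, ← hg', act, DualReg.sum_apply, DualReg.smul_apply]
  rw [Finset.sum_comm]
  refine Finset.sum_eq_zero fun j _ => ?_
  rw [← map_sum]
  have : ∑ i, a i * E i j = 0 := congrFun ha j
  rw [this, map_zero]

end DualSide

/-- Two composable matrices over `A` that give an exact sequence of free modules. -/
structure ExactPair (A : Type) [Ring A] where
  /-- rank of the source -/
  p : ℕ
  /-- rank of the middle term -/
  q : ℕ
  /-- rank of the target -/
  r : ℕ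
  /-- the first matrix -/
  F : Matrix (Fin p) (Fin q) A
  /-- the second matrix -/
  E : Matrix (Fin q) (Fin r) A
  mul_eq_zero : F * E = 0
  freeExact : FreeExact F E

section Resolutions
variable (k : Type) {A : Type} [Field k] [Ring A] [Algebra k A]

theorem exists_free_resolution [IsNoetherianRing A] (M : ModuleCat.{0} A) [Module.Finite A M] :
    ∃ (Z : ℕ → ModuleCat.{0} A) (r : ℕ → ℕ) (E : ∀ n, Matrix (Fin (r (n + 1))) (Fin (r n)) A),
      Z 0 = M ∧ IsSyzygySeq Z ∧ (∀ n, E (n + 1) * E n = 0) ∧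
      (∀ n, FreeExact (E (n + 1)) (E n)) ∧
      ∀ n, ∃ π : (Fin (r n) → A) →ₗ[A] Z n, Function.Surjective π ∧
        Function.Exact (Matrix.vecMulLinear (E n)) π := by
  have step : ∀ N : {N : ModuleCat.{0} A // Module.Finite A N}, ∃ (r : ℕ)
      (π : (Fin r → A) →ₗ[A] N.1), Function.Surjective π := fun N =>
    have := N.2
    Module.Finite.exists_fin' A N.1
  choose r π hπ using step
  let Z : ℕ → {N : ModuleCat.{0} A // Module.Finite A N} := fun n => Nat.rec ⟨M, inferInstance⟩
    (fun _ N => ⟨ModuleCat.of A (LinearMap.ker (π N)),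
      inferInstanceAs (Module.Finite A (LinearMap.ker (π N)))⟩) n
  have hι : ∀ n, ∃ ι : (Z (n + 1)).1 →ₗ[A] (Fin (r (Z n)) → A), Function.Injective ι ∧
      Function.Exact ι (π (Z n)) := fun n =>
    ⟨(LinearMap.ker (π (Z n))).subtype, Submodule.subtype_injective _,
      fun x => ⟨fun h => ⟨⟨x, h⟩, rfl⟩, fun ⟨y, hy⟩ => hy ▸ y.2⟩⟩
  choose ι hι hιex using hι
  have hE : ∀ n, ∃ E : Matrix (Fin (r (Z (n + 1)))) (Fin (r (Z n))) A,
      ∀ a, Matrix.vecMul a E = ι n (π (Z (n + 1)) a) := fun n => by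
    obtain ⟨E, hE⟩ := (Matrix.toLinearMapRight' (R := A)).surjective (ι n ∘ₗ π (Z (n + 1)))
    exact ⟨E, fun a => LinearMap.congr_fun hE a⟩
  choose E hE using hE
  have hEπ : ∀ n, Function.Exact (Matrix.vecMulLinear (E n)) (π (Z n)) := fun n x => by
    rw [hιex n x]
    constructor
    · rintro ⟨y, rfl⟩
      obtain ⟨a, rfl⟩ := hπ _ y
      exact ⟨a, hE n a⟩
    · rintro ⟨a, rfl⟩
      exact ⟨_, (hE n a).symm⟩
  refine ⟨fun n => (Z n).1, fun n => r (Z n), E, rfl, fun n => ?_, fun n => ?_, fun n a ha => ?_,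
    fun n => ⟨π (Z n), hπ _, hEπ n⟩⟩
  · exact ⟨ModuleCat.of A (Fin (r (Z n)) → A), ι n, π (Z n),
      inferInstanceAs (Module.Projective A (Fin (r (Z n)) → A)), hι n, hπ _, hιex n⟩
  · refine Matrix.ext_of_single_vecMul fun i => ?_
    rw [← Matrix.vecMul_vecMul, hE n, Matrix.vecMul_zero]
    have := (hEπ (n + 1)).apply_apply_eq_zero (Pi.single i 1)
    rw [Matrix.vecMulLinear_apply] at this
    rw [this, map_zero]
  · rw [hE n] at ha
    have h0 : π (Z (n + 1)) a = 0 := hι n (by rw [ha, map_zero])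
    exact (hEπ (n + 1) a).1 h0

theorem exists_injective_dualReg [IsArtinianRing A] (W : Type) [AddCommGroup W] [Module A W]
    [Module.Finite A W] :
    ∃ (n : ℕ) (f : W →ₗ[A] (Fin n → DualReg k A)), Function.Injective f := by
  obtain ⟨s, hs⟩ := Finset.exists_inf_le (fun f : W →ₗ[A] DualReg k A => LinearMap.ker f)
  refine ⟨s.card, LinearMap.pi fun i => (s.equivFin.symm i).1,
    (injective_iff_map_eq_zero _).2 fun x hx => ?_⟩
  by_contra hx0
  let := Module.compHom W (algebraMap k A)
  have := isScalarTower_compHom k A W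
  obtain ⟨f, hf, -⟩ := Submodule.exists_le_ker_of_notMem (p := (⊥ : Submodule k W)) (v := x) hx0
  apply hf
  have := hs (DualReg.lift f) ((Submodule.mem_finsetInf).2 fun g hg => (by
    have := congrFun hx (s.equivFin ⟨g, hg⟩)
    simpa using this))
  have := congrArg (fun φ => φ 1) (LinearMap.mem_ker.1 this)
  simpa using this

theorem exists_dual_resolution [FiniteDimensional k A] [IsArtinianRing A] (M : ModuleCat.{0} A)
    [Module.Finite A M] :
    ∃ (W : ℕ → ModuleCat.{0} A) (s : ℕ → ℕ) (F : ∀ n, Matrix (Fin (s n)) (Fin (s (n + 1))) A),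
      W 0 = M ∧ IsCosyzygySeq W ∧ (∀ n, F n * F (n + 1) = 0) ∧
      (∀ n, DualExact k (F n) (F (n + 1))) ∧
      ∀ n, ∃ j : W n →ₗ[A] (Fin (s n) → DualReg k A), Function.Injective j ∧
        Function.Exact j (dualAct k (F n)) := by
  have step : ∀ N : {N : ModuleCat.{0} A // Module.Finite A N}, ∃ (s : ℕ)
      (j : N.1 →ₗ[A] (Fin s → DualReg k A)), Function.Injective j := fun N =>
    have := N.2
    exists_injective_dualReg k N.1
  choose s j hj using step
  let W : ℕ → {N : ModuleCat.{0} A // Module.Finite A N} := fun n => Nat.rec ⟨M, inferInstance⟩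
    (fun _ N => ⟨ModuleCat.of A ((Fin (s N) → DualReg k A) ⧸ LinearMap.range (j N)),
      inferInstanceAs (Module.Finite A ((Fin (s N) → DualReg k A) ⧸ LinearMap.range (j N)))⟩) n
  have hπ : ∀ n, ∃ π : (Fin (s (W n)) → DualReg k A) →ₗ[A] (W (n + 1)).1,
      Function.Surjective π ∧ Function.Exact (j (W n)) π := fun n =>
    ⟨(LinearMap.range (j (W n))).mkQ, Submodule.mkQ_surjective _, by
      rw [LinearMap.exact_iff]; exact Submodule.ker_mkQ _⟩
  choose π hπ hπex using hπ
  choose F hF using fun n => exists_eq_dualAct (j (W (n + 1)) ∘ₗ π n)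
  have hF' : ∀ n g, dualAct k (F n) g = j (W (n + 1)) (π n g) := fun n g => by rw [← hF]; rfl
  have hjF : ∀ n, Function.Exact (j (W n)) (dualAct k (F n)) := fun n g => by
    rw [hF', ← hπex n g, ← map_zero (j (W (n + 1))), (hj _).eq_iff]
  refine ⟨fun n => (W n).1, fun n => s (W n), F, rfl, fun n => ?_, fun n => ?_, fun n g hg => ?_,
    fun n => ⟨j (W n), hj _, hjF n⟩⟩
  · exact ⟨ModuleCat.of A (Fin (s (W n)) → DualReg k A), j (W n), π n,
      inferInstanceAs (Module.Injective A (Fin (s (W n)) → DualReg k A)), hj _, hπ n, hπex n⟩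
  · refine eq_zero_of_dualAct (k := k) fun g => ?_
    rw [← dualAct_dualAct, hF' n]
    exact (hjF (n + 1)).apply_apply_eq_zero _
  · obtain ⟨w, rfl⟩ := (hjF (n + 1) g).1 hg
    obtain ⟨g', rfl⟩ := hπ n w
    exact ⟨g', hF' n g'⟩

include k in
/-- `𝒢` is cut out by a set of exact pairs of matrices. Each pair is continued to the right by
another pair in the set or by a presentation of `M`. -/
theorem exists_exactPairs [FiniteDimensional k A] [Module.Injective A A] (M : ModuleCat.{0} A)
    [Module.Finite A M] :
    ∃ C : Set (ExactPair A),
      (∀ X, MemG A M X ↔ ∀ c ∈ C, ActExact c.F c.E X) ∧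
      ∀ c ∈ C, (∃ d ∈ C, ∃ p F h h', c = ⟨p, d.p, d.q, F, d.F, h, h'⟩) ∨
        ∃ π : (Fin c.r → A) →ₗ[A] M, Function.Surjective π ∧
          Function.Exact (Matrix.vecMulLinear c.E) π := by
  have : IsArtinianRing A := IsArtinianRing.of_finite k A
  have : IsNoetherianRing A := IsNoetherianRing.of_finite k A
  obtain ⟨Z, r, E, hZ0, hZ, hE, hEex, hEπ⟩ := exists_free_resolution M
  obtain ⟨W, s, F, hW0, hW, hF, hFex, hFj⟩ := exists_dual_resolution k M
  have hFex' : ∀ n, FreeExact (F n) (F (n + 1)) := fun n => (hFex n).freeExact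
  let a : ℕ → ExactPair A := fun n => ⟨_, _, _, E (n + 1), E n, hE n, hEex n⟩
  let b : ℕ → ExactPair A := fun n => ⟨_, _, _, F n, F (n + 1), hF n, hFex' n⟩
  refine ⟨Set.range a ∪ Set.range b, fun X => ?_, ?_⟩
  · rw [memG_iff hZ hW hZ0 hW0]
    have ha : ∀ n, ExtVanish A (Z n) X ↔ ActExact (E (n + 1)) (E n) X := fun n => by
      obtain ⟨π, hπ, hex⟩ := hEπ n
      exact extVanish_iff_actExact_of_free (hE n) (hEex n) π hπ hex
    have hb : ∀ n, ExtVanish A X (W n) ↔ ActExact (F n) (F (n + 1)) X := fun n => by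
      obtain ⟨j, hj, hex⟩ := hFj n
      exact extVanish_iff_actExact_of_dual (hF n) (hFex n) j hj hex
    simp only [ha, hb]
    constructor
    · rintro h _ (⟨n, rfl⟩ | ⟨n, rfl⟩)
      · exact (h n).1
      · exact (h n).2
    · exact fun h n => ⟨h (a n) (Or.inl ⟨n, rfl⟩), h (b n) (Or.inr ⟨n, rfl⟩)⟩
  · rintro _ (⟨_ | n, rfl⟩ | ⟨n, rfl⟩)
    · subst hZ0
      exact Or.inr (hEπ 0)
    · exact Or.inl ⟨a n, Or.inl ⟨n, rfl⟩, _, _, hE (n + 1), hEex (n + 1), rfl⟩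
    · exact Or.inl ⟨b (n + 1), Or.inr ⟨n + 1, rfl⟩, _, _, hF n, hFex' n, rfl⟩

end Resolutions
end SelfOrth

namespace SelfOrth

theorem exists_dependent_seq {α : ℕ → Type*} (P : ∀ n, α n → Prop)
    (R : ∀ n, α n → α (n + 1) → Prop) (a : α 0) (ha : P 0 a)
    (hs : ∀ n a, P n a → ∃ b, P (n + 1) b ∧ R n a b) :
    ∃ f : ∀ n, α n, f 0 = a ∧ ∀ n, P n (f n) ∧ R n (f n) (f (n + 1)) := by
  choose s hs using hs
  let f : ∀ n, {a : α n // P n a} := Nat.rec ⟨a, ha⟩ fun n b => ⟨s n b.1 b.2, (hs n b.1 b.2).1⟩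
  exact ⟨fun n => (f n).1, rfl, fun n => ⟨(f n).2, (hs n _ (f n).2).2⟩⟩

section Colimit
variable {A : Type} [Ring A]

theorem exists_sequential_colimit (X : ℕ → ModuleCat.{0} A) (t : ∀ n, X n →ₗ[A] X (n + 1))
    (ht : ∀ n, Function.Injective (t n)) :
    ∃ (G : ModuleCat.{0} A) (ι : ∀ n, X n →ₗ[A] G), (∀ n, Function.Injective (ι n)) ∧
      (∀ n x, ι (n + 1) (t n x) = ι n x) ∧ (∀ g, ∃ n x, ι n x = g) ∧
      ∀ (I : Type) [AddCommGroup I] [Module A I] (e : ∀ n, X n →ₗ[A] I),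
        (∀ n x, e (n + 1) (t n x) = e n x) → ∃ e' : G →ₗ[A] I, ∀ n x, e' (ι n x) = e n x := by
  classical
  let f : ∀ i j, i ≤ j → X i →ₗ[A] X j := fun i j h =>
    Nat.leRec (motive := fun m _ => X i →ₗ[A] X m) LinearMap.id (fun k _ g => t k ∘ₗ g) h
  have f_self : ∀ i, f i i le_rfl = LinearMap.id := fun i => Nat.leRec_self ..
  have f_succ : ∀ i j (h : i ≤ j), f i (j + 1) (h.trans (Nat.le_succ j)) = t j ∘ₗ f i j h :=
    fun i j h => Nat.leRec_succ ..
  have f_inj : ∀ i j h, Function.Injective (f i j h) := fun i j h => by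
    induction j, h using Nat.le_induction with
    | base => rw [f_self]; exact Function.injective_id
    | succ j h ih => rw [f_succ _ _ h]; exact (ht j).comp ih
  have : DirectedSystem (fun n => X n) (fun i j h => f i j h) :=
    { map_self := fun i x => by rw [f_self]; rfl
      map_map := fun k j i hij hjk x => by
        induction k, hjk using Nat.le_induction with
        | base => rw [f_self]; rfl
        | succ k h ih => rw [f_succ j k h, f_succ i k (hij.trans h)]; simp [ih] }
  refine ⟨ModuleCat.of A (Module.DirectLimit (fun n => X n) f),
    fun n => Module.DirectLimit.of A ℕ (fun n => X n) f n, fun n => ?_, fun n x => ?_,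
    fun g => ?_, fun I _ _ e he => ?_⟩
  · refine (injective_iff_map_eq_zero _).2 fun x hx => ?_
    obtain ⟨j, hj, hx⟩ := Module.DirectLimit.of.zero_exact hx
    exact f_inj _ _ hj (hx.trans (map_zero _).symm)
  · have h1 : f n (n + 1) (Nat.le_succ n) x = t n x := by
      rw [f_succ n n le_rfl, f_self]; rfl
    rw [← h1]
    exact Module.DirectLimit.of_f
  · exact Module.DirectLimit.exists_of g
  · refine ⟨Module.DirectLimit.lift A ℕ (fun n => X n) f e fun i j hij x => ?_,
      fun n x => Module.DirectLimit.lift_of ..⟩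
    induction j, hij using Nat.le_induction with
    | base => rw [f_self]; rfl
    | succ j h ih => rw [f_succ _ _ h]; simp [he, ih]

end Colimit

section Preenvelope
variable {A : Type} [Ring A]

theorem exists_injective_embedding (X : ModuleCat.{0} A) :
    ∃ (J : ModuleCat.{0} A) (j : X →ₗ[A] J), Module.Injective A J ∧ Function.Injective j := by
  obtain ⟨W, hW, rfl⟩ := exists_isCosyzygySeq X
  obtain ⟨J, j, _, hJ, hj, _⟩ := hW 0
  exact ⟨J, j, hJ, hj⟩

/-- `t : X → X'` solves all the systems `E y = x` with `F x = 0` for `(F, E)` in `C`, and maps into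
modules for which these systems are solvable extend along `t`. -/
structure IsExtensionStep (C : Set (ExactPair A)) {X X' : ModuleCat.{0} A} (t : X →ₗ[A] X') :
    Prop where
  injective : Function.Injective t
  exists_act_eq : ∀ c ∈ C, ∀ x : Fin c.q → X, act c.F x = 0 →
    ∃ y, act c.E y = fun j => t (x j)
  exists_extend : ∀ (G I Q : Type) [AddCommGroup G] [Module A G] [AddCommGroup I] [Module A I]
    [AddCommGroup Q] [Module A Q] (j : G →ₗ[A] I) (π : I →ₗ[A] Q), Function.Injective j →
    Function.Surjective π → Function.Exact j π → (∀ c ∈ C, ActExact c.F c.E G) →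
    ∀ (e : X →ₗ[A] I) (f : X' →ₗ[A] Q), (∀ x, f (t x) = π (e x)) →
      ∃ e' : X' →ₗ[A] I, (∀ x, e' (t x) = e x) ∧ ∀ x', π (e' x') = f x'

theorem exists_isExtensionStep (C : Set (ExactPair A)) (X : ModuleCat.{0} A) :
    ∃ (X' : ModuleCat.{0} A) (t : X →ₗ[A] X'), IsExtensionStep C t := by
  classical
  let S := Σ c : C, {x : Fin c.1.q → X // act c.1.F x = 0}
  let S' := Σ s : S, Fin s.1.1.r
  let rel : (Σ s : S, Fin s.1.1.q) → X × (S' →₀ A) := fun ρ =>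
    LinearMap.inl A X (S' →₀ A) (ρ.1.2.1 ρ.2) - ∑ j, ρ.1.1.1.E ρ.2 j •
      LinearMap.inr A X (S' →₀ A) (Finsupp.single (⟨ρ.1, j⟩ : S') 1)
  let N : Submodule A (X × (S' →₀ A)) := Submodule.span A (Set.range rel)
  let X' := ModuleCat.of A ((X × (S' →₀ A)) ⧸ N)
  let t : X →ₗ[A] X' := N.mkQ ∘ₗ LinearMap.inl A X (S' →₀ A)
  let y : ∀ s : S, Fin s.1.1.r → X' := fun s j =>
    N.mkQ (LinearMap.inr A X (S' →₀ A) (Finsupp.single (⟨s, j⟩ : S') 1))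
  have hy : ∀ s : S, act s.1.1.E (y s) = fun j => t (s.2.1 j) := fun s => funext fun i => by
    have h1 : N.mkQ (rel ⟨s, i⟩) = 0 :=
      (Submodule.Quotient.mk_eq_zero N).2 (Submodule.subset_span ⟨_, rfl⟩)
    simp only [rel] at h1
    rw [map_sub, sub_eq_zero, map_sum] at h1
    simp only [map_smul] at h1
    exact h1.symm
  have ext : ∀ (I : Type) [AddCommGroup I] [Module A I] (e : X →ₗ[A] I)
      (v : ∀ s : S, Fin s.1.1.r → I), (∀ s, act s.1.1.E (v s) = fun j => e (s.2.1 j)) →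
      ∃ e' : X' →ₗ[A] I, (∀ x, e' (t x) = e x) ∧ ∀ s j, e' (y s j) = v s j := by
    intro I _ _ e v hv
    let u : X × (S' →₀ A) →ₗ[A] I :=
      e.coprod (Finsupp.linearCombination A fun σ : S' => v σ.1 σ.2)
    have hu : N ≤ LinearMap.ker u := Submodule.span_le.2 (by
      rintro _ ⟨ρ, rfl⟩
      have := congrFun (hv ρ.1) ρ.2
      simp only [act] at this
      have h1 : ∀ x, u (LinearMap.inl A X (S' →₀ A) x) = e x := fun x => by simp [u]
      have h2 : ∀ σ : S', u (LinearMap.inr A X (S' →₀ A) (Finsupp.single σ 1)) = v σ.1 σ.2 :=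
        fun σ => by simp [u]
      change u (rel ρ) = 0
      simp only [rel, map_sub, map_sum, map_smul, h1, h2, ← this, sub_self])
    refine ⟨N.liftQ u hu, fun x => ?_, fun s j => ?_⟩
    · exact (Submodule.liftQ_apply _ _ _).trans (by simp [u])
    · exact (Submodule.liftQ_apply _ _ _).trans (by simp [u])
  have hgen : ∀ (I : Type) [AddCommGroup I] [Module A I] (g g' : X' →ₗ[A] I),
      (∀ x, g (t x) = g' (t x)) → (∀ s j, g (y s j) = g' (y s j)) → g = g' := by
    intro I _ _ g g' h1 h2
    refine Submodule.linearMap_qext _ (LinearMap.prod_ext (LinearMap.ext h1)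
      (Finsupp.lhom_ext' fun σ => LinearMap.ext_ring (h2 σ.1 σ.2)))
  refine ⟨X', t, ?_, fun c hc x hx => ⟨y ⟨⟨c, hc⟩, x, hx⟩, hy ⟨⟨c, hc⟩, x, hx⟩⟩, ?_⟩
  · obtain ⟨J, j, hJ, hj⟩ := exists_injective_embedding X
    choose v hv using fun s : S => actExact_of_injective (X := J) s.1.1.mul_eq_zero
      s.1.1.freeExact (fun i => j (s.2.1 i)) (funext fun i => by
        rw [← map_act, s.2.2]; simp)
    obtain ⟨e', he', -⟩ := ext J j v hv
    exact fun a b hab => hj (by rw [← he', ← he', hab])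
  · intro G I Q _ _ _ _ _ _ j π hj hπ hex hG e f hfe
    have key : ∀ s : S, ∃ v : Fin s.1.1.r → I, act s.1.1.E v = (fun i => e (s.2.1 i)) ∧
        ∀ i, π (v i) = f (y s i) := by
      intro s
      choose v hv using fun i => hπ (f (y s i))
      have hz : ∀ i, ∃ w, j w = e (s.2.1 i) - act s.1.1.E v i := fun i => (hex _).1 (by
        rw [map_sub, map_act, ← hfe, sub_eq_zero]
        simp only [hv]
        rw [← map_act, hy])
      choose w hw using hz
      obtain ⟨u, hu⟩ := hG s.1.1 s.1.2 w (funext fun i => hj (by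
        rw [map_act]
        have : (fun i => j (w i)) = (fun i => e (s.2.1 i)) - act s.1.1.E v := funext hw
        rw [this, act_sub, act_act, s.1.1.mul_eq_zero, Pi.sub_apply, ← map_act, s.2.2]
        simp [act]))
      refine ⟨v + fun i => j (u i), funext fun i => ?_, fun i => ?_⟩
      · rw [act_add, Pi.add_apply, ← map_act, hu, hw]
        abel
      · simp [hv, hex.apply_apply_eq_zero]
    choose v hv hvf using key
    obtain ⟨e', he', hev⟩ := ext I e v hv
    refine ⟨e', he', fun x' => LinearMap.congr_fun (hgen Q (π ∘ₗ e') f (fun x => ?_)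
      (fun s i => ?_)) x'⟩
    · simp [he', hfe]
    · simp [hev, hvf]

theorem exists_special_preenvelope (C : Set (ExactPair A)) (X : ModuleCat.{0} A) :
    ∃ (G : ModuleCat.{0} A) (ι : X →ₗ[A] G), Function.Injective ι ∧
      (∀ c ∈ C, ActExact c.F c.E G) ∧
      ∀ G' : ModuleCat.{0} A, (∀ c ∈ C, ActExact c.F c.E G') →
        ExtVanish A (G ⧸ LinearMap.range ι) G' := by
  obtain ⟨Y, rfl, hY⟩ := exists_dependent_seq (α := fun _ => ModuleCat.{0} A) (fun _ _ => True)
    (fun _ Z Z' => ∃ t : Z →ₗ[A] Z', IsExtensionStep C t) X trivial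
    (fun _ Z _ => (exists_isExtensionStep C Z).imp fun _ h => ⟨trivial, h⟩)
  choose t ht using fun n => (hY n).2
  obtain ⟨G, ι, hι, hιt, hιG, hdesc⟩ := exists_sequential_colimit Y t fun n => (ht n).injective
  refine ⟨G, ι 0, hι 0, fun c hc x hx => ?_, fun G' hG' => ?_⟩
  · have hmono : ∀ n m, n ≤ m → ∀ a, ∃ b, ι m b = ι n a := fun n m h => by
      induction m, h using Nat.le_induction with
      | base => exact fun a => ⟨a, rfl⟩
      | succ m h ih =>
        intro a
        obtain ⟨b, hb⟩ := ih a
        exact ⟨t m b, (hιt m b).trans hb⟩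
    choose n a ha using fun i => hιG (x i)
    choose b hb using fun i => hmono (n i) (Finset.univ.sup n)
      (Finset.le_sup (Finset.mem_univ i)) (a i)
    have hbx : (fun i => ι _ (b i)) = x := funext fun i => (hb i).trans (ha i)
    obtain ⟨y, hy⟩ := (ht (Finset.univ.sup n)).exists_act_eq c hc b (funext fun i => hι _ (by
      rw [map_act, hbx, hx]; simp))
    refine ⟨fun i => ι (Finset.univ.sup n + 1) (y i), funext fun i => ?_⟩
    rw [← map_act, hy, ← hbx]
    exact hιt _ _
  · obtain ⟨J, j, hJ, hj⟩ := exists_injective_embedding G'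
    have hex : Function.Exact j (LinearMap.range j).mkQ := by
      rw [LinearMap.exact_iff, Submodule.ker_mkQ]
    refine extVanish_of_injective j _ hj hex fun f _ => ?_
    let g : G →ₗ[A] _ := f ∘ₗ (LinearMap.range (ι 0)).mkQ
    let P : ∀ n : ℕ, (↥(Y n) →ₗ[A] ↥J) → Prop := fun n e =>
      ∀ x, g (ι n x) = (LinearMap.range j).mkQ (e x)
    let R : ∀ n : ℕ, (↥(Y n) →ₗ[A] ↥J) → (↥(Y (n + 1)) →ₗ[A] ↥J) → Prop := fun n e e' =>
      ∀ x, e' (t n x) = e x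
    obtain ⟨e, he0, he⟩ := exists_dependent_seq P R 0
      (fun x => by
        have : (LinearMap.range (ι 0)).mkQ (ι 0 x) = 0 :=
          (Submodule.Quotient.mk_eq_zero _).2 ⟨x, rfl⟩
        simp only [g, LinearMap.comp_apply, this]
        simp)
      (fun n e hne => by
        obtain ⟨e', h1, h2⟩ := (ht n).exists_extend G' J _ j _ hj (Submodule.mkQ_surjective _) hex
          hG' e
          (g ∘ₗ ι (n + 1)) (fun x => by rw [LinearMap.comp_apply, hιt]; exact hne x)
        exact ⟨e', fun x => (h2 x).symm, h1⟩)
    obtain ⟨e', he'⟩ := hdesc J e (fun n => (he n).2)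
    obtain ⟨e₀, he₀⟩ := exists_comp_eq_of_ker_le (LinearMap.range (ι 0)).mkQ
      (Submodule.mkQ_surjective _) e' (fun x hx => by
        obtain ⟨a, rfl⟩ := (Submodule.Quotient.mk_eq_zero _).1 hx
        exact (he' 0 a).trans (by rw [he0]; rfl))
    refine ⟨e₀, fun x => ?_⟩
    obtain ⟨x, rfl⟩ := Submodule.mkQ_surjective _ x
    rw [he₀]
    obtain ⟨n, a, rfl⟩ := hιG x
    rw [he']
    exact ((he n).1 a).symm

end Preenvelope
end SelfOrth

namespace SelfOrth

section Precover
variable {A : Type} [Ring A]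

theorem exists_projective_cover (X : ModuleCat.{0} A) :
    ∃ (L P : ModuleCat.{0} A) (i : L →ₗ[A] P) (p : P →ₗ[A] X), Module.Projective A P ∧
      Function.Injective i ∧ Function.Surjective p ∧ Function.Exact i p := by
  refine ⟨ModuleCat.of A (LinearMap.ker (Finsupp.linearCombination A (id : X → X))),
    ModuleCat.of A (X →₀ A), Submodule.subtype _, Finsupp.linearCombination A (id : X → X),
    inferInstanceAs (Module.Projective A (X →₀ A)), Submodule.subtype_injective _, fun x =>
    ⟨Finsupp.single x 1, by simp⟩, ?_⟩
  rw [LinearMap.exact_iff]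
  exact (Submodule.range_subtype _).symm

/-- `π : X' → X` solves all the systems `E y = x` with `F x = 0` for `(F, E)` in `C`, and maps from
syzygies of modules for which these systems are solvable lift along `π`. -/
structure IsLiftStep (C : Set (ExactPair A)) {X' X : ModuleCat.{0} A} (π : X' →ₗ[A] X) :
    Prop where
  surjective : Function.Surjective π
  exists_act_eq : ∀ c ∈ C, ∀ x : Fin c.q → X', act c.F x = 0 →
    ∃ y : Fin c.r → X, act c.E y = fun j => π (x j)
  exists_lift : ∀ (L P G : Type) [AddCommGroup L] [Module A L] [AddCommGroup P] [Module A P]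
    [AddCommGroup G] [Module A G] [Module.Projective A P] (i : L →ₗ[A] P) (p : P →ₗ[A] G),
    Function.Injective i → Function.Surjective p → Function.Exact i p →
    (∀ c ∈ C, ActExact c.F c.E G) → ∀ (f : L →ₗ[A] X') (e : P →ₗ[A] X),
      (∀ l, e (i l) = π (f l)) →
      ∃ e' : P →ₗ[A] X', (∀ l, e' (i l) = f l) ∧ ∀ x, π (e' x) = e x

theorem exists_isLiftStep (k : Type) [Field k] [Algebra k A] [FiniteDimensional k A]
    [Module.Injective A A] (C : Set (ExactPair A)) (X : ModuleCat.{0} A) :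
    ∃ (X' : ModuleCat.{0} A) (π : X' →ₗ[A] X), IsLiftStep C π := by
  let S := Σ c : C, {h : X →ₗ[A] (Fin c.1.q → DualReg k A) // ∀ x, dualAct k c.1.E (h x) = 0}
  have hS : ∀ (s : S) x, ∃ g, dualAct k s.1.1.F g = s.2.1 x := fun s x =>
    s.1.1.freeExact.dualExact k s.1.1.mul_eq_zero _ (s.2.2 x)
  let B := X × (∀ s : S, Fin s.1.1.p → DualReg k A)
  let pr : ∀ s : S, B →ₗ[A] (Fin s.1.1.p → DualReg k A) := fun s =>
    LinearMap.proj s ∘ₗ LinearMap.snd A X (∀ s : S, Fin s.1.1.p → DualReg k A)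
  let N : Submodule A B := ⨅ s : S, LinearMap.eqLocus (dualAct k s.1.1.F ∘ₗ pr s)
    (s.2.1 ∘ₗ LinearMap.fst A X (∀ s : S, Fin s.1.1.p → DualReg k A))
  have hN : ∀ b : B, b ∈ N ↔ ∀ s : S, dualAct k s.1.1.F (b.2 s) = s.2.1 b.1 := fun b => by
    simp only [N, Submodule.mem_iInf]
    rfl
  let π : N →ₗ[A] X := LinearMap.fst A X (∀ s : S, Fin s.1.1.p → DualReg k A) ∘ₗ N.subtype
  refine ⟨ModuleCat.of A N, π, ⟨fun x => ?_, fun c hc => ?_, ?_⟩⟩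
  · choose g hg using fun s => hS s x
    exact ⟨⟨(x, g), (hN _).2 hg⟩, rfl⟩
  · refine (act_mem_iff_dual_lift (k := k) c.F c.E π).2 fun h hh => ?_
    exact ⟨pr ⟨⟨c, hc⟩, h, hh⟩ ∘ₗ N.subtype, fun x => (hN x.1).1 x.2 ⟨⟨c, hc⟩, h, hh⟩⟩
  · intro L P G _ _ _ _ _ _ _ i p hi hp hex hG f e hfe
    have key : ∀ s : S, ∃ v : P →ₗ[A] (Fin s.1.1.p → DualReg k A),
        (∀ x, dualAct k s.1.1.F (v x) = s.2.1 (e x)) ∧ ∀ l, v (i l) = (f l).1.2 s := by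
      intro s
      obtain ⟨w, hw⟩ := exists_comp_eq_of_mem_range
        (LinearMap.range (dualAct k s.1.1.F)).subtype (Submodule.subtype_injective _)
        (s.2.1 ∘ₗ e) (fun x => by
          obtain ⟨g, hg⟩ := hS s (e x)
          exact ⟨⟨_, g, hg⟩, rfl⟩)
      obtain ⟨v, hv⟩ := Module.projective_lifting_property (dualAct k s.1.1.F).rangeRestrict w
        (LinearMap.surjective_rangeRestrict _)
      have hv' : ∀ x, dualAct k s.1.1.F (v x) = s.2.1 (e x) := fun x => by
        rw [← LinearMap.comp_apply (s.2.1) e, ← hw, ← hv]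
        rfl
      have hT := (extVanish_iff_actExact_of_dual (k := k) (X := G) s.1.1.mul_eq_zero
        (s.1.1.freeExact.dualExact k s.1.1.mul_eq_zero)
        (LinearMap.ker (dualAct k s.1.1.F)).subtype (Submodule.subtype_injective _)
        (by rw [LinearMap.exact_iff, Submodule.range_subtype])).2 (hG s.1.1 s.1.2)
      obtain ⟨u, hu⟩ := exists_comp_eq_of_mem_range
        (LinearMap.ker (dualAct k s.1.1.F)).subtype (Submodule.subtype_injective _)
        (pr s ∘ₗ N.subtype ∘ₗ f - v ∘ₗ i) (fun l => ⟨⟨_, by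
          rw [LinearMap.mem_ker, Pi.sub_apply, map_sub, LinearMap.comp_apply v, hv', hfe,
            sub_eq_zero]
          exact (hN (f l).1).1 (f l).2 s⟩, rfl⟩)
      obtain ⟨u', hu'⟩ := hT L P i p hi hp hex u
      refine ⟨v + (LinearMap.ker (dualAct k s.1.1.F)).subtype ∘ₗ u', fun x => ?_, fun l => ?_⟩
      · rw [LinearMap.add_apply, map_add, hv']
        simp [LinearMap.mem_ker.1 (u' x).2]
      · rw [LinearMap.add_apply, LinearMap.comp_apply, hu', hu]
        exact add_sub_cancel _ _
    choose v hv hvi using key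
    refine ⟨LinearMap.codRestrict N (e.prod (LinearMap.pi v)) fun x => (hN _).2 fun s => hv s x,
      fun l => Subtype.ext (Prod.ext (hfe l) (funext fun s => hvi s l)), fun x => rfl⟩

/-- In a tower of lifting steps, the solutions of `E y = 0` satisfy the Mittag-Leffler condition. -/
theorem exists_act_eq_zero_lift {C : Set (ExactPair A)} {M : ModuleCat.{0} A}
    (hM : ∀ c ∈ C, ActExact c.F c.E M) {c : ExactPair A}
    (hc : (∃ d ∈ C, ∃ p F h h', c = ⟨p, d.p, d.q, F, d.F, h, h'⟩) ∨
      ∃ π : (Fin c.r → A) →ₗ[A] M, Function.Surjective π ∧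
        Function.Exact (Matrix.vecMulLinear c.E) π)
    {X'' X' X : ModuleCat.{0} A} {π' : X'' →ₗ[A] X'} {π : X' →ₗ[A] X} (hπ' : IsLiftStep C π')
    (hπ : IsLiftStep C π) (x : Fin c.r → X') (hx : act c.E x = 0) :
    ∃ x' : Fin c.r → X'', act c.E x' = 0 ∧ ∀ i, π (π' (x' i)) = π (x i) := by
  rcases hc with ⟨d, hd, p, F, h, h', rfl⟩ | ⟨σ, hσ, hex⟩
  · obtain ⟨w, hw⟩ := hπ.exists_act_eq d hd x hx
    choose w' hw' using fun i => hπ.surjective (w i)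
    choose w'' hw'' using fun i => hπ'.surjective (w' i)
    refine ⟨act d.E w'', ?_, fun i => ?_⟩
    · rw [act_act, d.mul_eq_zero]
      ext; simp [act]
    · rw [map_act, map_act]
      simp only [hw'', hw', hw]
  · obtain ⟨e, he, he'⟩ := hπ'.exists_lift _ _ M (LinearMap.range (Matrix.vecMulLinear c.E)).subtype
      σ (Submodule.subtype_injective _) hσ
      (by rw [LinearMap.exact_iff, Submodule.range_subtype, ← LinearMap.exact_iff]; exact hex) hM 0
      (Fintype.linearCombination A x) (by
        rintro ⟨_, a, rfl⟩
        refine (linearCombination_vecMul c.E x a).trans ?_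
        rw [hx]
        simp [Fintype.linearCombination_apply])
    refine ⟨fun i => e (Pi.single i 1), funext fun i => ?_, fun i => ?_⟩
    · rw [act_map_single]
      exact he ⟨_, _, rfl⟩
    · rw [he']
      simp [Fintype.linearCombination_apply_single]

theorem exists_special_precover (k : Type) [Field k] [Algebra k A] [FiniteDimensional k A]
    [Module.Injective A A] {C : Set (ExactPair A)} {M : ModuleCat.{0} A}
    (hM : ∀ c ∈ C, ActExact c.F c.E M)
    (hC : ∀ c ∈ C, (∃ d ∈ C, ∃ p F h h', c = ⟨p, d.p, d.q, F, d.F, h, h'⟩) ∨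
      ∃ π : (Fin c.r → A) →ₗ[A] M, Function.Surjective π ∧
        Function.Exact (Matrix.vecMulLinear c.E) π) (X : ModuleCat.{0} A) :
    ∃ (G : ModuleCat.{0} A) (ρ : G →ₗ[A] X), Function.Surjective ρ ∧
      (∀ c ∈ C, ActExact c.F c.E G) ∧
      ∀ G' : ModuleCat.{0} A, (∀ c ∈ C, ActExact c.F c.E G') →
        ExtVanish A G' (LinearMap.ker ρ) := by
  obtain ⟨Y, rfl, hY⟩ := exists_dependent_seq (α := fun _ => ModuleCat.{0} A) (fun _ _ => True)
    (fun _ Z Z' => ∃ π : Z' →ₗ[A] Z, IsLiftStep C π) X trivial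
    (fun _ Z _ => (exists_isLiftStep k C Z).imp fun _ h => ⟨trivial, h⟩)
  choose π hπ using fun n => (hY n).2
  let G : Submodule A (∀ n, Y n) := ⨅ n, LinearMap.eqLocus
    (π n ∘ₗ LinearMap.proj (φ := fun n => Y n) (n + 1)) (LinearMap.proj (φ := fun n => Y n) n)
  have hG : ∀ z : ∀ n, Y n, z ∈ G ↔ ∀ n, π n (z (n + 1)) = z n := fun z => by
    simp only [G, Submodule.mem_iInf]
    rfl
  let ρ : ∀ n, G →ₗ[A] Y n := fun n => LinearMap.proj (φ := fun n => Y n) n ∘ₗ G.subtype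
  have hρ : ∀ n z, π n (ρ (n + 1) z) = ρ n z := fun n z => (hG z.1).1 z.2 n
  refine ⟨ModuleCat.of A G, ρ 0, fun x => ?_, fun c hc z hz => ?_, fun G' hG' => ?_⟩
  · obtain ⟨z, hz0, hz⟩ := exists_dependent_seq (α := fun n => Y n) (fun _ _ => True)
      (fun n a b => π n b = a) x trivial
      (fun n a _ => ((hπ n).surjective a).imp fun _ h => ⟨trivial, h⟩)
    exact ⟨⟨z, (hG z).2 fun n => (hz n).2⟩, hz0⟩
  · have hy : ∀ n, ∃ y : Fin c.r → Y n, act c.E y = fun j => ρ n (z j) := fun n => by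
      obtain ⟨y, hy⟩ := (hπ n).exists_act_eq c hc (fun j => ρ (n + 1) (z j)) (funext fun i => by
        rw [← map_act, hz]; simp)
      exact ⟨y, hy.trans (funext fun j => hρ n (z j))⟩
    let P : ∀ n, (Fin c.r → Y n) → Prop := fun n y => ∃ y' : Fin c.r → Y (n + 1),
      act c.E y' = (fun j => ρ (n + 1) (z j)) ∧ ∀ i, π n (y' i) = y i
    let R : ∀ n, (Fin c.r → Y n) → (Fin c.r → Y (n + 1)) → Prop := fun n y y' =>
      ∀ i, π n (y' i) = y i
    obtain ⟨y₁, hy₁⟩ := hy 1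
    obtain ⟨y, -, hyP⟩ := exists_dependent_seq P R (fun i => π 0 (y₁ i)) ⟨y₁, hy₁, fun i => rfl⟩ (by
      rintro n a ⟨y', hy', hya⟩
      obtain ⟨w, hw⟩ := hy (n + 2)
      obtain ⟨x, hx, hxy⟩ := exists_act_eq_zero_lift hM (hC c hc) (hπ (n + 1)) (hπ n)
        (y' - fun i => π (n + 1) (w i)) (by
          rw [act_sub, hy', sub_eq_zero]
          ext i
          rw [← map_act, hw, hρ])
      refine ⟨fun i => π (n + 1) (w i + x i), ⟨w + x, ?_, fun i => rfl⟩, fun i => ?_⟩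
      · rw [act_add, hw, hx, add_zero]
      · change π n (π (n + 1) (w i + x i)) = a i
        rw [map_add, map_add, hxy, Pi.sub_apply, map_sub, hya]
        abel)
    refine ⟨fun i => ⟨fun n => y n i, (hG _).2 fun n => (hyP n).2 i⟩, funext fun j =>
      Subtype.ext (funext fun n => ?_)⟩
    obtain ⟨y', hy', hyy'⟩ := (hyP n).1
    change ρ n (act c.E _ j) = ρ n (z j)
    rw [map_act, ← hρ n (z j), ← congrFun hy' j, map_act]
    exact congrFun (congrArg (act c.E) (funext fun i => (hyy' i).symm)) j
  · obtain ⟨L, P, i, p, hP, hi, hp, hex⟩ := exists_projective_cover G'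
    refine extVanish_of_projective i p hp hex fun f => ?_
    let Q : ∀ n : ℕ, (P →ₗ[A] Y n) → Prop := fun n e => ∀ l, e (i l) = ρ n (f l).1
    let R : ∀ n : ℕ, (P →ₗ[A] Y n) → (P →ₗ[A] Y (n + 1)) → Prop := fun n e e' =>
      ∀ x, π n (e' x) = e x
    obtain ⟨e, he0, he⟩ := exists_dependent_seq Q R 0 (fun l => (f l).2.symm) (fun n e hne => by
      obtain ⟨e', h1, h2⟩ := (hπ n).exists_lift L P G' i p hi hp hex hG'
        (ρ (n + 1) ∘ₗ (LinearMap.ker (ρ 0)).subtype ∘ₗ f) e (fun l => by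
          rw [hne l]; exact (hρ n _).symm)
      exact ⟨e', h1, h2⟩)
    refine ⟨LinearMap.codRestrict (LinearMap.ker (ρ 0)) (LinearMap.codRestrict G (LinearMap.pi e)
      fun x => (hG _).2 fun n => (he n).2 x) fun x => ?_, fun l => Subtype.ext (Subtype.ext
        (funext fun n => (he n).1 l))⟩
    exact LinearMap.congr_fun he0 x

end Precover
end SelfOrth

namespace SelfOrth

section Closure
variable {A : Type} [Ring A]

theorem exists_isSyzygySeq (X : ModuleCat.{0} A) :
    ∃ Z : ℕ → ModuleCat.{0} A, IsSyzygySeq Z ∧ Z 0 = X :=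
  ⟨_, isSyzygySeq_syzygy (projectiveResolution X), rfl⟩

theorem memG_ker {M B Y : ModuleCat.{0} A} (hB : MemG A M B) (hY : MemG A M Y) (q : B →ₗ[A] Y)
    (hq : Function.Surjective q) (H : ∀ f : M →ₗ[A] Y, ∃ g : M →ₗ[A] B, ∀ x, q (g x) = f x) :
    MemG A M (ModuleCat.of A (LinearMap.ker q)) := by
  obtain ⟨Z, hZ, rfl⟩ := exists_isSyzygySeq M
  obtain ⟨W, hW, hW0⟩ := exists_isCosyzygySeq (Z 0)
  rw [memG_iff hZ hW rfl hW0] at hB hY ⊢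
  have hex : Function.Exact (LinearMap.ker q).subtype q := by
    rw [LinearMap.exact_iff, Submodule.range_subtype]
  refine fun n => ⟨?_, ?_⟩
  · obtain ⟨P, i, p, hP, hi, hp, hip⟩ := hZ n
    refine extVanish_of_projective i p hp hip fun h => ?_
    obtain ⟨e, he⟩ := (hB n).1 _ _ i p hi hp hip ((LinearMap.ker q).subtype ∘ₗ h)
    obtain ⟨e₀, he₀⟩ := exists_comp_eq_of_ker_le p hp (q ∘ₗ e) (fun x hx => by
      obtain ⟨l, rfl⟩ := (hip x).1 hx
      rw [LinearMap.comp_apply, he]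
      exact (h l).2)
    have hg : ∃ g : Z n →ₗ[A] B, ∀ x, q (g x) = e₀ x := by
      cases n with
      | zero => exact H e₀
      | succ n =>
        obtain ⟨P', i', p', hP', hi', hp', hip'⟩ := hZ n
        obtain ⟨u, hu⟩ := (hY n).1 _ _ i' p' hi' hp' hip' e₀
        obtain ⟨v, hv⟩ := Module.projective_lifting_property q u hq
        exact ⟨v ∘ₗ i', fun x => (LinearMap.congr_fun hv (i' x)).trans (hu x)⟩
    obtain ⟨g, hg⟩ := hg
    refine ⟨LinearMap.codRestrict (LinearMap.ker q) (e - g ∘ₗ p) fun x => ?_, fun l =>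
      Subtype.ext ?_⟩
    · rw [LinearMap.mem_ker, LinearMap.sub_apply, map_sub, LinearMap.comp_apply, hg, he₀]
      exact sub_self _
    · rw [LinearMap.codRestrict_apply, LinearMap.sub_apply, LinearMap.comp_apply,
        hip.apply_apply_eq_zero, map_zero, sub_zero, he]
      rfl
  · obtain ⟨J, j, s, hJ, hj, hs, hjs⟩ := hW n
    refine extVanish_of_injective j s hj hjs fun f _ => ?_
    obtain ⟨e, he⟩ := (hY (n + 1)).2 _ _ _ q (Submodule.subtype_injective _) hq hex f
    obtain ⟨g, hg⟩ := (hB n).2.exists_lift j s hj hjs e fun x => hs _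
    exact ⟨g ∘ₗ (LinearMap.ker q).subtype, fun x => (hg _).trans (he x)⟩

theorem memG_quotient {M B Y : ModuleCat.{0} A} (hB : MemG A M B) (hY : MemG A M Y)
    (j : Y →ₗ[A] B) (hj : Function.Injective j)
    (H : ∀ f : Y →ₗ[A] M, ∃ g : B →ₗ[A] M, ∀ x, g (j x) = f x) :
    MemG A M (ModuleCat.of A (B ⧸ LinearMap.range j)) := by
  obtain ⟨W, hW, rfl⟩ := exists_isCosyzygySeq M
  obtain ⟨Z, hZ, hZ0⟩ := exists_isSyzygySeq (W 0)
  rw [memG_iff hZ hW hZ0 rfl] at hB hY ⊢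
  have hex : Function.Exact j (LinearMap.range j).mkQ := by
    rw [LinearMap.exact_iff, Submodule.ker_mkQ]
  have hsurj : Function.Surjective (LinearMap.range j).mkQ := Submodule.mkQ_surjective _
  refine fun n => ⟨?_, ?_⟩
  · obtain ⟨P, i, p, hP, hi, hp, hip⟩ := hZ n
    refine extVanish_of_projective i p hp hip fun h => ?_
    obtain ⟨g, hg⟩ := (hY (n + 1)).1.exists_lift j _ hj hex h fun x => hsurj _
    obtain ⟨e, he⟩ := (hB n).1 _ _ i p hi hp hip g
    exact ⟨(LinearMap.range j).mkQ ∘ₗ e, fun l => by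
      rw [LinearMap.comp_apply, he]; exact hg l⟩
  · obtain ⟨J, i, s, hJ, hi, hs, his⟩ := hW n
    refine extVanish_of_injective i s hi his fun f _ => ?_
    obtain ⟨g, hg⟩ := (hB n).2.exists_lift i s hi his (f ∘ₗ (LinearMap.range j).mkQ) fun x => hs _
    obtain ⟨e₀, he₀⟩ := exists_comp_eq_of_mem_range i hi (g ∘ₗ j) (fun y => (his _).1 (by
      rw [LinearMap.comp_apply, hg, LinearMap.comp_apply, hex.apply_apply_eq_zero, map_zero]))
    have hu : ∃ u : B →ₗ[A] W n, ∀ y, u (j y) = e₀ y := by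
      cases n with
      | zero => exact H e₀
      | succ n =>
        obtain ⟨J', i', s', hJ', hi', hs', his'⟩ := hW n
        obtain ⟨v, hv⟩ := (hY n).2.exists_lift i' s' hi' his' e₀ fun x => hs' _
        obtain ⟨u, hu⟩ := Module.Injective.out j hj v
        exact ⟨s' ∘ₗ u, fun y => by rw [LinearMap.comp_apply, hu, hv]⟩
    obtain ⟨u, hu⟩ := hu
    obtain ⟨w, hw⟩ := exists_comp_eq_of_ker_le (LinearMap.range j).mkQ hsurj (g - i ∘ₗ u)
      (fun x hx => by
        obtain ⟨y, rfl⟩ := (hex x).1 hx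
        rw [LinearMap.sub_apply, LinearMap.comp_apply, hu, he₀]
        exact sub_self _)
    refine ⟨w, fun x => ?_⟩
    obtain ⟨x, rfl⟩ := hsurj x
    rw [hw, LinearMap.sub_apply, map_sub, hg, LinearMap.comp_apply i, his.apply_apply_eq_zero,
      sub_zero]
    rfl

end Closure

section Additive
variable {A : Type} [Ring A] {p q r : ℕ} {F : Matrix (Fin p) (Fin q) A}
  {E : Matrix (Fin q) (Fin r) A} {X Y B : Type} [AddCommGroup X] [Module A X] [AddCommGroup Y]
  [Module A Y] [AddCommGroup B] [Module A B]

theorem ActExact.of_retract (H : ActExact F E B) (s : Y →ₗ[A] B) (t : B →ₗ[A] Y)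
    (h : ∀ y, t (s y) = y) : ActExact F E Y := fun x hx => by
  obtain ⟨y, hy⟩ := H (fun i => s (x i)) (funext fun i => by rw [← map_act, hx]; simp)
  exact ⟨fun i => t (y i), funext fun i => by rw [← map_act, hy, h]⟩

theorem ActExact.pi (H : ActExact F E X) (I : Type) : ActExact F E (I → X) := fun x hx => by
  choose y hy using fun i => H (fun j => x j i) (funext fun l => by
    have := map_act (LinearMap.proj (φ := fun _ : I => X) (R := A) i) F x l
    rw [hx] at this
    exact this.symm)
  exact ⟨fun j i => y i j, funext fun l => funext fun i =>
    (map_act (LinearMap.proj (φ := fun _ : I => X) (R := A) i) E _ l).trans (congrFun (hy i) l)⟩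

theorem ActExact.finsupp (H : ActExact F E X) (I : Type) : ActExact F E (I →₀ X) := by
  classical
  intro x hx
  have key : ∀ i, ∃ y, act E y = (fun j => x j i) ∧ ((∀ j, x j i = 0) → y = 0) := fun i => by
    by_cases h : ∀ j, x j i = 0
    · exact ⟨0, by rw [act_zero]; exact funext fun j => (h j).symm, fun _ => rfl⟩
    · obtain ⟨y, hy⟩ := H (fun j => x j i) (funext fun l => by
        have := map_act (Finsupp.lapply (R := A) i) F x l
        rw [hx] at this
        exact this.symm)
      exact ⟨y, hy, fun h' => absurd h' h⟩
  choose y hy hy0 using key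
  refine ⟨fun j => Finsupp.onFinset (Finset.univ.biUnion fun l => (x l).support) (fun i => y i j)
    fun i hi => ?_, funext fun l => Finsupp.ext fun i => ?_⟩
  · by_contra h
    refine hi (congrFun (hy0 i fun l => ?_) j)
    by_contra hl
    exact h (Finset.mem_biUnion.2 ⟨l, Finset.mem_univ _, Finsupp.mem_support_iff.2 hl⟩)
  · exact (map_act (Finsupp.lapply (R := A) i) E _ l).trans (congrFun (hy i) l)

theorem ExtVanish.of_retract_right (H : ExtVanish A X B) (s : Y →ₗ[A] B) (t : B →ₗ[A] Y)
    (h : ∀ y, t (s y) = y) : ExtVanish A X Y := by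
  intro L Q _ _ _ _ i p hi hp hex f
  obtain ⟨e, he⟩ := H L Q i p hi hp hex (s ∘ₗ f)
  exact ⟨t ∘ₗ e, fun l => by simp [he, h]⟩

theorem ExtVanish.pi_right (H : ExtVanish A X Y) (I : Type) : ExtVanish A X (I → Y) := by
  intro L Q _ _ _ _ i p hi hp hex f
  choose e he using fun a : I => H L Q i p hi hp hex (LinearMap.proj a ∘ₗ f)
  exact ⟨LinearMap.pi e, fun l => funext fun a => he a l⟩

theorem ExtVanish.of_retract_left (H : ExtVanish A B X) (s : Y →ₗ[A] B) (t : B →ₗ[A] Y)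
    (h : ∀ y, t (s y) = y) : ExtVanish A Y X := by
  obtain ⟨J, j, hJ, hj⟩ := exists_injective_embedding (ModuleCat.of A X)
  have hex : Function.Exact j (LinearMap.range j).mkQ := by
    rw [LinearMap.exact_iff, Submodule.ker_mkQ]
  refine extVanish_of_injective (J := J) j _ hj hex fun f _ => ?_
  obtain ⟨g, hg⟩ := H.exists_lift (J := J) j _ hj hex (f ∘ₗ t) fun x => Submodule.mkQ_surjective _ _
  exact ⟨g ∘ₗ s, fun y => by rw [LinearMap.comp_apply, hg, LinearMap.comp_apply, h]⟩

theorem ExtVanish.finsupp_left (H : ExtVanish A Y X) (I : Type) : ExtVanish A (I →₀ Y) X := by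
  obtain ⟨J, j, hJ, hj⟩ := exists_injective_embedding (ModuleCat.of A X)
  have hex : Function.Exact j (LinearMap.range j).mkQ := by
    rw [LinearMap.exact_iff, Submodule.ker_mkQ]
  refine extVanish_of_injective (J := J) j _ hj hex fun f _ => ?_
  choose g hg using fun i : I => H.exists_lift (J := J) j _ hj hex (f ∘ₗ Finsupp.lsingle i)
    fun x => Submodule.mkQ_surjective _ _
  refine ⟨Finsupp.lsum ℕ g, fun x => ?_⟩
  refine LinearMap.congr_fun (f := (LinearMap.range j).mkQ ∘ₗ Finsupp.lsum ℕ g) (g := f)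
    (Finsupp.lhom_ext fun i y => ?_) x
  simpa using hg i y

theorem memAddBig_iff_retract (M Y : ModuleCat.{0} A) : MemAddBig A M Y ↔
    ∃ (I : Type) (s : Y →ₗ[A] (I →₀ M)) (t : (I →₀ M) →ₗ[A] Y), ∀ y, t (s y) = y := by
  constructor
  · rintro ⟨I, Y', ⟨e⟩⟩
    exact ⟨I, e.toLinearMap ∘ₗ LinearMap.inl A Y Y', LinearMap.fst A Y Y' ∘ₗ e.symm.toLinearMap,
      fun y => by simp⟩
  · rintro ⟨I, s, t, h⟩
    refine ⟨I, ModuleCat.of A (LinearMap.ker t), ⟨LinearEquiv.ofBijective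
      (s.coprod (LinearMap.ker t).subtype) ⟨(injective_iff_map_eq_zero _).2 ?_, fun b => ?_⟩⟩⟩
    · rintro ⟨y, z⟩ hyz
      have hyz : s y + z.1 = 0 := hyz
      have hy : y = 0 := by
        have := congrArg t hyz
        rwa [map_add, h, LinearMap.mem_ker.1 z.2, add_zero, map_zero] at this
      subst hy
      rw [map_zero, zero_add] at hyz
      exact Prod.ext rfl (Subtype.ext hyz)
    · exact ⟨(t b, ⟨b - s (t b), by rw [LinearMap.mem_ker, map_sub, h, sub_self]⟩),
        add_sub_cancel _ _⟩

end Additive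

/-- A power of a finitely generated module is a direct sum of copies of it. -/
theorem exists_finsupp_equiv_pi (k : Type) {A : Type} [Field k] [Ring A] [Algebra k A]
    [FiniteDimensional k A] (M : Type) [AddCommGroup M] [Module A M] [Module.Finite A M]
    (I : Type) : ∃ J : Type, Nonempty (I ↪ J) ∧ Nonempty ((J →₀ M) ≃ₗ[A] (I → M)) := by
  classical
  let := Module.compHom M (algebraMap k A)
  have := isScalarTower_compHom k A M
  have : SMulCommClass k A M := IsScalarTower.to_smulCommClass
  have : Module.Finite k M := Module.Finite.trans A M
  let b := Module.finBasis k M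
  have hli : LinearIndepOn k id (Set.range fun i : I => (Pi.single i 1 : I → k)) :=
    (Pi.linearIndependent_single_one I k).linearIndepOn_id
  let v := Module.Basis.extend hli
  refine ⟨_, ⟨⟨fun i => ⟨Pi.single i 1, hli.subset_extend (Set.subset_univ _) ⟨i, rfl⟩⟩,
    fun i j hij => ?_⟩⟩, ⟨LinearEquiv.ofBijective
      (LinearMap.pi fun i => Finsupp.lsum ℕ fun j => (v j i) • (LinearMap.id : M →ₗ[A] M))
      ⟨(injective_iff_map_eq_zero _).2 fun f hf => ?_, fun g => ?_⟩⟩⟩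
  · have := congrFun (congrArg Subtype.val hij) i
    by_contra h
    simp [h] at this
  · have key : ∀ t, v.repr.symm (f.mapRange (b.coord t) (map_zero _)) = 0 := fun t =>
      funext fun i => by
        have := congrArg (b.coord t) (congrFun hf i)
        rw [Module.Basis.repr_symm_apply, Finsupp.linearCombination_apply,
          Finsupp.sum_mapRange_index (by simp)]
        simpa [Finsupp.sum, Finset.sum_apply, mul_comm] using this
    ext j
    refine b.ext_elem fun t => ?_
    have := DFunLike.congr_fun ((LinearEquiv.map_eq_zero_iff _).1 (key t)) j
    simpa using this
  · refine ⟨∑ t, (v.repr fun i => b.coord t (g i)).mapRange (fun c => c • b t) (zero_smul _ _),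
      funext fun i => ?_⟩
    rw [map_sum, Finset.sum_apply]
    have : ∀ t, (LinearMap.pi fun i => Finsupp.lsum ℕ fun j => (v j i) • (LinearMap.id : M →ₗ[A] M))
        ((v.repr fun i => b.coord t (g i)).mapRange (fun c => c • b t) (zero_smul _ _)) i =
        b.coord t (g i) • b t := fun t => by
      conv_rhs => rw [← congrFun (v.linearCombination_repr fun i => b.coord t (g i)) i]
      rw [LinearMap.pi_apply, Finsupp.lsum_apply, Finsupp.sum_mapRange_index (by simp)]
      simp [Finsupp.linearCombination_apply, Finsupp.sum,
        Finset.sum_apply, Finset.sum_smul, smul_smul, mul_comm]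
    simp only [this]
    exact b.sum_repr (g i)

end SelfOrth

namespace SelfOrth

section AddClass
variable {A : Type} [Ring A] {M : ModuleCat.{0} A}

theorem IsGen.exists_retract (hgen : IsGen A M) :
    ∃ (n : ℕ) (s : A →ₗ[A] (Fin n → M)) (t : (Fin n → M) →ₗ[A] A), ∀ a, t (s a) = a := by
  obtain ⟨n, Y, ⟨e⟩⟩ := hgen
  exact ⟨n, e.toLinearMap ∘ₗ LinearMap.inl A A Y, LinearMap.fst A A Y ∘ₗ e.symm.toLinearMap,
    fun a => by simp⟩

/-- The canonical map from a sum of copies of a generator is surjective. -/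
theorem IsGen.lsum_surjective (hgen : IsGen A M) (Y : ModuleCat.{0} A) :
    Function.Surjective (Finsupp.lsum ℕ fun f : M →ₗ[A] Y => f) := fun y => by
  obtain ⟨n, s, t, hst⟩ := IsGen.exists_retract hgen
  let g : Fin n → M →ₗ[A] Y := fun i =>
    LinearMap.toSpanSingleton A Y y ∘ₗ t ∘ₗ LinearMap.single A (fun _ => M) i
  refine ⟨∑ i, Finsupp.single (g i) (s 1 i), ?_⟩
  have h1 : ∑ i, t (Pi.single i (s 1 i)) = 1 := by
    rw [← map_sum, Finset.univ_sum_single, hst]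
  rw [map_sum]
  simp [g, ← Finset.sum_smul, h1]

/-- The canonical map to a product of copies of a generator is injective. -/
theorem IsGen.pi_injective (k : Type) [Field k] [Algebra k A] [FiniteDimensional k A]
    [Module.Injective A A] (hgen : IsGen A M) (Y : ModuleCat.{0} A) :
    Function.Injective (LinearMap.pi fun f : Y →ₗ[A] M => f) :=
  (injective_iff_map_eq_zero _).2 fun y hy => by
    obtain ⟨n, s, t, hst⟩ := IsGen.exists_retract hgen
    by_contra hy0
    obtain ⟨f, hf⟩ := exists_map_ne_zero k (A := A) hy0
    refine hf ?_
    have : s (f y) = 0 := funext fun i => congrFun hy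
      (LinearMap.proj (φ := fun _ => M) i ∘ₗ s ∘ₗ f)
    rw [← hst (f y), this, map_zero]

theorem extVanish_of_memAddBig_left {Y G : ModuleCat.{0} A} (hY : MemAddBig A M Y)
    (hG : ExtVanish A M G) : ExtVanish A Y G := by
  obtain ⟨I, s, t, hst⟩ := (memAddBig_iff_retract M Y).1 hY
  exact (hG.finsupp_left I).of_retract_left s t hst

variable (k : Type) [Field k] [Algebra k A] [FiniteDimensional k A] [Module.Finite A M]
include k

theorem extVanish_of_memAddBig_right {Y G : ModuleCat.{0} A} (hY : MemAddBig A M Y)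
    (hG : ExtVanish A G M) : ExtVanish A G Y := by
  obtain ⟨I, s, t, hst⟩ := (memAddBig_iff_retract M Y).1 hY
  obtain ⟨J, ⟨u⟩, ⟨e⟩⟩ := exists_finsupp_equiv_pi k (A := A) M I
  have hJ : ExtVanish A G (J →₀ M) :=
    (hG.pi_right I).of_retract_right e.toLinearMap e.symm.toLinearMap (fun x => by simp)
  exact (hJ.of_retract_right (Finsupp.lmapDomain M A u) (Finsupp.lcomapDomain u u.injective)
    fun x => by
      ext i
      simp [Finsupp.lcomapDomain, Finsupp.mapDomain_apply u.injective]).of_retract_right s t hst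

variable [Module.Injective A A]

theorem memG_of_memAddBig (hM : MemG A M M) {Y : ModuleCat.{0} A} (hY : MemAddBig A M Y) :
    MemG A M Y := by
  obtain ⟨C, hC, -⟩ := exists_exactPairs k M
  obtain ⟨I, s, t, hst⟩ := (memAddBig_iff_retract M Y).1 hY
  exact (hC Y).2 fun c hc => (((hC M).1 hM c hc).finsupp I).of_retract s t hst

theorem memAddBig_of_extVanish_left (hgen : IsGen A M) (hM : MemG A M M) {Y : ModuleCat.{0} A}
    (hY : MemG A M Y) (H : ∀ G : ModuleCat.{0} A, MemG A M G → ExtVanish A Y G) :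
    MemAddBig A M Y := by
  let B := ModuleCat.of A ((M →ₗ[A] Y) →₀ M)
  let q : B →ₗ[A] Y := Finsupp.lsum ℕ fun f : M →ₗ[A] Y => f
  have hq : Function.Surjective q := IsGen.lsum_surjective hgen Y
  have hB : MemG A M B := memG_of_memAddBig k hM
    ((memAddBig_iff_retract M B).2 ⟨_, LinearMap.id, LinearMap.id, fun _ => rfl⟩)
  have hK := memG_ker hB hY q hq fun f => ⟨Finsupp.lsingle f, fun x =>
    (Finsupp.lsum_single ℕ (fun f : M →ₗ[A] Y => f) f x)⟩
  obtain ⟨s, hs⟩ := (H _ hK).exists_lift (LinearMap.ker q).subtype q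
    (Submodule.subtype_injective _) (by rw [LinearMap.exact_iff, Submodule.range_subtype])
    LinearMap.id fun y => hq y
  exact (memAddBig_iff_retract M Y).2 ⟨_, s, q, hs⟩

theorem memAddBig_of_extVanish_right (hgen : IsGen A M) (hM : MemG A M M) {Y : ModuleCat.{0} A}
    (hY : MemG A M Y) (H : ∀ G : ModuleCat.{0} A, MemG A M G → ExtVanish A G Y) :
    MemAddBig A M Y := by
  obtain ⟨C, hC, -⟩ := exists_exactPairs k M
  let B := ModuleCat.of A ((Y →ₗ[A] M) → M)
  let j : Y →ₗ[A] B := LinearMap.pi fun f : Y →ₗ[A] M => f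
  have hj : Function.Injective j := IsGen.pi_injective k hgen Y
  have hB : MemG A M B := (hC B).2 fun c hc => ((hC M).1 hM c hc).pi _
  have hQ := memG_quotient hB hY j hj fun f =>
    ⟨LinearMap.proj (φ := fun _ : Y →ₗ[A] M => M) f, fun x => rfl⟩
  obtain ⟨t, ht⟩ := H _ hQ Y B j (LinearMap.range j).mkQ hj (Submodule.mkQ_surjective _)
    (by rw [LinearMap.exact_iff, Submodule.ker_mkQ]) LinearMap.id
  obtain ⟨J, -, ⟨e⟩⟩ := exists_finsupp_equiv_pi k (A := A) M (Y →ₗ[A] M)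
  exact (memAddBig_iff_retract M Y).2 ⟨J, e.symm.toLinearMap ∘ₗ j, t ∘ₗ e.toLinearMap,
    fun y => by
      have : e (e.symm (j y)) = j y := e.apply_symm_apply _
      exact (congrArg t this).trans (ht y)⟩

end AddClass
end SelfOrth

/-- **Lemma 3.13(2)**. `(𝒢, 𝒢^{⊥1})` and `(^{⊥1}𝒢, 𝒢)` are cotorsion pairs in `A`-Mod, and
`𝒢 ∩ 𝒢^{⊥1} = Add M = ^{⊥1}𝒢 ∩ 𝒢`. -/
theorem G_cotorsion_pairs
    (k A : Type) [Field k] [Ring A] [Algebra k A] [FiniteDimensional k A]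
    [Module.Injective A A]
    (M : ModuleCat.{0} A) [Module.Finite A ↥M]
    (hgen : IsGen A M) (hso : SelfOrthogonal A M) :
    (∀ X : ModuleCat.{0} A,
      (∃ (K G : ModuleCat.{0} A) (f : K ⟶ G) (g : G ⟶ X), Function.Injective f ∧
        Function.Surjective g ∧ LinearMap.range f.hom = LinearMap.ker g.hom ∧ MemG A M G ∧
        (∀ G' : ModuleCat.{0} A, MemG A M G' → extZero A 1 G' K)) ∧
      (∃ (G' C' : ModuleCat.{0} A) (f : X ⟶ G') (g : G' ⟶ C'), Function.Injective f ∧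
        Function.Surjective g ∧ LinearMap.range f.hom = LinearMap.ker g.hom ∧ MemG A M G' ∧
        (∀ G'' : ModuleCat.{0} A, MemG A M G'' → extZero A 1 C' G''))) ∧
    (∀ Y : ModuleCat.{0} A,
      (MemG A M Y ∧ ∀ G' : ModuleCat.{0} A, MemG A M G' → extZero A 1 G' Y) ↔
        MemAddBig A M Y) ∧
    (∀ Y : ModuleCat.{0} A,
      (MemG A M Y ∧ ∀ G' : ModuleCat.{0} A, MemG A M G' → extZero A 1 Y G') ↔
        MemAddBig A M Y) := by
  have hM : MemG A M M := fun n hn => ⟨hso n hn, hso n hn⟩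
  have hMG : ∀ G, MemG A M G → SelfOrth.ExtVanish A M G ∧ SelfOrth.ExtVanish A G M := fun G hG =>
    ⟨(SelfOrth.extZero_one_iff M G).1 (hG 1 le_rfl).1,
      (SelfOrth.extZero_one_iff G M).1 (hG 1 le_rfl).2⟩
  obtain ⟨C, hC, hCM⟩ := SelfOrth.exists_exactPairs k M
  refine ⟨fun X => ⟨?_, ?_⟩, fun Y => ⟨fun ⟨hY, H⟩ => ?_, fun hY => ?_⟩,
    fun Y => ⟨fun ⟨hY, H⟩ => ?_, fun hY => ?_⟩⟩
  · obtain ⟨G, ρ, hρ, hG, hK⟩ := SelfOrth.exists_special_precover k ((hC M).1 hM) hCM X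
    exact ⟨ModuleCat.of A (LinearMap.ker ρ), G, ModuleCat.ofHom (LinearMap.ker ρ).subtype,
      ModuleCat.ofHom ρ, Submodule.subtype_injective _, hρ, Submodule.range_subtype _,
      (hC G).2 hG, fun G' hG' => (SelfOrth.extZero_one_iff _ _).2 (hK G' ((hC G').1 hG'))⟩
  · obtain ⟨G, ι, hι, hG, hK⟩ := SelfOrth.exists_special_preenvelope C X
    exact ⟨G, ModuleCat.of A (G ⧸ LinearMap.range ι), ModuleCat.ofHom ι,
      ModuleCat.ofHom (LinearMap.range ι).mkQ, hι, Submodule.mkQ_surjective _,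
      (Submodule.ker_mkQ _).symm, (hC G).2 hG,
      fun G' hG' => (SelfOrth.extZero_one_iff _ _).2 (hK G' ((hC G').1 hG'))⟩
  · exact SelfOrth.memAddBig_of_extVanish_right k hgen hM hY fun G hG =>
      (SelfOrth.extZero_one_iff G Y).1 (H G hG)
  · exact ⟨SelfOrth.memG_of_memAddBig k hM hY, fun G hG => (SelfOrth.extZero_one_iff G Y).2
      (SelfOrth.extVanish_of_memAddBig_right k hY (hMG G hG).2)⟩
  · exact SelfOrth.memAddBig_of_extVanish_left k hgen hM hY fun G hG =>
      (SelfOrth.extZero_one_iff Y G).1 (H G hG)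
  · exact ⟨SelfOrth.memG_of_memAddBig k hM hY, fun G hG => (SelfOrth.extZero_one_iff Y G).2
      (SelfOrth.extVanish_of_memAddBig_left hY (hMG G hG).1)⟩
end
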